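/- Let A_n := min{k : s_{n,k} > 0}, B_n := max{k : s_{n,k} > 0}, ε_- := liminf_{n→∞} A_n/n and ε_+ := limsup_{n→∞} B_n/n. Then for every ε ∈ (ε_-, ε_+), the entropy function of ternary square-free words P(ε) := inf_{0<q<∞} { F(q) − ε log q } is finite and concave on (ε_-, ε_+), and there exists a sequence of integers σ_n with σ_n/n → 0 such that lim_{n→∞} (1/n) log s_{n, ⌊εn⌋ + σ_n} = P(ε). -/

import Mathlib

/-- A word `w` is square-free if whenever `w = x ++ y ++ y ++ z`,
then `y` is the empty word. -/
def SquareFree {α : Type*} (w : List α) : Prop :=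
  ∀ x y z : List α, w = x ++ y ++ y ++ z → y = []

/-- `s2 n k` is the number of ternary square-free words of length `n`
containing exactly `k` occurrences of the letter `a` (here `0 : Fin 3`). -/
noncomputable def s2 (n k : ℕ) : ℕ :=
  Nat.card {w : List (Fin 3) // w.length = n ∧ SquareFree w ∧ w.count 0 = k}

/-- The weighted counting polynomial `s_n(q) = Σ_{k=0}^{n} s_{n,k} q^k`. -/
noncomputable def sPoly (n : ℕ) (q : ℝ) : ℝ :=
  ∑ k ∈ Finset.range (n + 1), (s2 n k : ℝ) * q ^ k



namespace TSF

/-- context trees -/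
inductive CT
  | L (v p : ℕ)
  | N (a b : CT)
  | A (a : CT)
  | B (b : CT)

noncomputable def CT.step (T : CT) (e : Bool) : CT :=
  CT.rec (motive := fun _ => CT) (fun v p => .L v p)
    (fun a b _ _ => Bool.rec (motive := fun _ => CT) b a e)
    (fun a _ => Bool.rec (motive := fun _ => CT) (.L 0 0) a e)
    (fun b _ => Bool.rec (motive := fun _ => CT) b (.L 0 0) e) T

noncomputable def bor (a b : Bool) : Bool := Bool.rec (motive := fun _ => Bool) b true a
noncomputable def band (a b : Bool) : Bool := Bool.rec (motive := fun _ => Bool) false b a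

/-- force evaluation of a natural number in the kernel -/
noncomputable def force (n : ℕ) (k : ℕ → Bool) : Bool :=
  Nat.rec (motive := fun _ => Bool) (k 0) (fun m _ => k (Nat.succ m)) n

/-- the moduli `4 ^ P` -/
def mods : List ℕ := [4, 16, 64, 256, 1024, 4096, 16384, 65536, 262144, 1048576, 4194304, 16777216,
  67108864, 268435456, 1073741824, 4294967296, 17179869184, 68719476736, 274877906944,
  1099511627776, 4398046511104, 17592186044416, 70368744177664, 281474976710656]

/-- some visible square at the head of the packed word `w` -/
noncomputable def anyS (w : ℕ) (ms : List ℕ) : Bool :=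
  List.rec (motive := fun _ => Bool) false
    (fun m _ ih => bor (Nat.beq (Nat.mod w m) (Nat.mod (Nat.div w m) m)) ih) ms

/-- mismatches are visible for all periods -/
noncomputable def noS (r M : ℕ) (ms : List ℕ) : Bool :=
  List.rec (motive := fun _ => Bool) true
    (fun m _ ih => Bool.rec (motive := fun _ => Bool) ih false
      (Nat.beq (Nat.mod (Nat.mod r (Nat.div M m)) m) (Nat.mod (Nat.div r m) m))) ms

noncomputable def low (r M v : ℕ) (ms : List ℕ) : ℕ :=
  Bool.rec (motive := fun _ => ℕ)
    (Bool.rec (motive := fun _ => ℕ) 0 v (noS r M ms)) 0 (Nat.beq v 0)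

noncomputable def leafOk (r M v0 p0 v1 p1 v2 p2 : ℕ) : Bool :=
  let r1 := Nat.add 1 (Nat.mul 4 r)
  let r2 := Nat.add 3 (Nat.mul 4 r)
  let M' := Nat.mul 4 M
  band (Nat.ble 281474976710656 M) <|
  force (low r1 M' v1 mods) fun a =>
  force (low r2 M' v2 mods) fun b =>
  band (Nat.ble (Nat.mul 12565 v0) (Nat.mul 10000 (Nat.add a b)))
    (band (bor (band (Nat.ble (Nat.mul 10 (Nat.add 11 p0)) (Nat.add b (Nat.mul 10 p1)))
        (Nat.ble (Nat.add 11 p0) (Nat.add 50 p1))) (anyS r1 mods))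
     (bor (band (Nat.ble (Nat.mul 10 (Nat.add 11 p0)) (Nat.add a (Nat.mul 10 p2)))
        (Nat.ble (Nat.add 11 p0) (Nat.add 50 p2))) (anyS r2 mods)))

/-- weight in the hub certificate -/
noncomputable def upw (r v : ℕ) : ℕ :=
  Bool.rec (motive := fun _ => ℕ)
    (Bool.rec (motive := fun _ => ℕ) v 0 (anyS r mods)) 0 (Nat.beq v 0)

noncomputable def hubOk (r _M v0 _p0 v1 _p1 v2 _p2 : ℕ) : Bool :=
  bor (Nat.beq v0 0) (Nat.ble
    (Nat.mul 10000 (Nat.add (upw (Nat.add 1 (Nat.mul 4 r)) v1) (upw (Nat.add 3 (Nat.mul 4 r)) v2)))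
    (Nat.mul 12088 v0))

noncomputable def tryLeaf (lf : ℕ → ℕ → ℕ → ℕ → ℕ → ℕ → ℕ → ℕ → Bool) (r M : ℕ) (T0 T1 T2 : CT) : Bool :=
  CT.rec (motive := fun _ => Bool) (fun v0 p0 =>
    CT.rec (motive := fun _ => Bool) (fun v1 p1 =>
      CT.rec (motive := fun _ => Bool) (fun v2 p2 =>
        lf r M v0 p0 v1 p1 v2 p2)
        (fun _ _ _ _ => false) (fun _ _ => false) (fun _ _ => false) T2)
      (fun _ _ _ _ => false) (fun _ _ => false) (fun _ _ => false) T1)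
    (fun _ _ _ _ => false) (fun _ _ => false) (fun _ _ => false) T0

/-- depth first search over left contexts; `w` is the packed word in natural order, `r` reversed,
`M = 4 ^ length` -/
noncomputable def dfs (lf : ℕ → ℕ → ℕ → ℕ → ℕ → ℕ → ℕ → ℕ → Bool) (n : ℕ) : ℕ → ℕ → ℕ → CT → CT → CT → Bool :=
  Nat.rec (motive := fun _ => ℕ → ℕ → ℕ → CT → CT → CT → Bool) (fun _ _ _ _ _ _ => false)
    (fun _ ih w r M T0 T1 T2 =>
      let ext (d : ℕ) : Bool :=
        force (Nat.add d (Nat.mul 4 w)) fun w' =>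
          bor (anyS w' mods)
            (force (Nat.add r (Nat.mul d M)) fun r' =>
             force (Nat.mul 4 M) fun M' =>
              (fun e => ih w' r' M' (T0.step e) (T1.step e) (T2.step e))
                (Nat.beq (Nat.mod (Nat.div w 4) 4) d))
      bor (tryLeaf lf r M T0 T1 T2) (band (ext 1) (band (ext 2) (ext 3)))) n

end TSF


namespace TSF
open CT

def vt0 : CT :=
  N (B (B (N (B (N (B (B (N (B (N (L 0 33) (L 417 67))) (L 417 67)))) (N (L 549 82) (A (B (N (L
  549 82) (N (L 549 82) (A (B (N (B (B (N (B (N (B (B (N (B (N (L 353 33) (L 549 82))) (L 549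
  82)))) (L 549 82))) (L 549 82)))) (L 549 82))))))))))) (A (B (N (B (B (B (A (B (N (B (B (N (B (N
  (B (B (A (B (N (B (B (N (L 353 60) (L 0 93)))) (L 481 50)))))) (L 481 50))) (L 481 50)))) (L 542
  82))))))) (N (L 547 82) (A (B (N (L 547 82) (A (B (N (B (B (N (B (N (B (B (N (B (N (B (B (N (L
  425 73) (L 0 33)))) (L 503 82))) (L 547 82)))) (L 547 82))) (L 547 82)))) (L 547
  82)))))))))))))) (N (B (A (B (B (N (L 588 82) (A (B (N (L 579 82) (N (B (N (B (B (N (B (N (B (B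
  (N (B (N (L 470 82) (N (L 0 93) (L 470 82)))) (L 470 82)))) (L 543 82))) (L 579 82)))) (L 579
  82))) (L 579 82)))))))))) (A (B (N (B (B (N (B (N (L 584 82) (N (B (A (B (B (N (B (N (B (B (N (B
  (N (L 491 82) (N (L 491 82) (L 0 33)))) (L 491 82)))) (L 551 82))) (L 571 82)))))) (L 584 82))))
  (A (B (N (L 588 82) (N (L 588 82) (A (B (N (B (B (N (B (N (B (B (N (B (N (L 588 82) (N (L 588
  82) (L 391 33)))) (L 588 82)))) (L 588 82))) (L 588 82)))) (L 588 82))))))))))) (N (B (N (L 585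
  82) (B (A (B (N (L 585 82) (N (B (N (B (B (N (B (N (B (B (N (B (N (L 544 82) (N (L 544 82) (A (B
  (N (L 467 82) (N (L 0 33) (L 370 66)))))))) (L 544 82)))) (L 544 82))) (L 576 82)))) (L 582
  82))) (L 585 82)))))))) (A (B (N (B (B (N (B (N (B (B (N (B (N (B (B (N (B (N (L 526 67) (N (L
  526 67) (A (B (N (L 414 76) (L 0 33))))))) (L 526 67)))) (L 588 82))) (L 588 82)))) (L 588 82)))
  (L 588 82)))) (L 588 82)))))))))

def vt1 : CT :=
  N (B (N (B (B (N (B (N (L 629 82) (N (L 629 82) (A (B (N (B (B (N (B (N (L 587 82) (N (B (A (B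
  (B (N (B (N (L 0 93) (L 378 60))) (L 504 66)))))) (L 587 82)))) (L 609 82)))) (L 609 82)))))))
  (L 629 82)))) (N (B (A (B (B (N (B (N (L 544 82) (N (L 0 104) (L 544 82)))) (L 544 82)))))) (A
  (B (N (B (B (N (L 629 82) (A (B (N (B (B (N (B (N (L 602 82) (N (B (A (B (B (N (B (N (L 505 66)
  (N (L 378 60) (L 0 93)))) (L 505 66)))))) (L 602 82)))) (L 602 82)))) (L 620 82))))))) (N (L 629
  82) (A (B (N (L 629 82) (A (B (N (B (B (N (B (N (L 629 82) (N (B (A (B (B (N (B (N (L 523 82) (N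
  (L 523 82) (A (B (N (L 250 49) (L 0 93))))))) (L 601 82)))))) (L 629 82)))) (L 629 82)))) (L 629
  82)))))))))))))) (A (B (N (B (B (N (L 627 82) (A (B (N (L 627 82) (N (B (N (B (B (N (B (N (L 600
  82) (N (B (A (B (B (N (L 524 82) (A (B (N (L 0 93) (L 437 77))))))))) (L 600 82)))) (L 600
  82)))) (L 618 82))) (L 627 82)))))))) (N (B (N (B (B (N (B (N (B (B (N (B (N (L 594 82) (N (B (A
  (B (B (N (L 445 73) (A (B (N (L 254 49) (N (L 0 104) (L 254 49)))))))))) (L 594 82)))) (L 594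
  82)))) (L 617 82))) (L 629 82)))) (L 629 82))) (A (B (N (B (B (N (B (N (L 629 82) (N (L 374 60)
  (L 629 82)))) (L 629 82)))) (L 629 82))))))))

def vt2 : CT :=
  N (B (N (B (B (N (L 598 82) (A (B (B (N (B (N (B (B (N (B (N (L 582 82) (N (L 525 71) (A (B (N
  (B (B (N (B (N (L 0 93) (L 425 75))) (L 525 71)))) (L 525 71))))))) (L 582 82)))) (L 598 82)))
  (L 598 82)))))))) (N (B (A (B (B (N (B (N (B (B (N (B (N (L 573 82) (N (L 573 82) (A (B (N (B (B
  (N (L 240 49) (L 417 70)))) (L 417 70))))))) (L 573 82)))) (L 592 82))) (L 598 82)))))) (A (B (N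
  (B (B (N (B (N (L 488 66) (N (L 488 66) (A (B (N (L 0 93) (L 362 60))))))) (L 488 66)))) (L 586
  82))))))) (A (B (N (B (B (N (B (N (L 598 82) (N (B (A (B (B (N (B (N (L 582 82) (N (L 562 82) (A
  (B (N (B (B (N (L 502 80) (A (B (N (L 0 104) (L 238 49))))))) (L 502 80))))))) (L 582 82))))))
  (L 598 82)))) (L 598 82)))) (N (B (N (B (B (N (L 601 82) (A (B (N (B (B (N (B (B (N (L 545 73)
  (A (B (N (B (B (N (L 476 58) (A (B (N (L 362 60) (N (L 0 93) (L 362 60)))))))) (L 545 73)))))))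
  (L 584 82)))) (L 596 82))))))) (L 601 82))) (A (B (N (B (B (N (B (N (B (B (N (B (N (L 601 82) (N
  (L 601 82) (A (B (N (B (B (N (L 539 75) (A (B (N (L 415 69) (N (L 238 49) (L 0 104)))))))) (L
  539 75))))))) (L 601 82)))) (L 601 82))) (L 601 82)))) (L 601 82))))))))

def vt3 : CT :=
  N (B (A (B (B vt1)))) (A (B (N (B (B vt2)) (N (B (N (B (B (N (B (N (L 253 49) (L 0 93))) (L 438
  77)))) (B (A (B (N (L 538 82) (N (B (N (B (B (N (B (N (B (B (N (B (N (L 525 82) (N (L 525 82) (A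
  (B (N (L 501 82) (N (B (N (L 253 44) (B (A (B (N (L 253 44) (N (L 0 104) (L 253 44)))))))) (L
  470 81)))))))) (L 525 82)))) (L 525 82))) (L 535 82)))) (L 537 82))) (A (B (N (B (B (N (B (N (L
  538 82) (N (L 538 82) (A (B (N (L 538 82) (N (L 284 44) (L 411 66)))))))) (L 538 82)))) (L 538
  82))))))))))) (A (B (N (B (B (N (B (N (B (B (N (B (N (B (B (N (B (N (L 597 82) (N (L 597 82) (A
  (B (N (L 562 82) (N (L 431 72) (A (B (N (B (B (N (L 0 104) (L 253 49)))) (L 431 72))))))))))) (L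
  597 82)))) (L 617 82))) (L 617 82)))) (L 617 82))) (A (B (N (B (B (N (B (N (L 548 78) (N (L 548
  78) (A (B (N (L 490 66) (N (L 363 60) (L 0 93)))))))) (L 586 82)))) (L 617 82))))))) (A (B (N (B
  (B (N (B (N (L 617 82) (N (B (A (B (B (N (B (N (L 600 82) (N (L 600 82) (A (B (N (L 517 82) (N
  (L 517 82) (A (B (N (L 517 82) (A (B (N (L 0 104) (L 253 49)))))))))))))) (L 612 82)))))) (L 617
  82)))) (L 617 82)))) (L 617 82)))))))))))

def vt4 : CT :=
  N (B (N (B (B (N (B (N (B (B (N (L 270 49) (A (B (N (B (B (B (A (B (N (L 0 16) (L 243 49)))))))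
  (L 261 49))))))) (L 273 49))) (L 0 104)))) (N (B (A (B (B (N (B (N (L 503 82) (N (L 500 82) (A
  (B (N (B (B (N (L 493 82) (A (B (N (B (B (N (B (N (L 385 62) (N (L 0 93) (L 385 62)))) (L 385
  62)))) (L 460 81))))))) (L 493 82))))))) (L 503 82)))))) (A (B (N (B (B (N (L 504 82) (A (B (N
  (L 496 73) (N (B (N (B (B (N (L 496 73) (A (B (N (B (B (N (B (B (N (L 273 44) (A (B (N (L 0 93)
  (L 273 44))))))) (L 428 66)))) (L 477 82))))))) (L 496 73))) (L 496 73)))))))) (N (L 505 82) (A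
  (B (N (B (B (N (L 505 82) (A (B (N (B (B (N (L 231 44) (L 385 62)))) (L 505 82))))))) (L 505
  82))))))))))) (A (B (N (B (B (N (B (N (B (B (A (B (N (B (B (N (L 598 82) (A (B (N (B (B (B (A (B
  (N (B (B (N (L 0 104) (L 260 49)))) (L 492 82))))))) (L 562 82))))))) (L 611 82)))))) (L 611
  82))) (A (B (N (B (B (N (L 558 71) (A (B (N (B (B (N (L 350 40) (L 0 93)))) (L 470 63))))))) (L
  588 82))))))) (N (B (N (B (B (N (B (N (L 620 82) (N (B (A (B (B (N (L 608 82) (A (B (N (B (B (N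
  (L 525 82) (A (B (N (L 525 82) (N (B (N (L 0 104) (L 268 49))) (L 525 82)))))))) (L 594
  82))))))))) (L 620 82)))) (L 620 82)))) (L 623 82))) (A (B (N (L 624 82) (A (B (N (B (B (N (L
  624 82) (A (B (N (B (B (N (L 491 82) (A (B (N (L 268 49) (L 0 93))))))) (L 568 82))))))) (L 624
  82)))))))))))

def vt5 : CT :=
  N (B (N (B (B (N (B (N (L 616 82) (N (B (A (B (B (N (L 592 82) (A (B (N (L 521 82) (N (B (N (B
  (B (N (B (N (L 0 104) (L 231 33))) (L 521 82)))) (L 521 82))) (L 521 82)))))))))) (L 616 82))))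
  (A (B (N (L 616 82) (N (L 616 82) (A (B (N (B (B (N (L 616 82) (A (B (N (L 616 82) (N (B (N (B
  (B (N (B (N (L 384 60) (L 540 66))) (L 616 82)))) (L 616 82))) (L 616 82)))))))) (L 616
  82))))))))))) (N (B (A (B (B (N (L 614 82) (A (B (N (B (B (N (L 593 82) (A (B (N (L 593 82) (N
  (B (N (L 385 33) (L 528 59))) (L 593 82)))))))) (L 610 82))))))))) (A (B (N (B (B (N (B (N (B (B
  (N (L 579 63) (A (B (B (N (B (N (B (B (N (B (N (L 455 77) (N (L 231 33) (L 0 104)))) (L 455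
  77)))) (L 579 63))) (L 579 63)))))))) (L 613 82))) (L 617 82)))) (L 617 82))))))) (A (B (N (B (B
  (N (B (B (N (L 607 74) (A (B (N (B (B (N (L 598 59) (A (B (N (L 538 39) (N (B (N (B (B (N (L 538
  39) (A (B (N (L 0 93) (L 382 60))))))) (L 538 39))) (L 538 39)))))))) (L 607 74))))))) (L 612
  82)))) (N (B (N (B (B (N (L 551 82) (A (B (N (L 495 82) (N (B (N (L 0 93) (L 395 57))) (L 495
  82)))))))) (L 601 82))) (L 613 82)))))

def vt6 : CT :=
  N (B (B (N (B (N (B (B (N (B (N (L 631 82) (N (L 631 82) (A (B (N (B (B (N (L 623 76) (A (B (N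
  (L 607 70) (N (L 555 39) (A (B (N (B (B (N (B (N (L 0 93) (L 398 60))) (L 555 39)))) (L 555
  39))))))))))) (L 623 76))))))) (L 631 82)))) (N (B (A (B (B (N (L 590 82) (A (B (N (L 531 82) (N
  (L 531 82) (A (B (N (L 0 104) (L 232 33))))))))))))) (L 631 82)))) (A (B (N (L 631 82) (N (B (N
  (B (B (N (B (N (B (B (N (L 621 82) (A (B (N (L 592 82) (N (L 592 82) (A (B (N (B (B (N (L 465
  79) (A (B (N (L 232 33) (N (L 0 104) (L 232 33)))))))) (L 560 82))))))))))) (L 628 82))) (L 631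
  82)))) (L 631 82))) (A (B (N (B (B (N (L 631 82) (A (B (N (L 631 82) (N (L 631 82) (A (B (N (L
  398 60) (L 555 66))))))))))) (L 631 82))))))))))) (A (B (N (B (B (N (B (N (B (B (N (B (N (B (B
  (N (L 618 82) (A (B (N (L 576 82) (N (L 576 82) (A (B (N (L 465 57) (A (B (N (B (B (N (L 0 104)
  (L 232 33)))) (L 465 57)))))))))))))) (L 626 82))) (L 631 82)))) (L 631 82))) (A (B (N (B (B (N
  (L 597 82) (A (B (N (L 541 59) (N (L 398 33) (A (B (N (L 398 33) (L 0 93))))))))))) (L 617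
  82))))))) (B (A (B (N (L 631 82) (N (B (N (B (B (N (L 602 82) (A (B (N (L 575 82) (N (L 575 82)
  (A (B (N (L 497 82) (L 232 33))))))))))) (L 618 82))) (L 631 82)))))))))

def vt7 : CT :=
  N (B (N (B (B (N (B vt0) (A (B (N (B (B (N (L 0 93) (A (B (N (B (B (N (B (N (B (B (A (B (N (B (B
  (N (L 333 55) (A (B (N (L 0 104) (L 221 42))))))) (L 373 45)))))) (L 373 45))) (L 373 45)))) (L
  393 60))))))) (N (B (N (B (B (N (B (N (L 520 66) (N (L 513 63) (A (B (N (B (B (N (B (N (B (B (N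
  (L 394 22) (A (B (B (N (B (N (L 0 93) (L 394 22))) (L 394 22)))))))) (L 500 64))) (L 513 63))))
  (L 513 63))))))) (L 520 66)))) (L 522 66))) (A (B (N (B (B (N (L 522 66) (A (B (N (L 522 66) (N
  (B (N (B (B (N (B (N (B (B (N (L 493 66) (A (B (N (L 400 66) (N (L 400 66) (A (B (N (L 0 93) (L
  300 50))))))))))) (L 512 66))) (L 522 66)))) (L 522 66))) (L 522 66)))))))) (A (B (N (B (B (N (B
  (N (B (B (N (B (N (B (B (N (L 483 66) (A (B (N (L 349 53) (N (L 349 53) (L 0 16)))))))) (L 508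
  66))) (L 522 66)))) (L 522 66))) (L 522 66)))) (L 522 66)))))))))))))) vt3)) (A (B (N (B (B
  vt4)) (N (B (N (B (B vt5)) (B (A (B (N (B (B (N (L 553 66) (A (B (N (L 396 60) (L 0 93))))))) (L
  629 82))))))) (A (B vt6))))))

def vt8 : CT :=
  N (B (N (B (B (N (B (N (L 441 61) (L 705 93))) (A (B (N (L 705 93) (N (L 705 93) (A (B (N (L 705
  93) (A (B (N (B (B (N (B (N (B (B (N (B (N (L 462 68) (L 617 93))) (L 705 93)))) (L 705 93))) (L
  705 93)))) (L 705 93)))))))))))))) (N (B (A (B (B (N (L 782 93) (A (B (N (L 764 93) (N (B (N (B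
  (B (N (B (N (L 545 77) (L 691 90))) (L 764 93)))) (L 764 93))) (L 764 93)))))))))) (A (B (N (B
  (B (N (B (N (L 774 93) (N (B (A (B (B (N (B (N (B (B (N (B (N (L 588 93) (N (L 588 93) (L 0
  104)))) (L 588 93)))) (L 708 93))) (L 748 93)))))) (L 774 93)))) (L 781 93)))) (N (B (N (L 775
  93) (B (A (B (N (L 775 93) (N (B (N (B (B (N (B (N (B (B (N (B (N (L 694 88) (N (L 694 88) (A (B
  (N (L 539 77) (L 346 60))))))) (L 694 88)))) (L 694 88))) (L 757 93)))) (L 768 93))) (L 775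
  93)))))))) (A (B (N (B (B (N (B (N (B (B (N (B (N (B (B (N (B (N (L 657 61) (N (L 657 61) (A (B
  (N (L 434 75) (L 0 104))))))) (L 657 61)))) (L 780 93))) (L 780 93)))) (L 780 93))) (L 780
  93)))) (L 780 93))))))))))) (A (B (N (B (B (B (A (B (N (B (B (N (B (N (B (B (A (B (N (B (B (N (L
  664 88) (L 441 75)))) (L 745 78)))))) (L 745 78))) (L 745 78)))) (L 784 93))))))) (N (L 786 93)
  (A (B (N (B (B (N (L 786 93) (A (B (N (L 786 93) (N (B (N (B (B (N (B (N (B (B (N (L 728 93) (A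
  (B (N (L 544 77) (N (L 544 77) (L 345 60)))))))) (L 767 93))) (L 786 93)))) (L 786 93))) (L 786
  93)))))))) (A (B (N (B (B (N (B (N (B (B (N (B (N (B (B (N (L 710 93) (A (B (N (L 441 61) (N (L
  441 61) (L 0 104)))))))) (L 759 93))) (L 786 93)))) (L 786 93))) (L 786 93)))) (L 786
  93)))))))))))

def vt9 : CT :=
  N (B (B (N (B (N (B (B (N (L 713 86) (A (B (B (N (B (N (B (B (N (B (N (L 682 93) (N (L 568 56)
  (A (B (N (B (B (N (L 369 60) (L 568 56)))) (L 568 56))))))) (L 682 93)))) (L 713 86))) (L 713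
  86)))))))) (N (B (A (B (B (N (B (N (B (B (N (B (N (L 663 93) (N (L 663 93) (A (B (N (B (B (N (L
  0 104) (L 353 55)))) (L 353 55))))))) (L 663 93)))) (L 701 93))) (L 714 93)))))) (L 722 93))))
  (A (B (N (B (B (N (B (N (L 716 93) (N (B (A (B (B (N (B (N (L 686 91) (N (L 646 85) (A (B (N (B
  (B (N (L 526 66) (L 0 104)))) (L 526 66))))))) (L 686 91)))))) (L 716 93)))) (L 716 93)))) (N (L
  722 93) (A (B (N (B (B (N (B (N (B (B (N (B (N (L 722 93) (N (L 722 93) (A (B (N (B (B (N (L 598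
  61) (A (B (N (L 351 55) (L 0 104))))))) (L 598 61))))))) (L 722 93)))) (L 722 93))) (L 722
  93)))) (L 722 93))))))))))) (N (B (N (L 369 60) (B (A (B (N (L 568 77) (N (B (N (B (B (N (B (N
  (B (B (N (B (N (L 542 77) (N (L 542 77) (A (B (N (L 493 73) (N (L 0 27) (L 432 64)))))))) (L 542
  77)))) (L 542 77))) (L 562 77)))) (L 566 77))) (L 568 77)))))))) (A (B (N (B (B (N (B (N (B (B
  (N (B (N (B (B (N (B (N (L 686 93) (N (L 686 93) (A (B (N (L 615 93) (L 354 55))))))) (L 686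
  93)))) (L 725 93))) (L 725 93)))) (L 725 93))) (L 725 93)))) (A (B (N (B (B (N (B (N (L 725 93)
  (N (B (A (B (B (N (B (N (L 691 93) (N (L 691 93) (A (B (N (L 526 66) (N (L 526 66) (A (B (N (L
  526 66) (L 0 104))))))))))) (L 716 93)))))) (L 725 93)))) (L 725 93)))) (L 725 93))))))))

def vt10 : CT :=
  N (B (N (B (B (N (B (N (B (B (N (B (N (L 766 93) (N (B (A (B (B (N (L 719 93) (A (B (N (L 578
  83) (N (B (N (B (B (N (L 0 104) (L 578 83)))) (L 578 83))) (L 578 83)))))))))) (L 766 93)))) (L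
  766 93)))) (N (L 769 91) (A (B (N (B (B (N (B (N (B (B (N (L 694 50) (A (B (B (N (B (N (B (B (N
  (B (N (L 445 76) (L 0 104))) (L 445 76)))) (L 694 50))) (L 694 50)))))))) (L 761 92))) (L 769
  91)))) (L 769 91))))))) (A (B (N (L 763 93) (N (B (N (B (B (N (L 638 93) (A (B (N (L 527 75) (N
  (L 328 44) (L 527 75)))))))) (L 738 93))) (L 763 93)))))))) (L 791 93))) (A (B (N (B (B (N (B (N
  (L 794 93) (N (B (A (B (B (N (L 713 93) (A (B (N (L 595 86) (N (L 595 86) (L 0 104)))))))))) (L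
  794 93)))) (A (B (N (L 794 93) (N (B (N (B (B (N (B (N (B (B (N (L 775 93) (A (B (N (L 717 93)
  (N (L 717 93) (A (B (N (B (B (N (L 464 77) (L 0 104)))) (L 654 78))))))))))) (L 788 93))) (L 794
  93)))) (L 794 93))) (L 794 93)))))))) (A (B (N (B (B (N (B (N (B (B (N (B (N (B (B (N (L 770 93)
  (A (B (N (L 685 81) (N (L 685 81) (L 464 44)))))))) (L 785 93))) (L 794 93)))) (L 794 93))) (L
  794 93)))) (B (A (B (N (L 794 93) (N (B (N (B (B (N (L 738 93) (A (B (N (L 683 93) (N (L 683 93)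
  (L 528 75)))))))) (L 769 93))) (L 794 93))))))))))))

def vt11 : CT :=
  N (B (N (B (B vt8)) (N (B (A (B (B (N (B (N (L 754 93) (N (L 581 72) (A (B (N (L 754 93) (N (L
  754 93) (A (B (N (L 754 93) (A (B (N (B (B (N (B (N (L 754 93) (N (B (A (B (B (N (L 543 77) (L
  698 93)))))) (L 754 93)))) (L 754 93)))) (L 754 93)))))))))))))) (A (B (N (B (B (N (L 743 93) (A
  (B (N (L 743 93) (N (B (N (B (B (N (B (N (L 691 73) (N (B (A (B (B (N (L 538 77) (L 366 60))))))
  (L 691 73)))) (L 691 73)))) (L 727 93))) (L 743 93)))))))) (N (B (N (B (B (N (B (N (B (B (N (B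
  (N (L 678 93) (N (B (A (B (B (N (L 381 56) (L 0 104)))))) (L 678 93)))) (L 678 93)))) (L 724
  93))) (L 747 93)))) (L 747 93))) (L 747 93)))))))))) (A (B vt9))))) (A (B (N (B (B (N (B (N (L 0
  104) (N (L 462 77) (A (B (N (B (B (N (L 460 76) (A (B (N (L 445 56) (N (B (N (B (B (N (L 445 56)
  (A (B (N (B (B (N (L 0 27) (L 309 49)))) (L 405 68))))))) (L 445 56))) (L 445 56)))))))) (L 462
  77))))))) (A (B (N (B (B (N (B (N (B (B (A (B (N (B (B (N (L 673 83) (A (B (N (L 463 77) (L 603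
  70))))))) (L 699 73)))))) (L 699 73))) (L 699 73)))) (N (B (N (B (B (N (B (N (L 703 88) (N (B (A
  (B (B (N (L 679 88) (A (B (N (B (B (N (L 513 80) (A (B (N (L 513 80) (N (L 0 104) (L 513
  80)))))))) (L 651 88))))))))) (L 703 88)))) (L 703 88)))) (L 709 88))) (A (B (N (L 711 88) (A (B
  (N (B (B (N (L 711 88) (A (B (N (L 446 66) (L 600 88))))))) (L 711 88)))))))))))))) vt10)))

def vt12 : CT :=
  N (B (N (B (B (N (B (N (L 397 60) (N (L 397 60) (A (B (N (B (B (N (B (N (L 370 60) (N (B (A (B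
  (B (N (B (N (L 0 71) (L 238 38))) (L 318 44)))))) (L 370 60)))) (L 384 60)))) (L 384 60)))))))
  (L 397 60)))) (N (B (A (B (B (N (B (N (L 343 60) (N (L 0 82) (L 343 60)))) (L 343 60)))))) (A (B
  (N (B (B (N (L 397 60) (A (B (N (B (B (N (B (N (L 379 60) (N (B (A (B (B (N (B (N (L 318 44) (N
  (L 238 38) (L 0 71)))) (L 318 44)))))) (L 379 60)))) (L 379 60)))) (L 391 60))))))) (N (L 397
  60) (A (B (N (L 397 60) (A (B (N (B (B (N (B (N (L 397 60) (N (B (A (B (B (N (B (N (L 330 60) (N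
  (L 330 60) (L 0 27)))) (L 379 60)))))) (L 397 60)))) (L 397 60)))) (L 397 60)))))))))))))) (A (B
  (N (B (B (N (L 395 60) (A (B (N (L 395 60) (N (B (N (B (B (N (B (N (L 379 60) (N (B (A (B (B (N
  (L 330 60) (A (B (N (L 0 71) (L 276 55))))))))) (L 379 60)))) (L 379 60)))) (L 390 60))) (L 395
  60)))))))) (N (B (N (B (B (N (B (N (B (B (N (B (N (L 375 60) (N (B (A (B (B (N (L 281 51) (L 0
  27)))))) (L 375 60)))) (L 375 60)))) (L 389 60))) (L 397 60)))) (L 397 60))) (A (B (N (B (B (N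
  (B (N (L 397 60) (N (B (A (B (B (N (L 236 38) (L 0 93)))))) (L 397 60)))) (L 397 60)))) (L 397
  60))))))))

def vt13 : CT :=
  N (B (N (B (B (N (L 640 93) (A (B (B (N (B (N (B (B (N (B (N (L 630 93) (N (L 594 90) (A (B (N
  (B (B (N (B (N (L 262 49) (L 531 91))) (L 594 90)))) (L 594 90))))))) (L 630 93)))) (L 640 93)))
  (L 640 93)))))))) (N (B (A (B (B (N (B (N (B (B (N (B (N (L 624 93) (N (L 624 93) (A (B (N (B (B
  (N (L 414 68) (L 526 89)))) (L 526 89))))))) (L 624 93)))) (L 636 93))) (L 640 93)))))) (A (B (N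
  (B (B (N (B (N (L 571 85) (N (L 571 85) (A (B (N (B (B (N (B (N (L 262 49) (L 0 104))) (L 262
  49)))) (L 491 79))))))) (L 571 85)))) (L 633 93))))))) (A (B (N (B (B (N (B (N (L 601 93) (N (B
  (A (B (B (N (B (N (L 591 93) (N (L 578 93) (A (B (N (B (B (N (L 540 93) (A (B (N (B (B (N (L 0
  104) (L 223 43)))) (L 374 62))))))) (L 540 93))))))) (L 591 93)))))) (L 601 93)))) (L 601 93))))
  (N (B (N (B (B (N (L 379 60) (A (B (N (B (B (N (B (B (N (L 344 51) (A (B (N (B (B (N (L 300 36)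
  (A (B (N (L 228 38) (N (L 0 16) (L 228 38)))))))) (L 344 51))))))) (L 368 60)))) (L 376
  60))))))) (L 379 60))) (A (B (N (B (B (N (B (N (B (B (N (B (N (L 379 60) (N (L 379 60) (A (B (N
  (B (B (N (L 340 53) (A (B (N (L 261 47) (L 0 16))))))) (L 340 53))))))) (L 379 60)))) (L 379
  60))) (L 379 60)))) (L 379 60))))))))

def vt14 : CT :=
  N (B (N (B (B (N (B (N (B (B (N (B (N (L 439 71) (N (L 439 71) (A (B (N (L 436 70) (N (B (N (L
  405 63) (B (A (B (N (L 405 63) (N (B (N (B (B (N (L 0 27) (L 318 41)))) (L 373 47))) (L 405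
  63)))))))) (L 432 70)))))))) (L 439 71)))) (N (L 279 49) (L 0 104)))) (A (B (N (L 557 92) (N (L
  557 92) (A (B (N (L 557 92) (A (B (N (L 557 92) (B (A (B (N (L 557 92) (N (B (N (L 276 55) (L
  434 59))) (L 557 92))))))))))))))))))) (B (A (B (N (L 619 93) (N (B (N (B (B (N (B (N (B (B (N
  (B (N (L 608 93) (N (L 608 93) (A (B (N (L 593 93) (N (B (N (L 437 65) (B (A (B (N (L 437 65) (N
  (L 276 49) (L 437 65)))))))) (L 574 93)))))))) (L 608 93)))) (L 608 93))) (L 615 93)))) (B (A (B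
  (N (L 610 93) (N (B (N (L 596 89) (B (A (B (N (L 564 83) (N (B (N (L 497 66) (L 339 60))) (L 564
  83)))))))) (L 610 93)))))))) (A (B (N (B (B (N (B (N (L 619 93) (N (L 619 93) (A (B (N (L 619
  93) (N (B (N (L 459 66) (B (A (B (N (L 279 49) (L 0 104))))))) (L 539 88)))))))) (L 619 93))))
  (L 619 93))))))))))) (A (B (N (B (B (N (B (N (B (B (N (B (N (B (B (N (B (N (L 658 93) (N (L 658
  93) (A (B (N (L 636 93) (N (L 553 92) (A (B (N (B (B (N (L 281 49) (L 441 71)))) (L 553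
  92))))))))))) (L 658 93)))) (L 671 93))) (L 671 93)))) (N (L 671 93) (A (B (N (L 671 93) (N (B
  (N (L 639 89) (B (A (B (N (L 603 72) (N (L 547 66) (L 389 60)))))))) (L 655 93)))))))) (A (B (N
  (B (B (N (B (N (L 627 93) (N (L 627 93) (A (B (N (L 591 88) (N (L 511 82) (A (B (N (L 0 104) (L
  281 49))))))))))) (L 652 93)))) (L 671 93))))))) (A (B (N (B (B (N (B (N (L 671 93) (N (B (A (B
  (B (N (B (N (L 660 93) (N (L 660 93) (A (B (N (L 608 93) (N (L 608 93) (A (B (N (L 608 93) (A (B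
  (N (B (B (N (L 0 104) (L 281 49)))) (L 441 71)))))))))))))) (L 668 93)))))) (L 671 93)))) (L 671
  93)))) (B (A (B (N (L 671 93) (N (L 671 93) (A (B (N (L 671 93) (A (B (N (L 671 93) (B (A (B (N
  (L 671 93) (N (L 671 93) (A (B (N (L 671 93) (L 389 60))))))))))))))))))))))))))

def vt15 : CT :=
  N (B (A (B (B (N (B (N (B (B (N (B (N (L 630 93) (N (L 630 93) (A (B (N (B (B (N (B (N (L 525
  85) (N (B (A (B (B (N (L 0 104) (L 317 60)))))) (L 525 85)))) (L 581 93)))) (L 581 93))))))) (L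
  630 93)))) (N (L 635 93) (A (B (N (B (B (N (L 630 93) (A (B (N (B (B (N (B (N (L 562 90) (N (B
  (A (B (B (N (B (N (L 319 60) (L 0 104))) (L 319 60)))))) (L 562 90)))) (L 562 90)))) (L 609
  93))))))) (L 630 93))))))) (L 638 93)))))) (A (B (N (B (B (N (B (N (L 604 93) (N (L 604 93) (A
  (B (N (B (B (N (B (N (L 318 60) (N (L 318 60) (L 0 104)))) (L 318 60)))) (L 564 93))))))) (A (B
  (N (L 599 93) (N (B (N (B (B (N (L 599 93) (A (B (N (B (B (N (B (B (N (L 459 67) (A (B (N (B (B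
  (N (L 286 52) (L 0 104)))) (L 459 67))))))) (L 557 89)))) (L 587 93))))))) (L 599 93))) (L 599
  93)))))))) (N (B (N (L 636 93) (B (A (B (N (L 636 93) (N (L 636 93) (A (B (N (B (B (N (B (N (L
  636 93) (N (L 636 93) (A (B (N (L 636 93) (L 318 60))))))) (L 636 93)))) (L 636 93))))))))))) (A
  (B (N (B (B (N (L 636 93) (A (B (N (B (B (N (B (N (L 463 72) (N (L 463 72) (A (B (N (L 317 60)
  (L 0 104))))))) (L 560 90)))) (L 636 93))))))) (L 636 93))))))))

def vt16 : CT :=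
  N (B (N (B (B (N (B (N (B (B (N (L 581 77) (A (B (N (L 581 77) (N (L 581 77) (A (B (N (B (B (N
  (L 581 77) (A (B (N (L 581 77) (N (B (N (B (B (N (L 391 60) (L 581 77)))) (L 581 77))) (L 581
  77)))))))) (L 581 77))))))))))) (N (B (A (B (B (N (L 574 77) (A (B (N (B (B (N (L 521 77) (A (B
  (N (L 521 77) (N (B (N (L 0 27) (L 359 53))) (L 521 77)))))))) (L 565 77))))))))) (L 581 77))))
  (A (B (N (B (B (N (B (B (N (L 564 68) (A (B (N (B (B (N (L 542 53) (A (B (N (L 391 33) (N (B (N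
  (B (B (N (L 391 33) (L 0 104)))) (L 391 33))) (L 391 33)))))))) (L 564 68))))))) (L 576 77))))
  (L 580 77))))))) (B (A (B (N (L 393 60) (L 583 77))))))) (A (B (N (B (B (N (B (N (B (B (N (B (N
  (L 584 77) (N (L 584 77) (A (B (N (B (B (N (L 564 70) (A (B (N (L 525 64) (N (L 394 33) (A (B (N
  (B (B (N (L 0 104) (L 394 33)))) (L 394 33))))))))))) (L 564 70))))))) (L 584 77)))) (L 584
  77))) (A (B (N (L 584 77) (N (L 584 77) (A (B (N (B (B (N (L 584 77) (A (B (N (L 584 77) (N (L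
  584 77) (L 394 60)))))))) (L 584 77))))))))))) (A (B (N (B (B (N (L 584 77) (A (B (N (B (B (N (L
  500 76) (A (B (N (L 359 53) (L 0 27))))))) (L 549 77))))))) (L 584 77)))))))

def vt17 : CT :=
  N (B (N (B (B (N (B (N (B (B (N (B (N (L 491 77) (N (L 491 77) (A (B (N (L 491 77) (N (L 491 77)
  (A (B (N (B (B (N (B (N (B (B (N (B (N (L 0 27) (L 491 77))) (L 491 77)))) (L 491 77))) (L 491
  77)))) (L 491 77))))))))))) (A (B (N (B (B (B (A (B (N (B (B (N (B (N (B (B (A (B (N (L 0 104)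
  (L 321 44)))))) (L 321 44))) (L 321 44)))) (L 475 77))))))) (L 486 77))))))) (N (L 493 77) (A (B
  (N (B (B (N (L 493 77) (A (B (N (L 493 77) (N (L 493 77) (A (B (N (B (B (N (B (N (B (B (N (B (N
  (L 493 77) (N (L 493 77) (L 0 27)))) (L 493 77)))) (L 493 77))) (L 493 77)))) (L 493
  77))))))))))) (L 493 77))))))) (A (B (B (N (B (N (B (B (N (B (N (L 316 60) (N (L 298 57) (A (B
  (N (B (B (N (B (N (L 0 16) (L 266 58))) (L 298 57)))) (L 298 57))))))) (L 316 60)))) (L 321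
  60))) (L 321 60)))))))) vt15)) (A (B (N (B (B (N (B (N (B (B (A (B (N (B (B (N (L 678 93) (A (B
  (N (B (B (B (A (B (N (B (B (N (L 301 60) (L 465 74)))) (L 612 93))))))) (L 656 93))))))) (L 686
  93)))))) (N (B (A (B (B (N (B (N (L 682 93) (N (L 675 93) (A (B (N (B (B (N (L 656 93) (A (B (N
  (L 385 60) (L 573 79))))))) (L 656 93))))))) (L 682 93)))))) (A (B (N (L 686 93) (N (L 686 93)
  (A (B (N (B (B (N (L 686 93) (A (B (N (L 385 60) (L 686 93))))))) (L 686 93))))))))))) (A (B (N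
  (B (B (N (L 653 93) (A (B (N (B (B (N (L 522 65) (A (B (N (L 0 104) (L 301 60))))))) (L 598
  88))))))) (L 672 93))))))) vt16)))

def vt18 : CT :=
  N (B (B (N (B (N (B (B (N (L 609 88) (A (B (N (L 609 88) (N (L 609 88) (A (B (N (L 609 88) (A (B
  (N (B (B (N (B (N (B (B (N (L 388 60) (L 609 88)))) (L 609 88))) (L 609 88)))) (L 609
  88)))))))))))))) (N (B (A (B (B (N (L 594 88) (A (B (N (L 549 88) (N (B (N (B (B (N (B (N (B (B
  (N (L 0 104) (L 220 38)))) (L 366 45))) (L 549 88)))) (L 549 88))) (L 549 88)))))))))) (A (B (N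
  (L 607 87) (N (B (N (L 591 80) (B (A (B (N (L 591 80) (N (B (N (B (B (N (L 388 44) (L 548 58))))
  (L 575 64))) (L 591 80)))))))) (L 605 87)))))))) (A (B (N (L 609 88) (N (L 609 88) (A (B (N (B
  (B (N (L 609 88) (A (B (N (L 609 88) (N (B (N (B (B (N (B (N (B (B (N (L 462 72) (A (B (N (L 220
  38) (L 0 104))))))) (L 561 78))) (L 609 88)))) (L 609 88))) (L 609 88)))))))) (L 609
  88))))))))))) (N (B (A (B (B (N (B (N (L 527 66) (N (L 527 66) (A (B (N (L 527 66) (N (L 527 66)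
  (A (B (N (L 527 66) (A (B (N (B (B (N (B (N (L 527 66) (N (L 387 60) (L 527 66)))) (L 527 66))))
  (L 527 66)))))))))))))) (A (B (N (B (B (N (L 514 66) (A (B (N (L 514 66) (N (B (N (B (B (N (B (N
  (L 383 33) (N (L 0 104) (L 383 33)))) (L 383 33)))) (L 473 59))) (L 514 66)))))))) (L 525
  66))))))))) (A (B (N (B (B (N (B (N (B (B (N (L 365 41) (A (B (B (N (B (N (B (B (N (B (N (L 287
  55) (L 0 11))) (L 287 55)))) (L 365 41))) (L 365 41)))))))) (L 387 60))) (L 389 60)))) (N (L 0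
  104) (L 389 60))))))

def vt19 : CT :=
  N (B (B (N (B vt18) (A (B (N (B (B (N (B (B (N (L 662 93) (A (B (N (B (B (N (L 657 81) (A (B (N
  (L 619 61) (N (B (N (B (B (N (L 619 61) (A (B (N (B (B (N (L 0 104) (L 279 59)))) (L 521
  82))))))) (L 619 61))) (L 619 61)))))))) (L 662 93))))))) (A (B (N (L 666 93) (N (L 666 93) (A
  (B (N (L 666 93) (A (B (N (B (B (N (L 666 93) (L 386 60)))) (L 666 93)))))))))))))) (N (B (N (B
  (B (N (L 627 93) (A (B (N (L 592 93) (N (B (N (B (B (N (L 279 59) (L 0 104)))) (L 529 79))) (L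
  592 93)))))))) (L 659 93))) (A (B (N (L 666 93) (A (B (N (L 666 93) (B (A (B (N (L 666 93) (N (B
  (N (B (B (N (L 526 72) (L 387 60)))) (L 605 76))) (L 666 93))))))))))))))))))) (B (A (B (N (B (B
  (N (L 659 93) (A (B (N (L 560 87) (L 310 60))))))) (N (B (N (B (B (N (B (N (B (B (N (B (N (L 702
  93) (N (L 702 93) (A (B (N (L 694 93) (N (B (N (L 616 82) (B (A (B (N (L 616 82) (N (B (N (B (B
  (N (L 0 104) (L 397 60)))) (L 536 66))) (L 616 82)))))))) (L 684 93)))))))) (L 702 93)))) (L 702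
  93))) (A (B (N (L 705 93) (N (L 705 93) (A (B (N (L 705 93) (A (B (N (L 705 93) (B (A (B (N (L
  705 93) (N (L 397 60) (L 705 93))))))))))))))))))) (B (A (B (N (L 702 93) (N (B (N (L 696 93) (B
  (A (B (N (L 680 93) (N (B (N (L 646 83) (B (A (B (N (L 567 77) (N (L 397 60) (L 567 77))))))))
  (L 680 93)))))))) (L 702 93)))))))) (A (B (N (B (B (N (B (N (L 707 93) (N (L 707 93) (A (B (N (L
  707 93) (N (B (N (L 627 83) (B (A (B (N (L 537 66) (N (L 397 60) (L 0 104)))))))) (L 667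
  93)))))))) (L 707 93)))) (L 707 93)))))))))

def vt20 : CT :=
  N (B (N (B (B (N (B (N (B (B (N (B (N (L 728 93) (N (L 728 93) (A (B (N (L 717 93) (N (L 675 93)
  (A (B (N (B (B (N (B (N (B (B (N (L 0 104) (L 398 60)))) (L 539 66))) (L 619 88)))) (L 675
  93))))))))))) (L 728 93)))) (N (L 734 93) (A (B (N (B (B (N (L 729 93) (A (B (N (L 719 93) (N (L
  686 67) (A (B (N (B (B (N (B (N (B (B (N (B (N (L 336 60) (L 0 104))) (L 336 60)))) (L 587 88)))
  (L 686 67)))) (L 686 67))))))))))) (L 729 93))))))) (L 734 93)))) (N (B (A (B (B (N (L 709 93)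
  (A (B (N (L 671 93) (N (L 671 93) (A (B (N (B (B (N (L 0 104) (L 336 60)))) (L 483
  61))))))))))))) (A (B (N (L 734 93) (N (B (N (L 718 93) (B (A (B (N (L 700 89) (N (L 672 83) (A
  (B (N (B (B (N (L 398 60) (L 593 77)))) (L 593 77))))))))))) (L 726 93)))))))) (A (B (N (B (B (N
  (B (N (L 712 93) (N (L 712 93) (A (B (N (L 694 93) (N (L 654 93) (A (B (N (B (B (N (L 398 60) (L
  0 104)))) (L 539 66))))))))))) (L 725 93)))) (N (B (N (B (B (N (B (N (B (B (N (L 728 93) (A (B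
  (N (L 710 93) (N (L 710 93) (A (B (N (B (B (N (L 630 93) (A (B (N (L 483 61) (N (L 336 60) (L
  483 61)))))))) (L 690 93))))))))))) (L 732 93))) (L 734 93)))) (L 734 93))) (A (B (N (B (B (N (L
  734 93) (A (B (N (L 734 93) (N (L 734 93) (A (B (N (B (B (N (L 587 88) (A (B (N (L 336 60) (L 0
  104))))))) (L 686 93))))))))))) (L 734 93))))))))

def vt21 : CT :=
  N (B (N (B (B vt11)) (N (B (N (B (B vt12)) (L 0 104))) (A (B (N (B (B vt13)) vt14)))))) (A (B (N
  (B (B vt17)) (N (B vt19) (A (B (N (B (B vt20)) (A (B (N (B (B (N (B (N (B (B (N (B (N (B (B (N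
  (L 727 93) (A (B (N (L 700 93) (N (L 700 93) (A (B (N (L 630 85) (A (B (N (B (B (N (L 336 60) (L
  483 61)))) (L 630 85)))))))))))))) (L 731 93))) (L 734 93)))) (N (B (A (B (B (N (B (N (L 729 93)
  (N (L 729 93) (A (B (N (L 703 93) (N (L 703 93) (A (B (N (L 703 93) (A (B (N (B (B (N (L 398 60)
  (L 539 66)))) (L 619 88)))))))))))))) (L 733 93)))))) (L 734 93)))) (A (B (N (B (B (N (L 713 93)
  (A (B (N (L 678 87) (N (L 587 61) (A (B (N (L 587 61) (A (B (N (L 0 104) (L 336 60))))))))))))))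
  (L 725 93))))))) (B (A (B (N (L 734 93) (N (B (N (B (B (N (L 717 93) (A (B (N (L 699 93) (N (L
  699 93) (A (B (N (L 650 93) (A (B (N (L 483 61) (L 0 104)))))))))))))) (L 726 93))) (A (B (N (L
  734 93) (A (B (N (L 734 93) (B (A (B (N (L 734 93) (N (L 734 93) (A (B (N (L 734 93) (A (B (N (L
  593 77) (L 398 60)))))))))))))))))))))))))))))))))

def vt22 : CT :=
  N (B (B (N (B (N (B (B (N (B (N (L 246 44) (L 525 78))) (L 525 78)))) (N (L 691 93) (A (B (N (L
  691 93) (N (L 691 93) (A (B (N (B (B (N (B (N (B (B (N (B (N (L 444 44) (L 691 93))) (L 691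
  93)))) (L 691 93))) (L 691 93)))) (L 691 93))))))))))) (A (B (N (B (B (B (A (B (N (B (B (N (B (N
  (B (B (A (B (N (B (B (N (L 444 71) (L 0 104)))) (L 605 61)))))) (L 605 61))) (L 605 61)))) (L
  683 93))))))) (N (L 688 93) (A (B (N (L 688 93) (A (B (N (B (B (N (B (N (B (B (N (B (N (B (B (N
  (L 535 84) (A (B (N (L 243 44) (L 0 104))))))) (L 633 93))) (L 688 93)))) (L 688 93))) (L 688
  93)))) (L 688 93)))))))))))))) (N (B (A (B (B (N (L 741 93) (A (B (N (L 730 93) (N (B (N (B (B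
  (N (B (N (B (B (N (B (N (L 591 93) (N (L 0 104) (L 591 93)))) (L 591 93)))) (L 684 93))) (L 730
  93)))) (L 730 93))) (L 730 93)))))))))) (A (B (N (B (B (N (B (N (L 736 93) (N (B (A (B (B (N (B
  (N (B (B (N (B (N (L 619 93) (N (L 619 93) (L 247 44)))) (L 619 93)))) (L 694 93))) (L 719
  93)))))) (L 736 93)))) (A (B (N (L 740 93) (N (L 740 93) (A (B (N (B (B (N (B (N (B (B (N (B (N
  (L 740 93) (N (L 740 93) (L 493 44)))) (L 740 93)))) (L 740 93))) (L 740 93)))) (L 740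
  93))))))))))) (N (B (N (L 736 93) (B (A (B (N (L 736 93) (N (B (N (B (B (N (B (N (B (B (N (B (N
  (L 685 93) (N (L 685 93) (A (B (N (L 588 93) (N (L 247 44) (L 466 77)))))))) (L 685 93)))) (L
  685 93))) (L 725 93)))) (L 732 93))) (L 736 93)))))))) (A (B (N (B (B (N (B (N (B (B (N (B (N (B
  (B (N (B (N (L 662 78) (N (L 662 78) (A (B (N (L 521 87) (L 247 44))))))) (L 662 78)))) (L 740
  93))) (L 740 93)))) (L 740 93))) (L 740 93)))) (L 740 93)))))))))

def vt23 : CT :=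
  N (B (N (B (B (N (B (N (L 792 93) (N (L 792 93) (A (B (N (B (B (N (B (N (L 739 93) (N (B (A (B
  (B (N (B (N (L 0 104) (L 475 71))) (L 635 77)))))) (L 739 93)))) (L 767 93)))) (L 767 93)))))))
  (L 792 93)))) (N (L 685 93) (A (B (N (B (B (N (L 792 93) (A (B (N (B (B (N (B (N (L 757 93) (N
  (B (A (B (B (N (B (N (L 635 77) (N (L 475 71) (L 0 104)))) (L 635 77)))))) (L 757 93)))) (L 757
  93)))) (L 781 93))))))) (N (L 792 93) (A (B (N (L 792 93) (A (B (N (B (B (N (B (N (L 792 93) (N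
  (B (A (B (B (N (B (N (L 659 93) (N (L 659 93) (A (B (N (L 315 60) (L 0 104))))))) (L 756
  93)))))) (L 792 93)))) (L 792 93)))) (L 792 93)))))))))))))) (A (B (N (B (B (N (L 789 93) (A (B
  (N (L 789 93) (N (B (N (B (B (N (B (N (L 756 93) (N (B (A (B (B (N (L 660 93) (A (B (N (L 0 104)
  (L 551 88))))))))) (L 756 93)))) (L 756 93)))) (L 779 93))) (L 789 93)))))))) (N (B (N (B (B (N
  (B (N (B (B (N (B (N (L 748 93) (N (B (A (B (B (N (L 561 84) (L 320 60)))))) (L 748 93)))) (L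
  748 93)))) (L 777 93))) (L 792 93)))) (L 792 93))) (A (B (N (B (B (N (B (N (L 792 93) (N (L 471
  71) (L 792 93)))) (L 792 93)))) (L 792 93))))))))

def vt24 : CT :=
  N (B (N (B (B (N (L 753 93) (A (B (B (N (B (N (B (B (N (B (N (L 733 93) (N (L 661 82) (A (B (N
  (B (B (N (B (N (L 0 104) (L 536 86))) (L 661 82)))) (L 661 82))))))) (L 733 93)))) (L 753 93)))
  (L 753 93)))))))) (N (B (A (B (B (N (B (N (B (B (N (B (N (L 721 93) (N (L 721 93) (A (B (N (B (B
  (N (L 303 60) (L 526 81)))) (L 526 81))))))) (L 721 93)))) (L 745 93))) (L 753 93)))))) (A (B (N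
  (B (B (N (B (N (L 615 77) (N (L 615 77) (A (B (N (L 0 104) (L 455 71))))))) (L 615 77)))) (L 738
  93))))))) (A (B (N (B (B (N (B (N (L 753 93) (N (B (A (B (B (N (B (N (L 733 93) (N (L 708 93) (A
  (B (N (B (B (N (L 633 91) (L 300 60)))) (L 633 91))))))) (L 733 93)))))) (L 753 93)))) (L 753
  93)))) (N (B (N (B (B (N (L 756 93) (A (B (N (B (B (N (B (B (N (L 686 84) (A (B (N (B (B (N (L
  599 69) (A (B (N (L 456 71) (N (L 0 104) (L 456 71)))))))) (L 686 84))))))) (L 735 93)))) (L 750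
  93))))))) (L 756 93))) (A (B (N (B (B (N (B (N (B (B (N (B (N (L 756 93) (N (L 756 93) (A (B (N
  (B (B (N (L 678 86) (A (B (N (L 522 80) (L 300 60))))))) (L 678 86))))))) (L 756 93)))) (L 756
  93))) (L 756 93)))) (L 756 93))))))))

def vt25 : CT :=
  N (B (B (N (B vt22) (A (B (N (B (B (N (L 0 104) (A (B (N (B (B (N (B (N (B (B (A (B (N (B (B (N
  (L 419 66) (L 278 53)))) (L 470 56)))))) (L 470 56))) (L 470 56)))) (L 494 71))))))) (N (B (N (B
  (B (N (B (N (L 655 77) (N (L 646 74) (A (B (N (B (B (N (B (N (B (B (N (L 496 33) (A (B (B (N (B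
  (N (L 0 104) (L 496 33))) (L 496 33)))))))) (L 630 75))) (L 646 74)))) (L 646 74))))))) (L 655
  77)))) (L 657 77))) (A (B (N (B (B (N (L 657 77) (A (B (N (L 657 77) (N (B (N (B (B (N (B (N (B
  (B (N (L 620 77) (A (B (N (L 504 77) (N (L 504 77) (A (B (N (L 0 104) (L 378 61))))))))))) (L
  645 77))) (L 657 77)))) (L 657 77))) (L 657 77)))))))) (A (B (N (B (B (N (B (N (B (B (N (B (N (B
  (B (N (L 609 77) (A (B (N (L 439 64) (N (L 439 64) (L 0 27)))))))) (L 640 77))) (L 657 77)))) (L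
  657 77))) (L 657 77)))) (L 657 77)))))))))))))) (N (B (A (B (B vt23)))) (A (B (N (B (B vt24)) (N
  (B (N (B (B (N (B (N (L 319 60) (L 0 104))) (L 552 88)))) (B (A (B (N (L 677 93) (N (B (N (B (B
  (N (B (N (B (B (N (B (N (L 661 93) (N (L 661 93) (A (B (N (L 630 93) (N (L 319 55) (L 592
  92)))))))) (L 661 93)))) (L 661 93))) (L 674 93)))) (L 676 93))) (A (B (N (B (B (N (B (N (L 677
  93) (N (L 677 93) (A (B (N (L 677 93) (N (L 358 55) (L 518 77)))))))) (L 677 93)))) (L 677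
  93))))))))))) (A (B (N (B (B (N (B (N (B (B (N (B (N (B (B (N (B (N (L 752 93) (N (L 752 93) (A
  (B (N (L 707 93) (N (L 542 83) (A (B (N (L 319 60) (L 542 83))))))))))) (L 752 93)))) (L 776
  93))) (L 776 93)))) (L 776 93))) (A (B (N (B (B (N (B (N (L 690 89) (N (L 690 89) (A (B (N (L
  616 77) (N (L 457 71) (L 0 104)))))))) (L 738 93)))) (L 776 93))))))) (A (B (N (B (B (N (B (N (L
  776 93) (N (B (A (B (B (N (B (N (L 755 93) (N (L 755 93) (A (B (N (L 651 93) (N (L 651 93) (A (B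
  (N (L 651 93) (L 319 60))))))))))) (L 771 93)))))) (L 776 93)))) (L 776 93)))) (L 776
  93))))))))))))

def vt26 : CT :=
  N (B (N (B (B (A (B (N (B (B (N (L 340 60) (A (B (N (B (B (B (A (B (N (B (B (N (L 0 27) (L 233
  41)))) (L 306 60))))))) (L 329 60))))))) (L 344 60)))))) (N (B (A (B (B (N (B (N (L 633 93) (N
  (L 630 93) (A (B (N (B (B (N (L 621 93) (A (B (N (B (B (N (B (N (L 485 73) (N (L 0 104) (L 485
  73)))) (L 485 73)))) (L 579 92))))))) (L 621 93))))))) (L 633 93)))))) (A (B (N (B (B (N (L 634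
  93) (A (B (N (L 625 84) (N (B (N (B (B (N (L 625 84) (A (B (N (B (B (N (B (B (N (L 344 55) (A (B
  (N (L 0 104) (L 344 55))))))) (L 539 77)))) (L 600 93))))))) (L 625 84))) (L 625 84)))))))) (N
  (L 636 93) (A (B (N (B (B (N (L 636 93) (A (B (N (B (B (N (L 291 55) (L 485 73)))) (L 636
  93))))))) (L 636 93))))))))))) (A (B (N (B (B (N (B (N (B (B (A (B (N (B (B (N (L 753 93) (A (B
  (N (B (B (B (A (B (N (L 327 60) (L 620 93))))))) (L 708 93))))))) (L 769 93)))))) (L 769 93)))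
  (A (B (N (B (B (N (L 703 82) (A (B (N (B (B (N (L 441 51) (L 0 104)))) (L 592 74))))))) (L 741
  93))))))) (N (B (N (B (B (N (B (N (L 781 93) (N (B (A (B (B (N (L 766 93) (A (B (N (B (B (N (L
  661 93) (A (B (N (L 661 93) (N (L 337 60) (L 661 93)))))))) (L 748 93))))))))) (L 781 93)))) (L
  781 93)))) (L 784 93))) (A (B (N (L 786 93) (A (B (N (B (B (N (L 786 93) (A (B (N (B (B (N (L
  619 93) (A (B (N (L 337 60) (L 0 104))))))) (L 716 93))))))) (L 786 93)))))))))))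

def vt27 : CT :=
  B (B (N (B (N (B (B (N (B (N (L 775 93) (N (B (A (B (B (N (L 745 93) (A (B (N (L 656 93) (N (B
  (N (B (B (N (L 291 44) (L 656 93)))) (L 656 93))) (L 656 93)))))))))) (L 775 93)))) (A (B (N (L
  775 93) (N (L 775 93) (A (B (N (B (B (N (L 775 93) (A (B (N (L 775 93) (N (B (N (B (B (N (B (N
  (L 483 71) (L 680 77))) (L 775 93)))) (L 775 93))) (L 775 93)))))))) (L 775 93))))))))))) (N (B
  (A (B (B (N (L 773 93) (A (B (N (B (B (N (L 747 93) (A (B (N (L 747 93) (N (B (N (L 485 44) (L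
  665 70))) (L 747 93)))))))) (L 769 93))))))))) (A (B (N (B (B (N (B (N (B (B (N (L 729 74) (A (B
  (B (N (B (N (B (B (N (B (N (L 572 88) (L 291 44))) (L 572 88)))) (L 729 74))) (L 729 74))))))))
  (L 772 93))) (L 777 93)))) (L 777 93))))))) (A (B (N (B (B (N (B (B (N (L 764 85) (A (B (N (B (B
  (N (L 753 70) (A (B (N (L 678 50) (N (B (N (B (B (N (L 678 50) (A (B (N (L 0 104) (L 481
  71))))))) (L 678 50))) (L 678 50)))))))) (L 764 85))))))) (L 770 93)))) (N (B (N (B (B (N (L 694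
  93) (A (B (N (L 623 93) (N (B (N (L 0 104) (L 498 68))) (L 623 93)))))))) (L 756 93))) (L 772
  93)))))))

def vt28 : CT :=
  N (B (B (N (B (N (B (B (N (B (N (L 794 93) (N (L 794 93) (A (B (N (B (B (N (L 784 87) (A (B (N
  (L 764 81) (N (L 698 50) (A (B (N (B (B (N (B (N (L 0 104) (L 501 71))) (L 698 50)))) (L 698
  50))))))))))) (L 784 87))))))) (L 794 93)))) (N (B (A (B (B (N (L 743 93) (A (B (N (L 668 93) (N
  (L 668 93) (L 292 44)))))))))) (L 794 93)))) (A (B (N (L 794 93) (N (B (N (B (B (N (B (N (B (B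
  (N (L 782 93) (A (B (N (L 745 93) (N (L 745 93) (A (B (N (B (B (N (L 586 90) (L 292 44)))) (L
  706 93))))))))))) (L 790 93))) (L 794 93)))) (L 794 93))) (A (B (N (B (B (N (L 794 93) (A (B (N
  (L 794 93) (N (L 794 93) (A (B (N (L 501 71) (L 698 77))))))))))) (L 794 93))))))))))) (A (B (N
  (B (B (N (B (N (B (B (N (B (N (B (B (N (L 779 93) (A (B (N (L 725 93) (N (L 725 93) (A (B (N (L
  586 68) (A (B (N (L 292 44) (L 586 68)))))))))))))) (L 788 93))) (L 794 93)))) (L 794 93))) (A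
  (B (N (B (B (N (L 752 93) (A (B (N (L 681 70) (N (L 501 44) (A (B (N (L 501 44) (L 0
  104))))))))))) (L 776 93))))))) (B (A (B (N (L 794 93) (N (B (N (B (B (N (L 758 93) (A (B (N (L
  724 93) (N (L 724 93) (A (B (N (L 626 93) (L 292 44))))))))))) (L 778 93))) (L 794 93)))))))))

def vt29 : CT :=
  N (B (N (B (B (N (B (N (L 556 72) (L 887 104))) (A (B (N (L 887 104) (N (L 887 104) (A (B (N (L
  887 104) (A (B (N (B (B (N (B (N (B (B (N (B (N (L 582 79) (L 777 104))) (L 887 104)))) (L 887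
  104))) (L 887 104)))) (L 887 104)))))))))))))) (N (B (A (B (B (N (L 984 104) (A (B (N (L 962
  104) (N (B (N (B (B (N (B (N (L 687 88) (L 870 101))) (L 962 104)))) (L 962 104))) (L 962
  104)))))))))) (A (B (N (B (B (N (B (N (L 974 104) (N (B (A (B (B (N (B (N (L 740 104) (L 891
  104))) (L 941 104)))))) (L 974 104)))) (L 983 104)))) (N (B (N (L 975 104) (B (A (B (N (L 975
  104) (N (B (N (B (B (N (B (N (B (B (N (B (N (L 874 99) (N (L 874 99) (A (B (N (L 679 88) (L 436
  71))))))) (L 874 99)))) (L 874 99))) (L 954 104)))) (L 967 104))) (L 975 104)))))))) (A (B (N (B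
  (B (N (B (N (B (B (N (B (N (B (B (N (B (N (L 827 72) (N (L 827 72) (L 546 86)))) (L 827 72))))
  (L 982 104))) (L 982 104)))) (L 982 104))) (L 982 104)))) (L 982 104))))))))))) (A (B (N (B (B
  (B (A (B (N (B (B (N (B (N (B (B (A (B (N (B (B (N (L 836 99) (L 556 86)))) (L 938 89)))))) (L
  938 89))) (L 938 89)))) (L 987 104))))))) (N (L 990 104) (A (B (N (B (B (N (L 990 104) (A (B (N
  (L 990 104) (N (B (N (B (B (N (B (N (B (B (N (L 917 104) (A (B (N (L 685 88) (N (L 685 88) (L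
  434 71)))))))) (L 966 104))) (L 990 104)))) (L 990 104))) (L 990 104)))))))) (A (B (N (B (B (N
  (B (N (B (B (N (B (N (B (B (N (L 893 104) (L 556 72)))) (L 955 104))) (L 990 104)))) (L 990
  104))) (L 990 104)))) (L 990 104)))))))))))

def vt30 : CT :=
  N (B (B (N (B (N (B (B (N (L 898 97) (A (B (B (N (B (N (B (B (N (B (N (L 859 104) (N (L 715 67)
  (A (B (N (B (B (N (L 464 71) (L 715 67)))) (L 715 67))))))) (L 859 104)))) (L 898 97))) (L 898
  97)))))))) (N (B (A (B (B (N (B (N (B (B (N (B (N (L 835 104) (N (L 835 104) (L 444 66)))) (L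
  835 104)))) (L 882 104))) (L 898 104)))))) (L 909 104)))) (A (B (N (B (B (N (B (N (L 902 104) (N
  (B (A (B (B (N (B (N (L 863 102) (N (L 813 96) (L 662 77)))) (L 863 102)))))) (L 902 104)))) (L
  902 104)))) (N (L 910 104) (A (B (N (B (B (N (B (N (B (B (N (B (N (L 910 104) (N (L 910 104) (A
  (B (N (B (B (N (L 753 72) (L 442 66)))) (L 753 72))))))) (L 910 104)))) (L 910 104))) (L 910
  104)))) (L 910 104))))))))))) (N (B (N (L 464 71) (B (A (B (N (L 715 88) (N (B (N (B (B (N (B (N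
  (B (B (N (B (N (L 683 88) (N (L 683 88) (A (B (N (L 621 84) (N (L 250 38) (L 544 75)))))))) (L
  683 88)))) (L 683 88))) (L 708 88)))) (L 713 88))) (L 715 88)))))))) (A (B (N (B (B (N (B (N (B
  (B (N (B (N (B (B (N (B (N (L 863 104) (N (L 863 104) (A (B (N (L 775 104) (L 445 66))))))) (L
  863 104)))) (L 913 104))) (L 913 104)))) (L 913 104))) (L 913 104)))) (A (B (N (B (B (N (B (N (L
  913 104) (N (B (A (B (B (N (B (N (L 871 104) (N (L 871 104) (L 662 77)))) (L 901 104)))))) (L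
  913 104)))) (L 913 104)))) (L 913 104))))))))

def vt31 : CT :=
  N (B (B (N (B (B (N (L 582 88) (A (B (N (B (B (N (L 579 87) (A (B (N (L 560 67) (N (B (N (B (B
  (N (L 560 67) (A (B (N (B (B (N (B (B (N (L 249 38) (L 0 82)))) (L 389 60)))) (L 510 79)))))))
  (L 560 67))) (L 560 67)))))))) (L 582 88))))))) (A (B (N (B (B (N (B (N (B (B (A (B (N (B (B (N
  (L 848 94) (A (B (N (L 583 88) (L 759 81))))))) (L 880 84)))))) (L 880 84))) (L 880 84)))) (N (B
  (N (B (B (N (B (N (L 885 99) (N (B (A (B (B (N (L 854 99) (A (B (N (L 646 91) (L 820 99)))))))))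
  (L 885 99)))) (L 885 99)))) (L 892 99))) (A (B (N (L 895 99) (A (B (N (B (B (N (L 895 99) (A (B
  (N (L 562 77) (L 755 99))))))) (L 895 99)))))))))))))) (N (B (N (B (B (N (B (N (B (B (N (B (N (L
  964 104) (N (B (A (B (B (N (L 905 104) (L 728 94)))))) (L 964 104)))) (L 964 104)))) (N (L 968
  102) (A (B (N (B (B (N (B (N (B (B (N (L 874 61) (A (B (B (N (B (N (L 560 87) (L 874 61))) (L
  874 61)))))))) (L 958 103))) (L 968 102)))) (L 968 102))))))) (A (B (N (L 961 104) (N (B (N (B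
  (B (N (L 804 104) (A (B (N (L 664 86) (N (L 413 55) (L 664 86)))))))) (L 929 104))) (L 961
  104)))))))) (L 996 104))) (A (B (N (B (B (N (B (N (L 1000 104) (N (B (A (B (B (N (L 898 104) (L
  749 97)))))) (L 1000 104)))) (A (B (N (L 1000 104) (N (B (N (B (B (N (B (N (B (B (N (L 976 104)
  (A (B (N (L 903 104) (N (L 903 104) (A (B (N (L 584 88) (L 824 89))))))))))) (L 992 104))) (L
  1000 104)))) (L 1000 104))) (L 1000 104)))))))) (A (B (N (B (B (N (B (N (B (B (N (B (N (B (B (N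
  (L 969 104) (A (B (N (L 862 92) (N (L 862 92) (L 584 55)))))))) (L 988 104))) (L 1000 104)))) (L
  1000 104))) (L 1000 104)))) (B (A (B (N (L 1000 104) (N (B (N (B (B (N (L 929 104) (A (B (N (L
  859 104) (N (L 859 104) (L 665 86)))))))) (L 969 104))) (L 1000 104)))))))))))))

def vt32 : CT :=
  N (B (N (B (B (N (B (N (L 499 71) (N (L 499 71) (A (B (N (B (B (N (B (N (L 466 71) (N (B (A (B
  (B (N (B (N (L 0 82) (L 300 49))) (L 400 55)))))) (L 466 71)))) (L 484 71)))) (L 484 71)))))))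
  (L 499 71)))) (N (B (A (B (B (N (B (N (L 432 71) (N (L 0 93) (L 432 71)))) (L 432 71)))))) (A (B
  (N (B (B (N (L 499 71) (A (B (N (B (B (N (B (N (L 478 71) (N (B (A (B (B (N (B (N (L 401 55) (N
  (L 300 49) (L 0 82)))) (L 401 55)))))) (L 478 71)))) (L 478 71)))) (L 493 71))))))) (N (L 499
  71) (A (B (N (L 499 71) (A (B (N (B (B (N (B (N (L 499 71) (N (B (A (B (B (N (B (N (L 416 71) (N
  (L 416 71) (L 0 38)))) (L 477 71)))))) (L 499 71)))) (L 499 71)))) (L 499 71)))))))))))))) (A (B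
  (N (B (B (N (L 498 71) (A (B (N (L 498 71) (N (B (N (B (B (N (B (N (L 477 71) (N (B (A (B (B (N
  (L 416 71) (A (B (N (L 0 82) (L 347 66))))))))) (L 477 71)))) (L 477 71)))) (L 491 71))) (L 498
  71)))))))) (N (B (N (B (B (N (B (N (B (B (N (B (N (L 472 71) (N (B (A (B (B (N (L 354 62) (L 0
  38)))))) (L 472 71)))) (L 472 71)))) (L 490 71))) (L 499 71)))) (L 499 71))) (A (B (N (B (B (N
  (B (N (L 499 71) (N (B (A (B (B (N (L 297 49) (L 0 104)))))) (L 499 71)))) (L 499 71)))) (L 499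
  71))))))))

def vt33 : CT :=
  N (B (N (B (B (N (L 806 104) (A (B (B (N (B (N (B (B (N (B (N (L 793 104) (N (L 748 101) (A (B
  (N (B (B (N (B (N (L 330 60) (L 669 102))) (L 748 101)))) (L 748 101))))))) (L 793 104)))) (L
  806 104))) (L 806 104)))))))) (N (B (A (B (B (N (B (N (B (B (N (B (N (L 786 104) (N (L 786 104)
  (A (B (N (B (B (N (L 522 79) (L 662 100)))) (L 662 100))))))) (L 786 104)))) (L 801 104))) (L
  806 104)))))) (A (B (N (B (B (N (B (N (L 719 96) (N (L 719 96) (A (B (N (L 330 60) (L 618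
  90))))))) (L 719 96)))) (L 797 104))))))) (A (B (N (B (B (N (B (N (L 756 104) (N (B (A (B (B (N
  (B (N (L 744 104) (N (L 728 104) (A (B (N (B (B (N (L 680 104) (A (B (N (L 281 54) (L 471
  73))))))) (L 680 104))))))) (L 744 104)))))) (L 756 104)))) (L 756 104)))) (N (B (N (B (B (N (L
  477 71) (A (B (N (B (B (N (B (B (N (L 433 62) (A (B (N (B (B (N (L 378 47) (A (B (N (L 287 49)
  (N (L 0 27) (L 287 49)))))))) (L 433 62))))))) (L 464 71)))) (L 473 71))))))) (L 477 71))) (A (B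
  (N (B (B (N (B (N (B (B (N (B (N (L 477 71) (N (L 477 71) (A (B (N (B (B (N (L 428 64) (A (B (N
  (L 329 58) (L 0 27))))))) (L 428 64))))))) (L 477 71)))) (L 477 71))) (L 477 71)))) (L 477
  71))))))))

def vt34 : CT :=
  N (B (N (B (B (N (B (N (B (B (N (B (N (L 553 82) (N (L 553 82) (A (B (N (L 549 81) (N (B (N (L
  510 74) (B (A (B (N (L 510 74) (N (B (N (B (B (N (L 0 38) (L 400 52)))) (L 470 58))) (L 510
  74)))))))) (L 544 81)))))))) (L 553 82)))) (L 352 60))) (A (B (N (L 702 103) (N (L 702 103) (A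
  (B (N (L 702 103) (A (B (N (L 702 103) (B (A (B (N (L 702 103) (N (B (N (L 348 66) (L 547 70)))
  (L 702 103))))))))))))))))))) (B (A (B (N (L 780 104) (N (B (N (B (B (N (B (N (B (B (N (B (N (L
  766 104) (N (L 766 104) (A (B (N (L 746 104) (N (B (N (L 550 76) (B (A (B (N (L 550 76) (N (L
  348 60) (L 550 76)))))))) (L 722 104)))))))) (L 766 104)))) (L 766 104))) (L 774 104)))) (B (A
  (B (N (L 767 104) (N (B (N (L 750 100) (B (A (B (N (L 711 94) (N (B (N (L 625 77) (L 426 71)))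
  (L 711 94)))))))) (L 767 104)))))))) (A (B (N (B (B (N (B (N (L 780 104) (N (L 780 104) (A (B (N
  (L 780 104) (N (B (N (L 578 77) (L 352 60))) (L 679 99)))))))) (L 780 104)))) (L 780
  104))))))))))) (A (B (N (B (B (N (B (N (B (B (N (B (N (B (B (N (B (N (L 829 104) (N (L 829 104)
  (A (B (N (L 801 104) (N (L 697 103) (A (B (N (B (B (N (L 354 60) (L 556 82)))) (L 697
  103))))))))))) (L 829 104)))) (L 844 104))) (L 844 104)))) (N (L 844 104) (A (B (N (L 844 104)
  (N (B (N (L 804 100) (B (A (B (N (L 759 83) (N (L 689 77) (L 490 71)))))))) (L 824 104))))))))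
  (A (B (N (B (B (N (B (N (L 790 104) (N (L 790 104) (A (B (N (L 744 99) (N (L 643 93) (L 354
  60)))))))) (L 821 104)))) (L 844 104))))))) (A (B (N (B (B (N (B (N (L 844 104) (N (B (A (B (B
  (N (B (N (L 831 104) (N (L 831 104) (A (B (N (L 765 104) (N (L 765 104) (A (B (N (L 765 104) (A
  (B (N (L 354 60) (L 556 82)))))))))))))) (L 841 104)))))) (L 844 104)))) (L 844 104)))) (B (A (B
  (N (L 844 104) (N (L 844 104) (A (B (N (L 844 104) (A (B (N (L 844 104) (B (A (B (N (L 844 104)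
  (N (L 844 104) (A (B (N (L 844 104) (L 490 71))))))))))))))))))))))))))

def vt35 : CT :=
  N (B (B (N (B (N (B (B (N (B (N (L 619 88) (N (L 619 88) (A (B (N (L 619 88) (N (L 619 88) (A (B
  (N (B (B (N (B (N (B (B (N (B (N (L 214 38) (L 619 88))) (L 619 88)))) (L 619 88))) (L 619
  88)))) (L 619 88))))))))))) (A (B (N (B (B (B (A (B (N (L 404 55) (L 597 88))))))) (L 611
  88))))))) (N (L 621 88) (A (B (N (B (B (N (L 621 88) (A (B (N (L 621 88) (N (L 621 88) (A (B (N
  (B (B (N (B (N (B (B (N (B (N (L 621 88) (N (L 621 88) (L 217 38)))) (L 621 88)))) (L 621 88)))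
  (L 621 88)))) (L 621 88))))))))))) (L 621 88))))))) (A (B (B (N (B (N (B (B (N (B (N (L 398 71)
  (N (L 375 68) (A (B (N (B (B (N (B (N (L 0 27) (L 335 69))) (L 375 68)))) (L 375 68))))))) (L
  398 71)))) (L 404 71))) (L 404 71)))))))) (N (B (A (B (B (N (B (N (B (B (N (B (N (L 794 104) (N
  (L 794 104) (A (B (N (B (B (N (B (N (L 661 96) (N (L 399 71) (L 661 96)))) (L 732 104)))) (L 732
  104))))))) (L 794 104)))) (N (L 799 104) (A (B (N (B (B (N (L 793 104) (A (B (N (B (B (N (B (N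
  (L 707 101) (N (L 401 71) (L 707 101)))) (L 707 101)))) (L 767 104))))))) (L 793 104))))))) (L
  804 104)))))) (A (B (N (B (B (N (B (N (L 761 104) (N (L 761 104) (A (B (N (L 400 71) (L 710
  104))))))) (A (B (N (L 755 104) (N (B (N (B (B (N (L 755 104) (A (B (N (B (B (N (B (B (N (L 577
  78) (A (B (N (L 360 63) (L 577 78))))))) (L 701 100)))) (L 739 104))))))) (L 755 104))) (L 755
  104)))))))) (N (B (N (L 801 104) (B (A (B (N (L 801 104) (N (L 801 104) (A (B (N (B (B (N (B (N
  (L 801 104) (N (L 801 104) (A (B (N (L 801 104) (L 401 71))))))) (L 801 104)))) (L 801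
  104))))))))))) (A (B (N (B (B (N (L 801 104) (A (B (N (B (B (N (B (N (L 583 83) (N (L 583 83) (L
  399 71)))) (L 705 101)))) (L 801 104))))))) (L 801 104)))))))))

def vt36 : CT :=
  N (B (B (N (B (N (B (B (A (B (N (B (B (N (L 854 104) (A (B (N (B (B (B (A (B (N (B (B (N (L 379
  71) (L 586 85)))) (L 770 104))))))) (L 826 104))))))) (L 864 104)))))) (N (B (A (B (B (N (B (N
  (L 858 104) (N (L 850 104) (A (B (N (B (B (N (L 826 104) (A (B (N (L 485 71) (L 721 90))))))) (L
  826 104))))))) (L 858 104)))))) (A (B (N (L 864 104) (N (L 864 104) (A (B (N (B (B (N (L 864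
  104) (A (B (N (L 485 71) (L 864 104))))))) (L 864 104))))))))))) (A (B (N (B (B (N (L 823 104)
  (A (B (N (B (B (N (L 657 76) (L 379 71)))) (L 753 99))))))) (L 847 104))))))) (N (B (N (B (B (N
  (B (N (B (B (N (L 732 88) (A (B (N (L 732 88) (N (L 732 88) (A (B (N (B (B (N (L 732 88) (A (B
  (N (L 732 88) (N (B (N (B (B (N (L 493 71) (L 732 88)))) (L 732 88))) (L 732 88)))))))) (L 732
  88))))))))))) (N (B (A (B (B (N (L 722 88) (A (B (N (B (B (N (L 656 88) (A (B (N (L 656 88) (N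
  (B (N (L 239 38) (L 452 64))) (L 656 88)))))))) (L 712 88))))))))) (L 732 88)))) (A (B (N (B (B
  (N (B (B (N (L 710 79) (A (B (N (B (B (N (L 682 64) (L 493 44)))) (L 710 79))))))) (L 725 88))))
  (L 730 88))))))) (B (A (B (N (L 495 71) (L 734 88))))))) (A (B (N (B (B (N (B (N (B (B (N (B (N
  (L 735 88) (N (L 735 88) (A (B (N (B (B (N (L 711 81) (A (B (N (L 661 75) (L 496 44))))))) (L
  711 81))))))) (L 735 88)))) (L 735 88))) (A (B (N (L 735 88) (N (L 735 88) (A (B (N (B (B (N (L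
  735 88) (A (B (N (L 735 88) (N (L 735 88) (L 496 71)))))))) (L 735 88))))))))))) (A (B (N (B (B
  (N (L 735 88) (A (B (N (B (B (N (L 630 87) (A (B (N (L 452 64) (L 239 38))))))) (L 691 88)))))))
  (L 735 88))))))))

def vt37 : CT :=
  N (B (B (N (B (N (B (B (N (L 766 99) (A (B (N (L 766 99) (N (L 766 99) (A (B (N (L 766 99) (A (B
  (N (B (B (N (B (N (B (B (N (L 489 71) (L 766 99)))) (L 766 99))) (L 766 99)))) (L 766
  99)))))))))))))) (N (B (A (B (B (N (L 748 99) (A (B (N (L 691 99) (N (B (N (B (B (N (B (N (L 277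
  49) (L 461 56))) (L 691 99)))) (L 691 99))) (L 691 99)))))))))) (A (B (N (L 764 98) (N (B (N (L
  745 91) (B (A (B (N (L 745 91) (N (B (N (B (B (N (L 489 55) (L 690 69)))) (L 724 75))) (L 745
  91)))))))) (L 762 98)))))))) (A (B (N (L 766 99) (N (L 766 99) (A (B (N (B (B (N (L 766 99) (A
  (B (N (L 766 99) (N (B (N (B (B (N (B (N (B (B (N (L 582 83) (L 277 49)))) (L 706 89))) (L 766
  99)))) (L 766 99))) (L 766 99)))))))) (L 766 99))))))))))) (N (B (A (B (B (N (B (N (L 664 77) (N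
  (L 664 77) (A (B (N (L 664 77) (N (L 664 77) (A (B (N (L 664 77) (A (B (N (B (B (N (B (N (L 664
  77) (N (L 488 71) (L 664 77)))) (L 664 77)))) (L 664 77)))))))))))))) (A (B (N (B (B (N (L 647
  77) (A (B (N (L 647 77) (N (B (N (L 482 44) (L 596 70))) (L 647 77)))))))) (L 661 77))))))))) (A
  (B (N (B (B (N (B (N (B (B (N (L 460 52) (A (B (B (N (B (N (B (B (N (B (N (L 361 66) (L 0 22)))
  (L 361 66)))) (L 460 52))) (L 460 52)))))))) (L 487 71))) (L 490 71)))) (L 490 71)))))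

def vt38 : CT :=
  N (B (B (N (B vt37) (A (B (N (B (B (N (B (B (N (L 834 104) (A (B (N (B (B (N (L 827 92) (A (B (N
  (L 779 72) (N (B (N (B (B (N (L 779 72) (A (B (N (L 351 70) (L 656 93))))))) (L 779 72))) (L 779
  72)))))))) (L 834 104))))))) (A (B (N (L 838 104) (N (L 838 104) (A (B (N (L 838 104) (A (B (N
  (B (B (N (L 838 104) (L 486 71)))) (L 838 104)))))))))))))) (N (B (N (B (B (N (L 790 104) (A (B
  (N (L 745 104) (N (B (N (L 351 70) (L 666 90))) (L 745 104)))))))) (L 829 104))) (A (B (N (L 839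
  104) (A (B (N (L 839 104) (B (A (B (N (L 839 104) (N (B (N (B (B (N (L 662 83) (L 487 71)))) (L
  762 87))) (L 839 104))))))))))))))))))) (B (A (B (N (B (B (N (L 830 104) (A (B (N (L 706 98) (L
  391 71))))))) (N (B (N (B (B (N (B (N (B (B (N (B (N (L 884 104) (N (L 884 104) (A (B (N (L 874
  104) (N (B (N (L 775 93) (B (A (B (N (L 775 93) (N (B (N (L 499 71) (L 674 77))) (L 775
  93)))))))) (L 862 104)))))))) (L 884 104)))) (L 884 104))) (A (B (N (L 888 104) (N (L 888 104)
  (A (B (N (L 888 104) (A (B (N (L 888 104) (B (A (B (N (L 888 104) (N (L 499 71) (L 888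
  104))))))))))))))))))) (B (A (B (N (L 884 104) (N (B (N (L 876 104) (B (A (B (N (L 856 104) (N
  (B (N (L 813 94) (B (A (B (N (L 713 88) (N (L 499 71) (L 713 88)))))))) (L 856 104)))))))) (L
  884 104)))))))) (A (B (N (B (B (N (B (N (L 890 104) (N (L 890 104) (A (B (N (L 890 104) (N (B (N
  (L 789 94) (B (A (B (N (L 676 77) (L 499 71))))))) (L 840 104)))))))) (L 890 104)))) (L 890
  104)))))))))

def vt39 : CT :=
  N (B (N (B (B (N (B (N (B (B (N (B (N (L 917 104) (N (L 917 104) (A (B (N (L 903 104) (N (L 850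
  104) (A (B (N (B (B (N (B (N (L 501 71) (L 679 77))) (L 780 99)))) (L 850 104))))))))))) (L 917
  104)))) (N (L 924 104) (A (B (N (B (B (N (L 918 104) (A (B (N (L 906 104) (N (L 864 78) (A (B (N
  (B (B (N (B (N (L 423 71) (L 739 99))) (L 864 78)))) (L 864 78))))))))))) (L 918 104))))))) (L
  924 104)))) (N (B (A (B (B (N (L 892 104) (A (B (N (L 845 104) (N (L 845 104) (A (B (N (L 423
  71) (L 608 72))))))))))))) (A (B (N (L 924 104) (N (B (N (L 904 104) (B (A (B (N (L 882 100) (N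
  (L 846 94) (A (B (N (B (B (N (L 501 71) (L 747 88)))) (L 747 88))))))))))) (L 914 104)))))))) (A
  (B (N (B (B (N (B (N (L 897 104) (N (L 897 104) (A (B (N (L 874 104) (N (L 823 104) (A (B (N (L
  501 71) (L 679 77))))))))))) (L 912 104)))) (N (B (N (B (B (N (B (N (B (B (N (L 917 104) (A (B
  (N (L 894 104) (N (L 894 104) (A (B (N (B (B (N (L 793 104) (A (B (N (L 608 72) (N (L 423 71) (L
  608 72)))))))) (L 869 104))))))))))) (L 922 104))) (L 924 104)))) (L 924 104))) (A (B (N (B (B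
  (N (L 924 104) (A (B (N (L 924 104) (N (L 924 104) (A (B (N (B (B (N (L 739 99) (L 423 71)))) (L
  864 104))))))))))) (L 924 104))))))))

def vt40 : CT :=
  N (B (N (B (B (N (B (N (B (B vt29)) (N (B (A (B (B (N (B (N (L 949 104) (N (L 732 83) (A (B (N
  (L 949 104) (N (L 949 104) (A (B (N (L 949 104) (A (B (N (B (B (N (B (N (L 949 104) (N (B (A (B
  (B (N (L 684 88) (L 879 104)))))) (L 949 104)))) (L 949 104)))) (L 949 104)))))))))))))) (A (B
  (N (B (B (N (L 935 104) (A (B (N (L 935 104) (N (B (N (B (B (N (B (N (L 869 84) (N (B (A (B (B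
  (N (L 677 88) (L 460 71)))))) (L 869 84)))) (L 869 84)))) (L 915 104))) (L 935 104)))))))) (N (B
  (N (B (B (N (B (N (B (B (N (B (N (L 854 104) (N (L 480 67) (L 854 104)))) (L 854 104)))) (L 912
  104))) (L 941 104)))) (L 941 104))) (L 941 104)))))))))) (A (B vt30))))) (A (B vt31))))) (N (B
  (A (B (B vt32)))) (A (B (N (B (B vt33)) vt34)))))) (A (B (N (B (B (N (B vt35) (A (B vt36))))) (N
  (B vt38) (A (B (N (B (B vt39)) (A (B (N (B (B (N (B (N (B (B (N (B (N (B (B (N (L 915 104) (A (B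
  (N (L 881 104) (N (L 881 104) (A (B (N (L 793 96) (A (B (N (B (B (N (L 423 71) (L 608 72)))) (L
  793 96)))))))))))))) (L 921 104))) (L 924 104)))) (N (B (A (B (B (N (B (N (L 918 104) (N (L 918
  104) (A (B (N (L 885 104) (N (L 885 104) (A (B (N (L 885 104) (A (B (N (B (B (N (L 501 71) (L
  679 77)))) (L 780 99)))))))))))))) (L 923 104)))))) (L 924 104)))) (A (B (N (B (B (N (L 898 104)
  (A (B (N (L 853 98) (N (L 739 72) (A (B (N (L 739 72) (L 423 71))))))))))) (L 913 104))))))) (B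
  (A (B (N (L 924 104) (N (B (N (B (B (N (L 902 104) (A (B (N (L 880 104) (N (L 880 104) (A (B (N
  (L 819 104) (L 608 72))))))))))) (L 915 104))) (A (B (N (L 924 104) (A (B (N (L 924 104) (B (A
  (B (N (L 924 104) (N (L 924 104) (A (B (N (L 924 104) (A (B (N (L 747 88) (L 501
  71)))))))))))))))))))))))))))))))))

def vt41 : CT :=
  N (B (B (N (B (N (B (B (N (B (N (L 310 55) (L 661 89))) (L 661 89)))) (N (L 870 104) (A (B (N (L
  870 104) (N (L 870 104) (A (B (N (B (B (N (B (N (B (B (N (B (N (L 560 55) (L 870 104))) (L 870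
  104)))) (L 870 104))) (L 870 104)))) (L 870 104))))))))))) (A (B (N (B (B (B (A (B (N (B (B (N
  (B (N (B (B (A (B (N (L 560 82) (L 762 72)))))) (L 762 72))) (L 762 72)))) (L 859 104))))))) (N
  (L 866 104) (A (B (N (L 866 104) (A (B (N (B (B (N (B (N (B (B (N (B (N (B (B (N (L 674 95) (L
  306 55)))) (L 797 104))) (L 866 104)))) (L 866 104))) (L 866 104)))) (L 866 104)))))))))))))) (N
  (B (A (B (B (N (L 933 104) (A (B (N (L 919 104) (N (B (N (B (B (N (B (N (L 745 104) (L 861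
  104))) (L 919 104)))) (L 919 104))) (L 919 104)))))))))) (A (B (N (B (B (N (B (N (L 926 104) (N
  (B (A (B (B (N (B (N (B (B (N (B (N (L 779 104) (N (L 779 104) (L 311 55)))) (L 779 104)))) (L
  874 104))) (L 906 104)))))) (L 926 104)))) (A (B (N (L 932 104) (N (L 932 104) (A (B (N (B (B (N
  (B (N (B (B (N (B (N (L 932 104) (N (L 932 104) (L 620 55)))) (L 932 104)))) (L 932 104))) (L
  932 104)))) (L 932 104))))))))))) (N (B (N (L 927 104) (B (A (B (N (L 927 104) (N (B (N (B (B (N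
  (B (N (B (B (N (B (N (L 863 104) (N (L 863 104) (A (B (N (L 740 104) (N (L 311 55) (L 587
  88)))))))) (L 863 104)))) (L 863 104))) (L 913 104)))) (L 922 104))) (L 927 104)))))))) (A (B (N
  (B (B (N (B (N (B (B (N (B (N (B (B (N (B (N (L 833 89) (N (L 833 89) (A (B (N (L 656 98) (L 311
  55))))))) (L 833 89)))) (L 931 104))) (L 931 104)))) (L 931 104))) (L 931 104)))) (L 931
  104)))))))))

def vt42 : CT :=
  N (B (B (N (B (N (B (B (N (L 948 104) (A (B (B (N (B (N (B (B (N (B (N (L 923 104) (N (L 832 93)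
  (A (B (N (B (B (N (L 674 97) (L 832 93)))) (L 832 93))))))) (L 923 104)))) (L 948 104))) (L 948
  104)))))))) (N (B (A (B (B (N (B (N (B (B (N (B (N (L 908 104) (N (L 908 104) (A (B (N (B (B (N
  (L 381 71) (L 662 92)))) (L 662 92))))))) (L 908 104)))) (L 938 104))) (L 948 104)))))) (A (B (N
  (B (B (N (B (N (L 774 88) (N (L 774 88) (L 573 82)))) (L 774 88)))) (L 930 104))))))) (A (B (N
  (B (B (N (B (N (L 948 104) (N (B (A (B (B (N (B (N (L 923 104) (N (L 891 104) (A (B (N (B (B (N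
  (L 796 102) (L 378 71)))) (L 796 102))))))) (L 923 104)))))) (L 948 104)))) (L 948 104)))) (N (B
  (N (B (B (N (L 952 104) (A (B (N (B (B (N (B (B (N (L 864 95) (A (B (N (B (B (N (L 755 80) (L
  574 82)))) (L 864 95))))))) (L 925 104)))) (L 945 104))))))) (L 952 104))) (A (B (N (B (B (N (B
  (N (B (B (N (B (N (L 952 104) (N (L 952 104) (A (B (N (B (B (N (L 854 97) (A (B (N (L 657 91) (L
  378 71))))))) (L 854 97))))))) (L 952 104)))) (L 952 104))) (L 952 104)))) (L 952 104)))))))))))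
  (N (B (N (B (B (N (L 401 71) (L 695 99)))) (B (A (B (N (L 853 104) (N (B (N (B (B (N (B (N (B (B
  (N (B (N (L 832 104) (N (L 832 104) (A (B (N (L 793 104) (N (L 401 66) (L 745 103)))))))) (L 832
  104)))) (L 832 104))) (L 848 104)))) (L 851 104))) (A (B (N (B (B (N (B (N (L 853 104) (N (L 853
  104) (A (B (N (L 853 104) (N (L 451 66) (L 652 88)))))))) (L 853 104)))) (L 853 104)))))))))))
  (A (B (N (B (B (N (B (N (B (B (N (B (N (B (B (N (B (N (L 946 104) (N (L 946 104) (A (B (N (L 890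
  104) (N (L 683 94) (A (B (N (L 401 71) (L 683 94))))))))))) (L 946 104)))) (L 977 104))) (L 977
  104)))) (L 977 104))) (A (B (N (B (B (N (B (N (L 868 100) (N (L 868 100) (A (B (N (L 776 88) (L
  576 82))))))) (L 930 104)))) (L 977 104))))))) (A (B (N (B (B (N (B (N (L 977 104) (N (B (A (B
  (B (N (B (N (L 951 104) (N (L 951 104) (A (B (N (L 819 104) (N (L 819 104) (A (B (N (L 819 104)
  (L 401 71))))))))))) (L 970 104)))))) (L 977 104)))) (L 977 104)))) (L 977 104))))))))

def vt43 : CT :=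
  N (B (A (B (B (N (B (N (B (B (N (B (N (L 997 104) (N (L 997 104) (A (B (N (B (B (N (B (N (L 930
  104) (N (B (A (B (B (N (L 599 82) (L 799 88)))))) (L 930 104)))) (L 966 104)))) (L 966
  104))))))) (L 997 104)))) (N (L 863 104) (A (B (N (B (B (N (L 997 104) (A (B (N (B (B (N (B (N
  (L 954 104) (N (B (A (B (B (N (B (N (L 800 88) (L 599 82))) (L 800 88)))))) (L 954 104)))) (L
  954 104)))) (L 983 104))))))) (N (L 997 104) (A (B (N (L 997 104) (A (B (N (B (B (N (B (N (L 997
  104) (N (B (A (B (B (N (B (N (L 830 104) (N (L 830 104) (L 397 71)))) (L 952 104)))))) (L 997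
  104)))) (L 997 104)))) (L 997 104)))))))))))))) (A (B (N (B (B (N (L 993 104) (A (B (N (L 993
  104) (N (B (N (B (B (N (B (N (L 952 104) (N (B (A (B (B (N (L 830 104) (L 693 99)))))) (L 952
  104)))) (L 952 104)))) (L 980 104))) (L 993 104)))))))) (N (B (N (B (B (N (B (N (B (B (N (B (N
  (L 942 104) (N (B (A (B (B (N (L 706 95) (L 403 71)))))) (L 942 104)))) (L 942 104)))) (L 978
  104))) (L 997 104)))) (L 997 104))) (A (B (N (B (B (N (B (N (L 997 104) (N (L 593 82) (L 997
  104)))) (L 997 104)))) (L 997 104))))))))))))) (A (B vt42))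

def vt44 : CT :=
  N (B (N (B (B (A (B (N (B (B (N (L 428 71) (A (B (N (B (B (B (A (B (N (B (B (N (L 0 38) (L 293
  52)))) (L 386 71))))))) (L 414 71))))))) (L 433 71)))))) (N (B (A (B (B (N (B (N (L 797 104) (N
  (L 793 104) (A (B (N (B (B (N (L 781 104) (A (B (N (L 610 84) (L 729 103))))))) (L 781
  104))))))) (L 797 104)))))) (A (B (N (B (B (N (L 799 104) (A (B (N (L 787 95) (N (B (N (B (B (N
  (L 787 95) (A (B (N (B (B (N (L 433 66) (L 679 88)))) (L 755 104))))))) (L 787 95))) (L 787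
  95)))))))) (N (L 800 104) (A (B (N (B (B (N (L 800 104) (A (B (N (B (B (N (L 367 66) (L 610
  84)))) (L 800 104))))))) (L 800 104))))))))))) (A (B (N (B (B (N (B (N (B (B (A (B (N (B (B (N
  (L 948 104) (A (B (N (B (B (B (A (B (N (L 412 71) (L 781 104))))))) (L 892 104))))))) (L 968
  104)))))) (L 968 104))) (A (B (N (B (B (N (L 885 93) (A (B (N (L 555 62) (L 745 85))))))) (L 933
  104))))))) (N (B (N (B (B (N (B (N (L 983 104) (N (B (A (B (B (N (L 964 104) (A (B (N (B (B (N
  (L 832 104) (A (B (N (L 832 104) (N (L 424 71) (L 832 104)))))))) (L 942 104))))))))) (L 983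
  104)))) (L 983 104)))) (L 988 104))) (A (B (N (L 990 104) (A (B (N (B (B (N (L 990 104) (A (B (N
  (B (B (N (L 779 104) (L 424 71)))) (L 901 104))))))) (L 990 104)))))))))))

def vt45 : CT :=
  N (B (B (N (B (N (B (B (N (B (N (L 976 104) (N (B (A (B (B (N (L 938 104) (A (B (N (L 826 104)
  (N (B (N (B (B (N (L 367 55) (L 826 104)))) (L 826 104))) (L 826 104)))))))))) (L 976 104)))) (A
  (B (N (L 976 104) (N (L 976 104) (A (B (N (B (B (N (L 976 104) (A (B (N (L 976 104) (N (B (N (B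
  (B (N (B (N (L 608 82) (L 856 88))) (L 976 104)))) (L 976 104))) (L 976 104)))))))) (L 976
  104))))))))))) (N (B (A (B (B (N (L 973 104) (A (B (N (B (B (N (L 940 104) (A (B (N (L 940 104)
  (N (B (N (L 611 55) (L 837 81))) (L 940 104)))))))) (L 968 104))))))))) (A (B (N (B (B (N (B (N
  (B (B (N (L 918 85) (A (B (B (N (B (N (B (B (N (B (N (L 721 99) (L 367 55))) (L 721 99)))) (L
  918 85))) (L 918 85)))))))) (L 972 104))) (L 978 104)))) (L 978 104))))))) (A (B (N (B (B (N (B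
  (B (N (L 962 96) (A (B (N (B (B (N (L 948 81) (A (B (N (L 853 61) (N (B (N (B (B (N (L 853 61)
  (L 606 82)))) (L 853 61))) (L 853 61)))))))) (L 962 96))))))) (L 970 104)))) (N (B (N (B (B (N
  (L 873 104) (A (B (N (L 785 104) (N (L 627 79) (L 785 104)))))))) (L 952 104))) (L 972
  104)))))))) (B (A (B (N (B (B (N (L 876 88) (L 628 82)))) (L 996 104)))))

def vt46 : CT :=
  N (B (B (N (B (N (B (B (N (B (N (L 999 104) (N (L 999 104) (A (B (N (B (B (N (L 987 98) (A (B (N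
  (L 962 92) (N (L 879 61) (A (B (N (B (B (N (L 631 82) (L 879 61)))) (L 879 61))))))))))) (L 987
  98))))))) (L 999 104)))) (N (B (A (B (B (N (L 936 104) (A (B (N (L 841 104) (N (L 841 104) (L
  368 55)))))))))) (L 999 104)))) (A (B (N (L 999 104) (N (B (N (B (B (N (B (N (B (B (N (L 985
  104) (A (B (N (L 938 104) (N (L 938 104) (A (B (N (B (B (N (L 738 101) (L 368 55)))) (L 888
  104))))))))))) (L 995 104))) (L 999 104)))) (L 999 104))) (A (B (N (B (B (N (L 999 104) (A (B (N
  (L 999 104) (N (L 999 104) (A (B (N (L 631 82) (L 879 88))))))))))) (L 999 104))))))))))) (A (B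
  (N (B (B (N (B (N (B (B (N (B (N (B (B (N (L 980 104) (A (B (N (L 913 104) (N (L 913 104) (A (B
  (N (L 738 79) (A (B (N (L 368 55) (L 738 79)))))))))))))) (L 992 104))) (L 999 104)))) (L 999
  104))) (A (B (N (B (B (N (L 947 104) (A (B (N (L 857 81) (L 631 55))))))) (L 977 104))))))) (B
  (A (B (N (L 999 104) (N (B (N (B (B (N (L 955 104) (A (B (N (L 911 104) (N (L 911 104) (A (B (N
  (L 788 104) (L 368 55))))))))))) (L 980 104))) (L 999 104)))))))))

def vt47 : CT :=
  N (B (B (N (B (N (B (B (N (L 699 97) (A (B (N (L 699 97) (N (L 699 97) (A (B (N (L 699 97) (A (B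
  (N (B (B (N (B (N (B (B (N (B (N (L 315 49) (L 560 77))) (L 699 97)))) (L 699 97))) (L 699
  97)))) (L 699 97)))))))))))))) (N (B (A (B (B (N (L 690 96) (A (B (N (L 662 92) (N (B (N (B (B
  (N (B (N (L 315 49) (L 546 62))) (L 662 92)))) (L 662 92))) (L 662 92)))))))))) (A (B (N (B (B
  (N (B (N (L 677 97) (N (B (A (B (B (N (B (N (L 383 65) (L 572 75))) (L 636 81)))))) (L 677
  97)))) (L 689 97)))) (N (B (N (L 679 96) (B (A (B (N (L 679 96) (N (B (N (B (B (N (B (N (B (B (N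
  (B (N (L 550 60) (N (L 550 60) (L 305 49)))) (L 550 60)))) (L 550 60))) (L 651 74)))) (L 669
  80))) (L 679 96)))))))) (L 687 97)))))))) (A (B (N (L 699 97) (N (L 699 97) (A (B (N (B (B (N (L
  699 97) (A (B (N (L 699 97) (N (B (N (B (B (N (B (N (B (B (N (L 607 85) (L 315 49)))) (L 669
  93))) (L 699 97)))) (L 699 97))) (L 699 97)))))))) (L 699 97))))))))))) (N (B (A (B (B (N (B (N
  (L 606 78) (N (L 333 44) (A (B (N (L 606 78) (N (L 606 78) (A (B (N (L 606 78) (A (B (N (B (B (N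
  (B (N (L 606 78) (N (B (A (B (B (N (L 272 49) (L 517 72)))))) (L 606 78)))) (L 606 78)))) (L 606
  78)))))))))))))) (A (B (N (B (B (N (L 597 78) (A (B (N (L 597 78) (N (B (N (B (B (N (B (N (L 514
  45) (N (L 272 49) (L 514 45)))) (L 514 45)))) (L 572 71))) (L 597 78)))))))) (L 604 78)))))))))
  (A (B (N (B (B (N (B (N (B (B (N (L 546 58) (A (B (B (N (B (N (B (B (N (B (N (L 496 71) (L 315
  28))) (L 496 71)))) (L 546 58))) (L 546 58)))))))) (L 559 77))) (A (B (N (B (B (N (B (N (L 547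
  75) (N (B (A (B (B (N (B (N (L 499 63) (N (L 435 57) (L 245 38)))) (L 499 63)))))) (L 547 75))))
  (L 547 75)))) (L 557 77))))))) (N (L 315 49) (A (B (N (L 561 77) (A (B (N (B (B (N (B (N (L 561
  77) (N (B (A (B (B (N (B (N (L 508 71) (N (L 508 71) (L 245 38)))) (L 547 75)))))) (L 561 77))))
  (L 561 77)))) (L 561 77))))))))))))

def vt48 : CT :=
  B (B (N (B vt47) (A (B (N (B (B (N (B (B (N (L 732 99) (A (B (N (B (B (N (L 729 98) (A (B (N (L
  705 78) (N (B (N (B (B (N (L 705 78) (A (B (N (B (B (N (L 314 49) (L 490 71)))) (L 643 90)))))))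
  (L 705 78))) (L 705 78)))))))) (L 732 99))))))) (A (B (N (L 734 99) (N (B (N (B (B (N (B (N (L
  721 99) (N (B (A (B (B (N (L 683 99) (A (B (N (L 420 71) (L 639 94))))))))) (L 721 99)))) (L 721
  99)))) (L 730 99))) (A (B (N (L 734 99) (A (B (N (B (B (N (L 734 99) (A (B (N (L 314 49) (L 557
  77))))))) (L 734 99)))))))))))))) (N (B (N (B (B (N (B (N (B (B (N (B (N (L 694 98) (N (B (A (B
  (B (N (L 619 89) (L 396 65)))))) (L 694 98)))) (L 694 98)))) (L 705 98))) (A (B (N (L 689 96) (N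
  (B (N (B (B (N (L 491 71) (L 315 49)))) (L 649 91))) (L 689 96)))))))) (L 731 99))) (A (B (N (B
  (B (N (B (N (L 736 99) (N (B (A (B (B (N (L 608 77) (L 420 71)))))) (L 736 99)))) (L 736 99))))
  (A (B (N (L 736 99) (B (A (B (N (L 736 99) (N (B (N (B (B (N (L 647 89) (A (B (N (L 559 77) (N
  (L 559 77) (L 315 49)))))))) (L 697 93))) (L 736 99))))))))))))))))))

def vt49 : CT :=
  N (B (N (B (B (N (L 508 82) (A (B (B (N (B (N (B (B (N (B (N (L 501 82) (N (L 472 79) (A (B (N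
  (B (B (N (B (N (L 0 38) (L 422 80))) (L 472 79)))) (L 472 79))))))) (L 501 82)))) (L 508 82)))
  (L 508 82)))))))) (N (B (A (B (B (N (B (N (B (B (N (B (N (L 496 82) (N (L 496 82) (A (B (N (B (B
  (N (B (N (L 329 57) (N (L 0 38) (L 329 57)))) (L 418 78)))) (L 418 78))))))) (L 496 82)))) (L
  505 82))) (L 508 82)))))) (A (B (N (B (B (N (B (N (L 453 74) (N (L 453 74) (A (B (N (L 0 38) (L
  390 68))))))) (L 453 74)))) (L 503 82))))))) (A (B (N (B (B (N (B (N (L 477 82) (N (B (A (B (B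
  (N (B (N (L 469 82) (N (L 459 82) (A (B (N (B (B (N (L 429 82) (A (B (N (L 0 32) (L 297
  51))))))) (L 429 82))))))) (L 469 82)))))) (L 477 82)))) (L 477 82)))) (N (B (N (B (B (N (L 301
  49) (A (B (N (B (B (N (B (B (N (L 273 40) (A (B (N (B (B (N (L 238 25) (L 0 5)))) (L 273
  40))))))) (L 292 49)))) (L 298 49))))))) (L 301 49))) (A (B (N (B (B (N (B (N (B (B (N (B (N (L
  301 49) (N (L 301 49) (A (B (N (B (B (N (L 270 42) (A (B (N (L 207 36) (L 0 5))))))) (L 270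
  42))))))) (L 301 49)))) (L 301 49))) (L 301 49)))) (L 301 49))))))))

def vt50 : CT :=
  N (B (N (B (B (N (B (N (B (B (N (B (N (L 349 60) (N (L 349 60) (A (B (N (L 346 59) (N (B (N (L
  321 52) (B (A (B (N (L 321 52) (N (B (N (B (B (N (L 0 16) (L 252 30)))) (L 296 36))) (L 321
  52)))))))) (L 343 59)))))))) (L 349 60)))) (N (L 222 38) (L 0 38)))) (A (B (N (L 443 81) (N (L
  443 81) (A (B (N (L 443 81) (A (B (N (L 443 81) (B (A (B (N (L 443 81) (N (B (N (B (B (N (L 219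
  44) (L 0 38)))) (L 345 48))) (L 443 81))))))))))))))))))) (B (A (B (N (L 492 82) (N (B (N (B (B
  (N (B (N (B (B (N (B (N (L 483 82) (N (L 483 82) (A (B (N (L 471 82) (N (B (N (L 347 54) (B (A
  (B (N (L 347 54) (N (B (N (L 0 38) (L 219 38))) (L 347 54)))))))) (L 456 82)))))))) (L 483
  82)))) (L 483 82))) (L 488 82)))) (B (A (B (N (L 484 82) (N (B (N (L 473 78) (B (A (B (N (L 448
  72) (N (B (N (L 395 55) (B (A (B (N (L 269 49) (N (L 0 38) (L 269 49)))))))) (L 448 72))))))))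
  (L 484 82)))))))) (A (B (N (B (B (N (B (N (L 492 82) (N (L 492 82) (A (B (N (L 492 82) (N (B (N
  (L 365 55) (B (A (B (N (L 222 38) (L 0 38))))))) (L 428 77)))))))) (L 492 82)))) (L 492
  82))))))))))) (A (B (N (B (B (N (B (N (B (B (N (B (N (B (B (N (B (N (L 523 82) (N (L 523 82) (A
  (B (N (L 505 82) (N (L 439 81) (A (B (N (B (B (N (B (N (L 0 38) (L 223 38))) (L 350 60)))) (L
  439 81))))))))))) (L 523 82)))) (L 533 82))) (L 533 82)))) (N (L 533 82) (A (B (N (L 533 82) (N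
  (B (N (L 507 78) (B (A (B (N (L 479 61) (N (L 434 55) (A (B (N (B (B (N (L 0 38) (L 309 49))))
  (L 309 49))))))))))) (L 520 82)))))))) (A (B (N (B (B (N (B (N (L 498 82) (N (L 498 82) (A (B (N
  (L 469 77) (N (L 406 71) (A (B (N (L 0 38) (L 223 38))))))))))) (L 518 82)))) (L 533 82)))))))
  (A (B (N (B (B (N (B (N (L 533 82) (N (B (A (B (B (N (B (N (L 524 82) (N (L 524 82) (A (B (N (L
  483 82) (N (L 483 82) (A (B (N (L 483 82) (A (B (N (B (B (N (L 0 93) (L 223 38)))) (L 350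
  60)))))))))))))) (L 531 82)))))) (L 533 82)))) (L 533 82)))) (B (A (B (N (L 533 82) (N (L 533
  82) (A (B (N (L 533 82) (A (B (N (L 533 82) (B (A (B (N (L 533 82) (N (L 533 82) (A (B (N (L 533
  82) (A (B (N (L 309 49) (L 0 104)))))))))))))))))))))))))))))

def vt51 : CT :=
  N (B (N vt48 (B (A (B (N (B (B (N (L 416 71) (A (B (N (L 354 65) (L 0 38))))))) (N (B (N (B (B
  (N (B (N (B (B (N (B (N (L 443 71) (N (L 443 71) (A (B (N (L 438 71) (N (B (N (L 388 60) (B (A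
  (B (N (L 388 60) (N (B (N (B (B (N (L 0 82) (L 250 38)))) (L 338 44))) (L 388 60)))))))) (L 432
  71)))))))) (L 443 71)))) (L 443 71))) (A (B (N (L 445 71) (N (L 445 71) (A (B (N (L 445 71) (A
  (B (N (L 445 71) (B (A (B (N (L 445 71) (N (B (N (L 0 93) (L 250 38))) (L 445
  71))))))))))))))))))) (B (A (B (N (L 443 71) (N (B (N (L 439 71) (B (A (B (N (L 429 71) (N (B (N
  (L 407 61) (B (A (B (N (L 357 55) (N (B (N (L 250 38) (L 0 93))) (L 357 55)))))))) (L 429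
  71)))))))) (L 443 71)))))))) (A (B (N (B (B (N (B (N (L 446 71) (N (L 446 71) (A (B (N (L 446
  71) (N (B (N (L 396 61) (B (A (B (N (L 339 44) (N (L 250 38) (L 0 82)))))))) (L 421 71))))))))
  (L 446 71)))) (A (B (N (L 446 71) (B (A (B (N (L 446 71) (N (L 446 71) (A (B (N (L 446 71) (A (B
  (N (L 446 71) (B (A (B (N (L 446 71) (N (L 446 71) (A (B (N (L 446 71) (L 0
  93))))))))))))))))))))))))))))))))) (A (B (N (B (B vt49)) vt50)))

def vt52 : CT :=
  N (B (A (B (B (N (B (N (B (B (N (B (N (L 501 82) (N (L 501 82) (A (B (N (B (B (N (B (N (L 417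
  74) (N (B (A (B (B (N (L 0 93) (L 252 49)))))) (L 417 74)))) (L 462 82)))) (L 462 82))))))) (L
  501 82)))) (N (L 504 82) (A (B (N (B (B (N (L 500 82) (A (B (N (B (B (N (B (N (L 446 79) (N (B
  (A (B (B (N (B (N (L 253 49) (L 0 93))) (L 253 49)))))) (L 446 79)))) (L 446 79)))) (L 484
  82))))))) (L 500 82))))))) (L 507 82)))))) (A (B (N (B (B (N (B (N (L 480 82) (N (L 480 82) (A
  (B (N (B (B (N (B (N (L 252 49) (N (L 252 49) (L 0 93)))) (L 252 49)))) (L 448 82))))))) (A (B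
  (N (L 476 82) (N (B (N (B (B (N (L 476 82) (A (B (N (B (B (N (B (B (N (L 364 56) (A (B (N (B (B
  (N (L 227 41) (L 0 93)))) (L 364 56))))))) (L 442 78)))) (L 466 82))))))) (L 476 82))) (L 476
  82)))))))) (N (B (N (L 505 82) (B (A (B (N (L 505 82) (N (L 505 82) (A (B (N (B (B (N (B (N (L
  505 82) (N (L 505 82) (A (B (N (L 505 82) (N (L 0 104) (L 253 49)))))))) (L 505 82)))) (L 505
  82))))))))))) (A (B (N (B (B (N (L 505 82) (A (B (N (B (B (N (B (N (L 368 61) (N (L 368 61) (A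
  (B (N (L 252 49) (L 0 93))))))) (L 445 79)))) (L 505 82))))))) (L 505 82))))))))

def vt53 : CT :=
  N (B (N (B (B (N (B (N (B (B (N (L 462 66) (A (B (N (L 462 66) (N (L 462 66) (A (B (N (B (B (N
  (L 462 66) (A (B (N (L 462 66) (N (B (N (B (B (N (L 311 49) (L 462 66)))) (L 462 66))) (L 462
  66)))))))) (L 462 66))))))))))) (N (B (A (B (B (N (L 456 66) (A (B (N (B (B (N (L 414 66) (A (B
  (N (L 414 66) (N (B (N (L 0 16) (L 285 42))) (L 414 66)))))))) (L 449 66))))))))) (L 462 66))))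
  (A (B (N (B (B (N (B (B (N (L 448 57) (A (B (N (B (B (N (L 430 42) (A (B (N (L 311 22) (N (B (N
  (B (B (N (L 311 22) (L 0 93)))) (L 311 22))) (L 311 22)))))))) (L 448 57))))))) (L 457 66)))) (L
  461 66))))))) (B (A (B (N (L 312 49) (L 463 66))))))) (A (B (N (B (B (N (B (N (B (B (N (B (N (L
  464 66) (N (L 464 66) (A (B (N (B (B (N (L 448 59) (A (B (N (L 417 53) (N (L 313 22) (A (B (N (B
  (B (N (L 0 93) (L 313 22)))) (L 313 22))))))))))) (L 448 59))))))) (L 464 66)))) (L 464 66))) (A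
  (B (N (L 464 66) (N (L 464 66) (A (B (N (B (B (N (L 464 66) (A (B (N (L 464 66) (N (L 464 66) (L
  313 49)))))))) (L 464 66))))))))))) (A (B (N (B (B (N (L 464 66) (A (B (N (B (B (N (L 397 65) (A
  (B (N (L 285 42) (L 0 16))))))) (L 436 66))))))) (L 464 66)))))))

def vt54 : CT :=
  N (B (N (B (B (N (B (N (B (B (N (B (N (L 390 66) (N (L 390 66) (A (B (N (L 390 66) (N (L 390 66)
  (A (B (N (B (B (N (B (N (B (B (N (B (N (L 0 16) (L 390 66))) (L 390 66)))) (L 390 66))) (L 390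
  66)))) (L 390 66))))))))))) (A (B (N (B (B (B (A (B (N (B (B (N (B (N (B (B (A (B (N (L 0 93) (L
  255 33)))))) (L 255 33))) (L 255 33)))) (L 377 66))))))) (L 386 66))))))) (N (L 392 66) (A (B (N
  (B (B (N (L 392 66) (A (B (N (L 392 66) (N (L 392 66) (A (B (N (B (B (N (B (N (B (B (N (B (N (L
  392 66) (N (L 392 66) (L 0 16)))) (L 392 66)))) (L 392 66))) (L 392 66)))) (L 392 66)))))))))))
  (L 392 66))))))) (A (B (N (L 0 104) (N (B (N (B (B (N (B (N (L 251 49) (N (L 236 46) (A (B (N (B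
  (B (N (B (N (L 0 5) (L 211 47))) (L 236 46)))) (L 236 46))))))) (L 251 49)))) (L 255 49))) (L
  255 49)))))))) vt52)) (A (B (N (B (B (N (B (N (B (B (A (B (N (B (B (N (L 539 82) (A (B (N (B (B
  (B (A (B (N (B (B (N (L 239 49) (L 369 63)))) (L 486 82))))))) (L 521 82))))))) (L 545 82))))))
  (N (B (A (B (B (N (B (N (L 541 82) (N (L 536 82) (A (B (N (B (B (N (L 521 82) (A (B (N (L 306
  49) (L 455 68))))))) (L 521 82))))))) (L 541 82)))))) (A (B (N (L 545 82) (N (L 545 82) (A (B (N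
  (B (B (N (L 545 82) (A (B (N (B (B (N (L 0 104) (L 306 49)))) (L 545 82))))))) (L 545
  82))))))))))) (A (B (N (B (B (N (L 519 82) (A (B (N (B (B (N (L 415 54) (A (B (N (L 0 93) (L 239
  49))))))) (L 475 77))))))) (L 534 82))))))) vt53)))

def vt55 : CT :=
  N (B (B (N (B (N (B (B (N (L 483 77) (A (B (N (L 483 77) (N (L 483 77) (A (B (N (L 483 77) (A (B
  (N (B (B (N (B (N (B (B (N (L 308 49) (L 483 77)))) (L 483 77))) (L 483 77)))) (L 483
  77)))))))))))))) (N (B (A (B (B (N (L 472 77) (A (B (N (L 436 77) (N (B (N (B (B (N (B (N (L 0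
  27) (L 291 34))) (L 436 77)))) (L 436 77))) (L 436 77)))))))))) (A (B (N (L 482 76) (N (B (N (L
  470 69) (B (A (B (N (L 470 69) (N (B (N (B (B (N (L 308 33) (L 435 47)))) (L 457 53))) (L 470
  69)))))))) (L 481 76)))))))) (A (B (N (L 483 77) (N (L 483 77) (A (B (N (B (B (N (L 483 77) (A
  (B (N (L 483 77) (N (B (N (B (B (N (B (N (B (B (N (L 367 61) (L 0 27)))) (L 445 67))) (L 483
  77)))) (L 483 77))) (L 483 77)))))))) (L 483 77))))))))))) (N (B (A (B (B (N (B (N (L 419 55) (N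
  (L 419 55) (A (B (N (L 419 55) (N (L 419 55) (A (B (N (L 419 55) (A (B (N (B (B (N (B (N (L 419
  55) (N (B (A (B (B (N (L 0 104) (L 307 49)))))) (L 419 55)))) (L 419 55)))) (L 419
  55)))))))))))))) (A (B (N (B (B (N (L 408 55) (A (B (N (L 408 55) (N (B (N (B (B (N (B (N (L 304
  22) (N (L 0 93) (L 304 22)))) (L 304 22)))) (L 376 48))) (L 408 55)))))))) (L 417 55))))))))) (A
  (B (N (B (B (N (B (N (B (B (N (L 290 30) (A (B (B (N (B (N (B (B (N (B (N (L 228 44) (L 0 0)))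
  (L 228 44)))) (L 290 30))) (L 290 30)))))))) (L 307 49))) (L 309 49)))) (N (L 0 93) (L 309
  49))))))

def vt56 : CT :=
  N (B (B (N (B vt55) (A (B (N (B (B (N (B (B (N (L 526 82) (A (B (N (B (B (N (L 522 70) (A (B (N
  (L 492 50) (N (B (N (B (B (N (L 492 50) (A (B (N (B (B (N (L 0 93) (L 222 48)))) (L 413
  71))))))) (L 492 50))) (L 492 50)))))))) (L 526 82))))))) (A (B (N (L 529 82) (N (L 529 82) (A
  (B (N (L 529 82) (A (B (N (B (B (N (L 529 82) (L 306 49)))) (L 529 82)))))))))))))) (N (B (N (B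
  (B (N (L 498 82) (A (B (N (L 470 82) (N (B (N (B (B (N (L 222 48) (L 0 93)))) (L 420 68))) (L
  470 82)))))))) (L 523 82))) (A (B (N (L 529 82) (A (B (N (L 529 82) (B (A (B (N (L 529 82) (N (B
  (N (B (B (N (L 417 61) (L 307 49)))) (L 480 65))) (L 529 82))))))))))))))))))) (B (A (B (N (B (B
  (N (L 524 82) (A (B (N (L 445 76) (L 246 49))))))) (N (B (N (B (B (N (B (N (B (B (N (B (N (L 557
  82) (N (L 557 82) (A (B (N (L 551 82) (N (B (N (L 489 71) (B (A (B (N (L 489 71) (N (B (N (B (B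
  (N (L 0 93) (L 315 49)))) (L 425 55))) (L 489 71)))))))) (L 544 82)))))))) (L 557 82)))) (L 557
  82))) (A (B (N (L 560 82) (N (L 560 82) (A (B (N (L 560 82) (A (B (N (L 560 82) (B (A (B (N (L
  560 82) (N (L 315 49) (L 560 82))))))))))))))))))) (B (A (B (N (L 558 82) (N (B (N (L 552 82) (B
  (A (B (N (L 540 82) (N (B (N (L 513 72) (B (A (B (N (L 450 66) (N (L 315 49) (L 450 66))))))))
  (L 540 82)))))))) (L 558 82)))))))) (A (B (N (B (B (N (B (N (L 562 82) (N (L 562 82) (A (B (N (L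
  562 82) (N (B (N (L 498 72) (B (A (B (N (L 426 55) (N (L 315 49) (L 0 93)))))))) (L 530
  82)))))))) (L 562 82)))) (A (B (N (L 562 82) (B (A (B (N (L 562 82) (N (L 562 82) (A (B (N (L
  562 82) (A (B (N (L 562 82) (B (A (B (N (L 562 82) (N (L 562 82) (A (B (N (L 562 82) (L 0
  104)))))))))))))))))))))))))))))))

def vt57 : CT :=
  N (B (N (B (B (N (B vt25) (A (B (N (B (B vt26)) (N (B (N vt27 (B (A (B (N (B (B (N (L 696 77) (A
  (B (N (L 499 71) (L 0 104))))))) (L 791 93))))))) (A (B vt28))))))))) vt40)) (N (B (N (B (B (N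
  (B (N (B (B (N (B vt41) (A (B (N (B (B (B (A (B (N (B (B (N (B (N (B (B (A (B (N (B (B (N (L 528
  77) (L 350 64)))) (L 592 67)))))) (L 592 67))) (L 592 67)))) (L 622 82))))))) (N (B (N (B (B (N
  (B (N (L 824 88) (N (L 813 85) (A (B (N (B (B (N (B (N (L 625 44) (L 793 86))) (L 813 85)))) (L
  813 85))))))) (L 824 88)))) (L 827 88))) (A (B (N (B (B (N (L 827 88) (A (B (N (L 827 88) (N (B
  (N (B (B (N (B (N (B (B (N (L 781 88) (A (B (N (L 635 88) (N (L 635 88) (L 476 72)))))))) (L 812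
  88))) (L 827 88)))) (L 827 88))) (L 827 88)))))))) (A (B (N (B (B (N (B (N (B (B (N (B (N (B (B
  (N (L 766 88) (A (B (N (L 553 75) (N (L 553 75) (L 0 38)))))))) (L 805 88))) (L 827 88)))) (L
  827 88))) (L 827 88)))) (L 827 88)))))))))))))) vt43)) (A (B (N (B (B vt44)) (N (B vt45) (A (B
  vt46))))))))) vt51)) (A (B (N (B (B vt54)) (N (B vt56) (L 0 49))))))

def vtR : CT :=
  N (B (N (B (B vt7)) vt21)) vt57

def ht0 : CT :=
  N (N (L 50 0) (N (N (L 50 0) (N (L 50 0) (N (N (L 50 0) (N (N (L 50 0) (N (L 50 0) (N (L 738 0)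
  (N (N (L 50 0) (N (N (L 50 0) (N (L 50 0) (N (L 50 0) (L 665 0)))) (L 665 0))) (L 50 0))))) (L
  848 0))) (N (N (L 50 0) (N (N (L 50 0) (N (L 50 0) (N (N (L 50 0) (N (N (L 50 0) (N (L 50 0) (N
  (L 317 0) (L 50 0)))) (L 658 0))) (L 896 0)))) (L 896 0))) (L 50 0))))) (N (N (L 50 0) (N (N (L
  50 0) (N (L 50 0) (N (L 1122 0) (N (N (L 50 0) (N (N (L 50 0) (N (L 50 0) (N (N (L 50 0) (N (L
  50 0) (L 652 0))) (L 1073 0)))) (L 1073 0))) (L 50 0))))) (N (N (L 50 0) (N (L 581 0) (L 50 0)))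
  (L 897 0)))) (N (N (L 50 0) (N (N (L 50 0) (N (L 50 0) (N (N (L 50 0) (N (N (L 50 0) (N (L 50 0)
  (N (L 218 0) (L 50 0)))) (L 451 0))) (L 614 0)))) (L 614 0))) (L 50 0))))) (N (N (L 50 0) (N (N
  (L 50 0) (N (L 50 0) (N (N (L 50 0) (N (N (L 50 0) (N (L 50 0) (N (L 892 0) (N (N (L 50 0) (N (N
  (L 50 0) (N (L 50 0) (N (L 50 0) (L 803 0)))) (L 803 0))) (L 50 0))))) (L 1025 0))) (N (N (L 50
  0) (N (N (L 50 0) (N (L 50 0) (N (N (L 50 0) (N (L 383 0) (L 795 0))) (L 1083 0)))) (L 1083 0)))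
  (L 50 0))))) (N (N (L 50 0) (N (N (L 50 0) (N (L 50 0) (N (L 1356 0) (N (N (L 50 0) (N (N (L 50
  0) (N (L 50 0) (N (L 787 0) (L 1296 0)))) (L 1296 0))) (L 50 0))))) (N (L 702 0) (L 1084 0))))
  (N (N (L 50 0) (N (N (L 50 0) (N (L 50 0) (N (N (L 50 0) (N (N (L 50 0) (N (L 50 0) (N (L 263 0)
  (L 50 0)))) (L 545 0))) (L 742 0)))) (L 742 0))) (L 50 0))))) (N (N (L 50 0) (N (N (L 50 0) (N
  (L 50 0) (N (N (L 50 0) (N (N (L 50 0) (N (L 50 0) (N (L 1078 0) (L 970 0)))) (L 1238 0))) (N (N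
  (L 50 0) (N (N (L 50 0) (N (L 50 0) (N (N (L 50 0) (N (L 462 0) (L 960 0))) (L 1308 0)))) (L
  1308 0))) (L 50 0))))) (N (N (L 50 0) (N (L 901 0) (L 462 0))) (L 0 0)))) (N (N (L 50 0) (N (N
  (L 50 0) (N (L 50 0) (N (N (L 50 0) (N (N (L 50 0) (N (L 50 0) (N (L 181 0) (L 50 0)))) (L 374
  0))) (L 508 0)))) (N (L 508 0) (N (N (L 50 0) (N (L 508 0) (N (L 508 0) (L 50 0)))) (L 50 0)))))
  (L 50 0))))

def htR : CT :=
  ht0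

end TSF

namespace TSF

theorem dfs_ok : dfs leafOk 48 9 6 16 vtR (vtR.step true) (vtR.step false) = true := by
  decide +kernel

theorem hub_ok : dfs hubOk 48 9 6 16 htR (htR.step true) (htR.step false) = true := by
  decide +kernel

/-- every leaf satisfies a test -/
noncomputable def CT.all (q : ℕ → ℕ → Bool) (T : CT) : Bool :=
  CT.rec (motive := fun _ => Bool) (fun v p => q v p) (fun _ _ x y => band x y)
    (fun _ x => x) (fun _ x => x) T

theorem vt_all : vtR.all (fun v p => band (bor (Nat.beq v 0) (Nat.ble 207 v))
    (band (Nat.ble v 1000) (Nat.ble p 104))) = true := by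
  decide +kernel

theorem ht_all : htR.all (fun v _ => Nat.ble v 2000) = true := by
  decide +kernel

/-- all leaves below the path `bs` have value zero -/
noncomputable def zeroOn (bs : List Bool) : CT → Bool :=
  List.rec (motive := fun _ => CT → Bool) (fun T => T.all fun v _ => Nat.beq v 0)
    (fun b _ ih T => CT.rec (motive := fun _ => Bool) (fun v _ => Nat.beq v 0)
      (fun x y _ _ => Bool.rec (motive := fun _ => Bool) (ih y) (ih x) b)
      (fun x _ => Bool.rec (motive := fun _ => Bool) true (ih x) b)
      (fun y _ => Bool.rec (motive := fun _ => Bool) (ih y) true b) T) bs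

/-- full binary trees all of whose leaves have value at least 50 -/
noncomputable def CT.big (T : CT) : Bool :=
  CT.rec (motive := fun _ => Bool) (fun v _ => Nat.ble 50 v) (fun _ _ x y => band x y)
    (fun _ _ => false) (fun _ _ => false) T

/-- all leaves off the path `bs` have value at least 50 -/
noncomputable def posOff (bs : List Bool) : CT → Bool :=
  List.rec (motive := fun _ => CT → Bool) (fun _ => true)
    (fun b _ ih T => CT.rec (motive := fun _ => Bool) (fun v _ => Nat.ble 50 v)
      (fun x y _ _ => Bool.rec (motive := fun _ => Bool)
        (band (ih y) x.big) (band (ih x) y.big) b)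
      (fun _ _ => false) (fun _ _ => false) T) bs

def fCode : List Bool := [false, false, false, true, false, false, false]
def hCode : List Bool := [false, false, true, false, false, false]

theorem vt_f : zeroOn fCode vtR = true := by
  decide +kernel

theorem ht_h : zeroOn hCode htR = true := by
  decide +kernel

theorem ht_pos : posOff hCode htR = true := by
  decide +kernel

end TSF

namespace TSF

abbrev W := List (Fin 3)

/-! ### Square-free words -/

theorem sf_middle {α : Type*} {a b c : List α} (h : SquareFree (a ++ b ++ c)) : SquareFree b := by
  intro x y z e
  apply h (a ++ x) y (z ++ c)
  simp [e]

theorem sf_of_isInfix {α : Type*} {b l : List α} (h : SquareFree l) (hb : b <:+: l) :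
    SquareFree b := by
  obtain ⟨a, c, rfl⟩ := hb
  exact sf_middle h

theorem sf_suffix {α : Type*} {a b : List α} (h : SquareFree (a ++ b)) : SquareFree b :=
  sf_of_isInfix h (List.suffix_append a b).isInfix

theorem sf_tail {α : Type*} {c : α} {l : List α} (h : SquareFree (c :: l)) : SquareFree l :=
  sf_of_isInfix h (List.suffix_cons c l).isInfix

theorem sf_drop {α : Type*} {l : List α} (h : SquareFree l) (n : ℕ) : SquareFree (l.drop n) :=
  sf_of_isInfix h (List.drop_suffix n l).isInfix

theorem sf_reverse {α : Type*} {l : List α} (h : SquareFree l) : SquareFree l.reverse := by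
  intro x y z e
  have := h z.reverse y.reverse x.reverse (by
    rw [← List.reverse_reverse l, e]; simp)
  simpa using this

theorem sf_reverse_iff {α : Type*} {l : List α} : SquareFree l.reverse ↔ SquareFree l :=
  ⟨fun h => by simpa using sf_reverse h, sf_reverse⟩

theorem sf_map {α β : Type*} {g : α → β} (hg : Function.Injective g) {l : List α}
    (h : SquareFree l) : SquareFree (l.map g) := by
  intro x y z e
  rw [List.map_eq_append_iff] at e
  obtain ⟨l1, z', rfl, e1, rfl⟩ := e
  rw [List.map_eq_append_iff] at e1
  obtain ⟨l2, y', rfl, e2, e3⟩ := e1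
  rw [List.map_eq_append_iff] at e2
  obtain ⟨x', y'', rfl, rfl, e4⟩ := e2
  have : y' = y'' := List.map_injective_iff.2 hg (by rw [e3, e4])
  subst this
  have := h x' y' z' rfl
  subst this
  simpa using e3.symm

/-- a square of period `P` at the head -/
def headSq (P : ℕ) (l : W) : Prop := 1 ≤ P ∧ 2 * P ≤ l.length ∧ l.take P = (l.drop P).take P

theorem not_headSq {l : W} (h : SquareFree l) (P : ℕ) : ¬ headSq P l := by
  rintro ⟨h1, h2, h3⟩
  have e : l = [] ++ l.take P ++ l.take P ++ (l.drop P).drop P := by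
    conv_lhs => rw [← List.take_append_drop P l, ← List.take_append_drop P (l.drop P), ← h3]
    simp
  have := h _ _ _ e
  have h4 := congrArg List.length this
  rw [List.length_take, List.length_nil] at h4
  omega

theorem sf_cons_iff {c : Fin 3} {l : W} :
    SquareFree (c :: l) ↔ SquareFree l ∧ ∀ P, ¬ headSq P (c :: l) := by
  constructor
  · exact fun h => ⟨sf_tail h, not_headSq h⟩
  · rintro ⟨h, h2⟩ x y z e
    cases x with
    | cons a x =>
      simp only [List.cons_append, List.cons.injEq] at e
      exact h x y z e.2
    | nil =>
      by_contra hy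
      have hy' : 1 ≤ y.length := List.length_pos_of_ne_nil hy
      apply h2 y.length
      rw [e]
      refine ⟨hy', by simp; omega, by simp⟩

theorem sf_nil {α : Type*} : SquareFree ([] : List α) := by
  intro x y z e
  have := congrArg List.length e
  simp at this
  exact List.eq_nil_of_length_eq_zero (by omega)

/-! ### Longest common prefixes -/

def lcp : W → W → ℕ
  | x :: s, y :: t => if x = y then lcp s t + 1 else 0
  | _, _ => 0

theorem le_lcp {k : ℕ} : ∀ {s t : W}, k ≤ lcp s t ↔ k ≤ s.length ∧ k ≤ t.length ∧ s.take k = t.take k := by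
  induction k with
  | zero => simp
  | succ k ih =>
    intro s t
    match s, t with
    | [], t => simp [lcp]
    | x :: s, [] => simp [lcp]
    | x :: s, y :: t =>
      by_cases h : x = y
      · subst h
        simp [lcp, ih]
      · simp [lcp, h]

def mu (P : ℕ) (l : W) : ℕ := lcp l (l.drop P)

theorem headSq_iff {P : ℕ} {l : W} : headSq P l ↔ 1 ≤ P ∧ P ≤ mu P l := by
  unfold headSq mu
  rw [le_lcp]
  simp only [List.length_drop]
  constructor
  · rintro ⟨a, b, c⟩; exact ⟨a, by omega, by omega, c⟩
  · rintro ⟨a, b, c, d⟩; exact ⟨a, by omega, d⟩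

theorem mu_lt {P : ℕ} {l : W} (h : SquareFree l) (hP : 1 ≤ P) : mu P l < P := by
  by_contra hh
  exact not_headSq h P (headSq_iff.2 ⟨hP, by omega⟩)

theorem mu_cons {P : ℕ} (hP : 1 ≤ P) (c : Fin 3) (l : W) :
    mu P (c :: l) = if l[P - 1]? = some c then mu P l + 1 else 0 := by
  obtain ⟨p, rfl⟩ : ∃ p, P = p + 1 := ⟨P - 1, by omega⟩
  unfold mu
  simp only [List.drop_succ_cons, Nat.add_sub_cancel]
  by_cases h : p < l.length
  · rw [List.drop_eq_getElem_cons h]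
    simp only [lcp, List.getElem?_eq_getElem h, Option.some.injEq]
    by_cases h2 : c = l[p]
    · rw [if_pos h2, if_pos h2.symm]
    · rw [if_neg h2, if_neg (Ne.symm h2)]
  · rw [List.drop_eq_nil_of_le (by omega)]
    have : l[p]? = none := List.getElem?_eq_none (by omega)
    simp [this, lcp]

theorem mu_min {l : W} (h : SquareFree l) {P Q : ℕ} (hPQ : P < Q) :
    min (mu P l) (mu Q l) < Q - P := by
  by_contra hh
  push Not at hh
  have h1 : Q - P ≤ mu P l := le_trans hh (min_le_left _ _)
  have h2 : Q - P ≤ mu Q l := le_trans hh (min_le_right _ _)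
  unfold mu at h1 h2
  rw [le_lcp] at h1 h2
  refine not_headSq (sf_drop h P) (Q - P) ⟨by omega, ?_, ?_⟩
  · have := h2.2.1
    simp only [List.length_drop] at this ⊢
    omega
  · rw [← h1.2.2, List.drop_drop, h2.2.2]
    congr 2
    omega

theorem mu_drop (P g : ℕ) (l : W) : mu P l ≤ mu P (l.drop g) + g := by
  by_cases hg : g ≤ mu P l
  · have h : mu P l ≤ mu P l := le_rfl
    have : mu P l - g ≤ mu P (l.drop g) := by
      unfold mu at h hg ⊢
      rw [le_lcp] at h
      obtain ⟨a, b, c⟩ := h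
      rw [le_lcp]
      simp only [List.length_drop] at b ⊢
      refine ⟨by omega, by omega, ?_⟩
      have := congrArg (List.drop g) c
      rw [List.drop_take, List.drop_take] at this
      rw [this]
      rw [List.drop_drop, List.drop_drop, Nat.add_comm]
    omega
  · omega

theorem mu_le_length {P : ℕ} {l : W} : mu P l ≤ l.length - P := by
  have h : mu P l ≤ mu P l := le_rfl
  conv_rhs at h => unfold mu
  rw [le_lcp] at h
  simpa using h.2.1

theorem mu_map {P : ℕ} {l : W} (g : Equiv.Perm (Fin 3)) : mu P (l.map g) = mu P l := by
  unfold mu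
  rw [← List.map_drop]
  generalize l.drop P = t
  induction l generalizing t with
  | nil => simp [lcp]
  | cons x s ih =>
    cases t with
    | nil => simp [lcp]
    | cons y t => simp [lcp, ih]

/-! ### Packed words -/

def pack : W → ℕ
  | [] => 0
  | x :: l => (x.1 + 1) + 4 * pack l

theorem pack_inj : ∀ {s t : W}, pack s = pack t → s = t
  | [], [], _ => rfl
  | [], y :: t, h => by simp only [pack] at h; omega
  | x :: s, [], h => by simp only [pack] at h; omega
  | x :: s, y :: t, h => by
    simp only [pack] at h
    have hx := x.2
    have hy := y.2
    have h1 : x = y := Fin.ext (by omega)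
    have h2 : pack s = pack t := by omega
    rw [h1, pack_inj h2]

theorem pack_div (P : ℕ) (l : W) : pack l / 4 ^ P = pack (l.drop P) := by
  induction P generalizing l with
  | zero => simp
  | succ P ih =>
    cases l with
    | nil => simp [pack]
    | cons x l =>
      rw [List.drop_succ_cons, ← ih, pow_succ', ← Nat.div_div_eq_div_mul]
      congr 1
      simp only [pack]
      have := x.2
      omega

theorem pack_lt (l : W) : pack l < 4 ^ l.length := by
  induction l with
  | nil => simp [pack]
  | cons x l ih =>
    simp only [pack, List.length_cons, pow_succ]
    have := x.2
    omega

theorem pack_append (s t : W) : pack (s ++ t) = pack s + 4 ^ s.length * pack t := by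
  induction s with
  | nil => simp [pack]
  | cons x s ih =>
    simp only [List.cons_append, pack, ih, List.length_cons, pow_succ]
    ring

theorem pack_mod (P : ℕ) (l : W) : pack l % 4 ^ P = pack (l.take P) := by
  by_cases h : P ≤ l.length
  · conv_lhs => rw [← List.take_append_drop P l, pack_append]
    have h2 : (l.take P).length = P := by simp [h]
    rw [h2, Nat.add_mul_mod_self_left, Nat.mod_eq_of_lt]
    have := pack_lt (l.take P)
    rwa [h2] at this
  · rw [List.take_of_length_le (by omega), Nat.mod_eq_of_lt]
    exact lt_of_lt_of_le (pack_lt l) (Nat.pow_le_pow_right (by norm_num) (by omega))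

theorem bor_true {a b : Bool} : bor a b = true ↔ a = true ∨ b = true := by
  cases a <;> cases b <;> simp [bor]
theorem band_true {a b : Bool} : band a b = true ↔ a = true ∧ b = true := by
  cases a <;> cases b <;> simp [band]
theorem force_eq (n : ℕ) (k : ℕ → Bool) : force n k = k n := by
  cases n <;> rfl

theorem mem_mods {m : ℕ} : m ∈ mods ↔ ∃ P, 1 ≤ P ∧ P ≤ 24 ∧ m = 4 ^ P := by
  have : mods = (List.range 24).map (fun i => 4 ^ (i + 1)) := by decide +kernel
  rw [this]
  simp only [List.mem_map, List.mem_range]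
  constructor
  · rintro ⟨i, hi, rfl⟩; exact ⟨i + 1, by omega, by omega, rfl⟩
  · rintro ⟨P, h1, h2, rfl⟩; exact ⟨P - 1, by omega, by congr 1; omega⟩

theorem anyS_true {w : ℕ} {ms : List ℕ} :
    anyS w ms = true ↔ ∃ m ∈ ms, w % m = (w / m) % m := by
  induction ms with
  | nil => simp [anyS]
  | cons m ms ih =>
    have : anyS w (m :: ms) = bor (Nat.beq (w % m) ((w / m) % m)) (anyS w ms) := rfl
    rw [this, bor_true, ih]
    simp

theorem noS_true {r M : ℕ} {ms : List ℕ} :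
    noS r M ms = true ↔ ∀ m ∈ ms, (r % (M / m)) % m ≠ (r / m) % m := by
  induction ms with
  | nil => simp [noS]
  | cons m ms ih =>
    have : noS r M (m :: ms) = Bool.rec (motive := fun _ => Bool) (noS r M ms) false
      (Nat.beq ((r % (M / m)) % m) ((r / m) % m)) := rfl
    rw [this]
    by_cases h : (r % (M / m)) % m = (r / m) % m
    · have h2 : Nat.beq ((r % (M / m)) % m) ((r / m) % m) = true := by simp [h]
      rw [h2]; simp [h]
    · have h2 : Nat.beq ((r % (M / m)) % m) ((r / m) % m) = false := by
        rw [← Bool.not_eq_true, Nat.beq_eq]; exact h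
      rw [h2]; simp [h, ih]

/-- short square at the head -/
def short (l : W) : Prop := ∃ P, P ≤ 24 ∧ headSq P l

theorem anyS_pack {l : W} (hl : l ≠ []) : anyS (pack l) mods = true ↔ short l := by
  rw [anyS_true]
  have hlen : 1 ≤ l.length := List.length_pos_of_ne_nil hl
  constructor
  · rintro ⟨m, hm, e⟩
    obtain ⟨P, h1, h2, rfl⟩ := mem_mods.1 hm
    rw [pack_div, pack_mod, pack_mod] at e
    have e := pack_inj e
    refine ⟨P, h2, h1, ?_, e⟩
    have := congrArg List.length e
    simp at this
    omega
  · rintro ⟨P, h2, h1, h3, e⟩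
    refine ⟨4 ^ P, mem_mods.2 ⟨P, h1, h2, rfl⟩, ?_⟩
    rw [pack_div, pack_mod, pack_mod, e]

theorem short_append {u t : W} (h : short u) : short (u ++ t) := by
  obtain ⟨P, h1, h2, h3, h4⟩ := h
  refine ⟨P, h1, h2, by simp; omega, ?_⟩
  rw [List.take_append_of_le_length (by omega), List.drop_append_of_le_length (by omega),
    List.take_append_of_le_length (by simp; omega), h4]

theorem noS_pack {u t : W} (hu : 25 ≤ u.length) (h : noS (pack u) (4 ^ u.length) mods = true) :
    ¬ short (u ++ t) := by
  rintro ⟨P, h1, h2, h3, h4⟩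
  rw [noS_true] at h
  apply h (4 ^ P) (mem_mods.2 ⟨P, h2, h1, rfl⟩)
  rw [Nat.pow_div (by omega) (by norm_num), pack_mod, pack_mod, pack_div, pack_mod]
  congr 1
  rw [List.take_append_of_le_length (by omega), List.drop_append_of_le_length (by omega)] at h4
  have h5 := congrArg (List.take (u.length - P)) h4
  rw [List.take_take, List.take_take] at h5
  rw [List.take_take, Nat.min_comm, h5]
  rw [Nat.min_comm, ← List.take_take, List.take_append_of_le_length (by simp), List.take_of_length_le (l := u.drop P) (by simp)]

end TSF

namespace TSF

/-! ### Evaluating context trees -/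

def look : CT → W → ℕ × ℕ
  | .L v p, _ => (v, p)
  | .N a b, x :: y :: z :: t => if x = z then look a (y :: z :: t) else look b (y :: z :: t)
  | .A a, x :: y :: z :: t => if x = z then look a (y :: z :: t) else (0, 0)
  | .B b, x :: y :: z :: t => if x = z then (0, 0) else look b (y :: z :: t)
  | .N _ _, _ => (0, 0)
  | .A _, _ => (0, 0)
  | .B _, _ => (0, 0)

theorem look_step (T : CT) (x y z : Fin 3) (t : W) :
    look T (x :: y :: z :: t) = look (T.step (decide (x = z))) (y :: z :: t) := by
  cases T <;> by_cases h : x = z <;> simp [look, CT.step, h]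

theorem tryLeaf_true {lf : ℕ → ℕ → ℕ → ℕ → ℕ → ℕ → ℕ → ℕ → Bool} {r M : ℕ} {T0 T1 T2 : CT}
    (h : tryLeaf lf r M T0 T1 T2 = true) (l : W) :
    lf r M (look T0 l).1 (look T0 l).2 (look T1 l).1 (look T1 l).2 (look T2 l).1 (look T2 l).2
      = true := by
  cases T0 <;> cases T1 <;> cases T2 <;> simp_all [tryLeaf, look]

/-- one extension step of the search -/
noncomputable def dfsExt (lf : ℕ → ℕ → ℕ → ℕ → ℕ → ℕ → ℕ → ℕ → Bool) (n w r M : ℕ) (T0 T1 T2 : CT)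
    (d : ℕ) : Bool :=
  force (Nat.add d (Nat.mul 4 w)) fun w' =>
    bor (anyS w' mods)
      (force (Nat.add r (Nat.mul d M)) fun r' =>
       force (Nat.mul 4 M) fun M' =>
        (fun e => dfs lf n w' r' M' (T0.step e) (T1.step e) (T2.step e))
          (Nat.beq (Nat.mod (Nat.div w 4) 4) d))

theorem dfs_succ (lf : ℕ → ℕ → ℕ → ℕ → ℕ → ℕ → ℕ → ℕ → Bool) (n w r M : ℕ) (T0 T1 T2 : CT) :
    dfs lf (n + 1) w r M T0 T1 T2 = bor (tryLeaf lf r M T0 T1 T2)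
      (band (dfsExt lf n w r M T0 T1 T2 1) (band (dfsExt lf n w r M T0 T1 T2 2)
        (dfsExt lf n w r M T0 T1 T2 3))) := rfl

theorem dfs_sound (lf : ℕ → ℕ → ℕ → ℕ → ℕ → ℕ → ℕ → ℕ → Bool) (n : ℕ) :
    ∀ (x y : Fin 3) (w rest : W) (T0 T1 T2 : CT),
    dfs lf n (pack (y :: x :: w)) (pack (y :: x :: w).reverse) (4 ^ (y :: x :: w).length) T0 T1 T2
      = true →
    SquareFree ((y :: x :: w).reverse ++ rest) → n ≤ rest.length →
    ∃ u rest', (y :: x :: w).reverse ++ rest = u ++ rest' ∧ 2 ≤ u.length ∧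
      lf (pack u) (4 ^ u.length) (look T0 (x :: y :: rest)).1 (look T0 (x :: y :: rest)).2
        (look T1 (x :: y :: rest)).1 (look T1 (x :: y :: rest)).2
        (look T2 (x :: y :: rest)).1 (look T2 (x :: y :: rest)).2 = true := by
  induction n with
  | zero => intro x y w rest T0 T1 T2 h; simp [dfs] at h
  | succ n ih =>
    intro x y w rest T0 T1 T2 h hsf hlen
    rw [dfs_succ, bor_true] at h
    rcases h with h | h
    · exact ⟨_, rest, rfl, by simp, by rw [List.length_reverse]; exact tryLeaf_true h _⟩
    · match rest, hlen with
      | z :: rest, hlen =>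
      have hz : bor (anyS (pack (z :: y :: x :: w)) mods)
          (dfs lf n (pack (z :: y :: x :: w)) (pack (z :: y :: x :: w).reverse)
            (4 ^ (z :: y :: x :: w).length)
            (T0.step (decide (x = z))) (T1.step (decide (x = z))) (T2.step (decide (x = z)))) = true := by
        have e1 : pack (z :: y :: x :: w).reverse
            = Nat.add (pack (y :: x :: w).reverse) (Nat.mul (z.1 + 1) (4 ^ (y :: x :: w).length)) := by
          rw [List.reverse_cons, pack_append]
          simp [pack]
          ring
        have e2 : 4 ^ (z :: y :: x :: w).length = Nat.mul 4 (4 ^ (y :: x :: w).length) := by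
          rw [List.length_cons, pow_succ, mul_comm]; rfl
        have e3 : decide (x = z) = Nat.beq (Nat.mod (Nat.div (pack (y :: x :: w)) 4) 4) (z.1 + 1) := by
          have : Nat.mod (Nat.div (pack (y :: x :: w)) 4) 4 = x.1 + 1 := by
            change (pack (y :: x :: w) / 4) % 4 = _
            simp only [pack]
            have := x.2; have := y.2
            omega
          rw [this]
          rw [Bool.eq_iff_iff]
          simp [Fin.ext_iff]
        have key : dfsExt lf n (pack (y :: x :: w)) (pack (y :: x :: w).reverse)
            (4 ^ (y :: x :: w).length) T0 T1 T2 (z.1 + 1) = true := by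
          simp only [band_true] at h
          obtain ⟨h1, h2, h3⟩ := h
          fin_cases z
          · exact h1
          · exact h2
          · exact h3
        rw [e1, e2, e3]
        simp only [dfsExt, force_eq] at key
        exact key
      rw [bor_true, anyS_pack (by simp)] at hz
      have hsf' : SquareFree ((z :: y :: x :: w).reverse ++ rest) := by
        simpa using hsf
      rcases hz with hz | hz
      · exfalso
        obtain ⟨P, _, hP⟩ := hz
        refine not_headSq ?_ P hP
        apply sf_reverse_iff.1
        exact sf_of_isInfix hsf' (List.prefix_append _ _).isInfix
      · obtain ⟨u, rest', e, hu, hl⟩ := ih y z (x :: w) rest _ _ _ hz hsf' (by simpa using hlen)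
        refine ⟨u, rest', ?_, hu, ?_⟩
        · rw [← e]; simp
        · simpa only [look_step] using hl

theorem look_map (T : CT) (l : W) (g : Equiv.Perm (Fin 3)) : look T (l.map g) = look T l := by
  induction T generalizing l with
  | L v p => simp [look]
  | N a b iha ihb =>
    match l with
    | [] => simp [look]
    | [_] => simp [look]
    | [_, _] => simp [look]
    | x :: y :: z :: t =>
                           have ha := iha (y :: z :: t)
                           have hb := ihb (y :: z :: t)
                           simp only [List.map_cons] at ha hb
                           simp [look, ha, hb]
  | A a ih =>
    match l with
    | [] => simp [look]
    | [_] => simp [look]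
    | [_, _] => simp [look]
    | x :: y :: z :: t =>
                           have ha := ih (y :: z :: t)
                           simp only [List.map_cons] at ha
                           simp [look, ha]
  | B a ih =>
    match l with
    | [] => simp [look]
    | [_] => simp [look]
    | [_, _] => simp [look]
    | x :: y :: z :: t =>
                           have ha := ih (y :: z :: t)
                           simp only [List.map_cons] at ha
                           simp [look, ha]

theorem all_look {T : CT} {q : ℕ → ℕ → Bool} (h : T.all q = true) (h0 : q 0 0 = true) (l : W) :
    q (look T l).1 (look T l).2 = true := by
  induction T generalizing l with
  | L v p => simpa [look, CT.all] using h
  | N a b iha ihb =>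
    have h' : band (a.all q) (b.all q) = true := h
    rw [band_true] at h'
    unfold look
    split <;> try split
    all_goals simp_all
  | A a ih =>
    have h' : a.all q = true := h
    unfold look
    split <;> try split
    all_goals simp_all
  | B a ih =>
    have h' : a.all q = true := h
    unfold look
    split <;> try split
    all_goals simp_all

/-- the word starts with the equality pattern `bs` -/
def codeB : List Bool → W → Prop
  | [], _ => True
  | b :: bs, x :: y :: z :: t => decide (x = z) = b ∧ codeB bs (y :: z :: t)
  | _ :: _, _ => False

instance codeB_dec : ∀ (bs : List Bool) (l : W), Decidable (codeB bs l)
  | [], _ => isTrue trivial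
  | b :: bs, x :: y :: z :: t => by
      have := codeB_dec bs (y :: z :: t)
      unfold codeB; infer_instance
  | _ :: _, [] => isFalse (by simp [codeB])
  | _ :: _, [_] => isFalse (by simp [codeB])
  | _ :: _, [_, _] => isFalse (by simp [codeB])

theorem zeroOn_look {bs : List Bool} : ∀ {T : CT} {l : W}, zeroOn bs T = true → codeB bs l →
    (look T l).1 = 0 := by
  induction bs with
  | nil =>
    intro T l h _
    have := all_look (q := fun v _ => Nat.beq v 0) h rfl l
    simpa using this
  | cons b bs ih =>
    intro T l h hl
    match l, hl with
    | x :: y :: z :: t, hl =>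
    obtain ⟨h1, h2⟩ := hl
    rw [look_step]
    subst h1
    cases T with
    | L v p => simp only [CT.step, look]; simpa [zeroOn] using h
    | N u v =>
      by_cases hx : x = z
      · simp only [hx, decide_true] at h ⊢; exact ih (T := u) h h2
      · simp only [hx, decide_false] at h ⊢; exact ih (T := v) h h2
    | A u =>
      by_cases hx : x = z
      · simp only [hx, decide_true] at h ⊢; exact ih (T := u) h h2
      · simp [hx, CT.step, look]
    | B v =>
      by_cases hx : x = z
      · simp [hx, CT.step, look]
      · simp only [hx, decide_false] at h ⊢; exact ih (T := v) h h2

/-- depth of a tree -/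
def CT.depth : CT → ℕ
  | .L _ _ => 0
  | .N a b => max a.depth b.depth + 1
  | .A a => a.depth + 1
  | .B b => b.depth + 1

theorem big_look {T : CT} : ∀ {l : W}, T.big = true → T.depth + 2 ≤ l.length →
    50 ≤ (look T l).1 := by
  induction T with
  | L v p => intro l h _; simpa [CT.big, look] using h
  | N a b iha ihb =>
    intro l h hl
    have h' : band a.big b.big = true := h
    rw [band_true] at h'
    simp only [CT.depth] at hl
    match l, hl with
    | x :: y :: z :: t, hl =>
    simp only [List.length_cons] at hl
    have := le_max_left a.depth b.depth
    have := le_max_right a.depth b.depth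
    unfold look
    split
    · exact iha h'.1 (by simp only [List.length_cons]; omega)
    · exact ihb h'.2 (by simp only [List.length_cons]; omega)
  | A a _ => intro l h; simp [CT.big] at h
  | B a _ => intro l h; simp [CT.big] at h

theorem posOff_look {bs : List Bool} : ∀ {T : CT} {l : W}, posOff bs T = true → ¬ codeB bs l →
    T.depth + 2 ≤ l.length → 50 ≤ (look T l).1 := by
  induction bs with
  | nil => intro T l _ h; simp [codeB] at h
  | cons b bs ih =>
    intro T l h hl hlen
    cases T with
    | L v p => simpa [look, posOff] using h
    | A a => simp [posOff] at h
    | B a => simp [posOff] at h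
    | N u v =>
      simp only [CT.depth] at hlen
      have := le_max_left u.depth v.depth
      have := le_max_right u.depth v.depth
      match l, hlen with
      | x :: y :: z :: t, hlen =>
      simp only [List.length_cons] at hlen
      have hu : u.depth + 2 ≤ (y :: z :: t).length := by simp only [List.length_cons]; omega
      have hv : v.depth + 2 ≤ (y :: z :: t).length := by simp only [List.length_cons]; omega
      simp only [codeB, not_and] at hl
      unfold look
      cases b with
      | true =>
        have h' : band (posOff bs u) v.big = true := h
        rw [band_true] at h'
        split
        · rename_i hx
          exact ih h'.1 (hl (by simpa using hx)) hu
        · exact big_look h'.2 hv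
      | false =>
        have h' : band (posOff bs v) u.big = true := h
        rw [band_true] at h'
        split
        · exact big_look h'.2 hu
        · rename_i hx
          exact ih h'.1 (hl (by simpa using hx)) hv

theorem ht_depth : htR.depth + 2 ≤ 50 := by decide +kernel

end TSF

namespace TSF
open Classical

/-! ### The certificates, semantically -/

noncomputable def vv (l : W) : ℕ := if short l then 0 else (look vtR l).1
def ph (l : W) : ℕ := (look vtR l).2
def hw (l : W) : ℕ := (look htR l).1
def headF (l : W) : Prop := codeB fCode l
def headH (l : W) : Prop := codeB hCode l

theorem short_map {l : W} (g : Equiv.Perm (Fin 3)) : short (l.map g) ↔ short l := by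
  unfold short
  simp only [headSq_iff, mu_map]

theorem vv_map {l : W} (g : Equiv.Perm (Fin 3)) : vv (l.map g) = vv l := by
  unfold vv; simp only [short_map, look_map]
theorem ph_map {l : W} (g : Equiv.Perm (Fin 3)) : ph (l.map g) = ph l := by
  unfold ph; simp only [look_map]
theorem hw_map {l : W} (g : Equiv.Perm (Fin 3)) : hw (l.map g) = hw l := by
  unfold hw; simp only [look_map]

theorem codeB_map {bs : List Bool} {l : W} (g : Equiv.Perm (Fin 3)) :
    codeB bs (l.map g) ↔ codeB bs l := by
  induction bs generalizing l with
  | nil => simp [codeB]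
  | cons b bs ih =>
    match l with
    | [] => simp [codeB]
    | [_] => simp [codeB]
    | [_, _] => simp [codeB]
    | x :: y :: z :: t =>
      have := ih (l := y :: z :: t)
      simp only [List.map_cons] at this
      simp [codeB, this]

theorem vv_le (l : W) : vv l ≤ 1000 := by
  have := all_look vt_all (by decide) l
  simp only [band_true, Nat.ble_eq] at this
  unfold vv; split <;> omega

theorem vv_ge (l : W) : vv l = 0 ∨ 207 ≤ vv l := by
  have := all_look vt_all (by decide) l
  simp only [band_true, bor_true, Nat.ble_eq, Nat.beq_eq] at this
  unfold vv; split <;> omega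

theorem ph_le (l : W) : ph l ≤ 104 := by
  have := all_look vt_all (by decide) l
  simp only [band_true, Nat.ble_eq] at this
  exact this.2.2

theorem hw_le (l : W) : hw l ≤ 2000 := by
  have := all_look ht_all (by decide) l
  unfold hw
  simpa using this

theorem vv_headF {l : W} (h : headF l) : vv l = 0 := by
  unfold vv; split
  · rfl
  · exact zeroOn_look vt_f h

theorem hw_headH {l : W} (h : headH l) : hw l = 0 := zeroOn_look ht_h h

theorem hw_pos {l : W} (h : ¬ headH l) (hl : 50 ≤ l.length) : 50 ≤ hw l :=
  posOff_look ht_pos h (le_trans ht_depth hl)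

theorem vv_short {l : W} (h : short l) : vv l = 0 := by simp [vv, h]

theorem low_le {c : Fin 3} {u t : W} (hu : 24 ≤ u.length) :
    low (pack (c :: u)) (4 ^ (c :: u).length) (look vtR (c :: (u ++ t))).1 mods ≤ vv (c :: (u ++ t)) := by
  generalize hv : (look vtR (c :: (u ++ t))).1 = v
  unfold low
  by_cases h0 : v = 0
  · simp [h0]
  · have : Nat.beq v 0 = false := by
      rw [← Bool.not_eq_true, Nat.beq_eq]; exact h0
    rw [this]
    by_cases hn : noS (pack (c :: u)) (4 ^ (c :: u).length) mods = true
    · have := noS_pack (t := t) (by simp; omega) hn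
      simp only [List.cons_append] at this
      rw [hn]
      unfold vv
      rw [if_neg this, hv]
    · rw [Bool.not_eq_true] at hn
      rw [hn]
      exact Nat.zero_le _

theorem anyS_not_sf {c : Fin 3} {u t : W} (h : anyS (pack (c :: u)) mods = true) :
    ¬ SquareFree (c :: (u ++ t)) := by
  rw [anyS_pack (by simp)] at h
  obtain ⟨P, _, hP⟩ := short_append (t := t) h
  exact fun hs => not_headSq hs P (by simpa using hP)

theorem cert_root {rest : W} (hs : SquareFree (1 :: 0 :: rest : W)) (hl : 48 ≤ rest.length) :
    12565 * vv (1 :: 0 :: rest) ≤ 10000 * (vv (0 :: 1 :: 0 :: rest) + vv (2 :: 1 :: 0 :: rest)) ∧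
    (SquareFree (0 :: 1 :: 0 :: rest : W) →
      10 * (11 + ph (1 :: 0 :: rest)) ≤ vv (2 :: 1 :: 0 :: rest) + 10 * ph (0 :: 1 :: 0 :: rest) ∧
      11 + ph (1 :: 0 :: rest) ≤ 50 + ph (0 :: 1 :: 0 :: rest)) ∧
    (SquareFree (2 :: 1 :: 0 :: rest : W) →
      10 * (11 + ph (1 :: 0 :: rest)) ≤ vv (0 :: 1 :: 0 :: rest) + 10 * ph (2 :: 1 :: 0 :: rest) ∧
      11 + ph (1 :: 0 :: rest) ≤ 50 + ph (2 :: 1 :: 0 :: rest)) := by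
  obtain ⟨u, t, e, _, h⟩ := dfs_sound leafOk 48 1 0 [] rest _ _ _ dfs_ok hs hl
  have s1 : look (vtR.step true) (1 :: 0 :: rest) = look vtR (0 :: 1 :: 0 :: rest) := by
    rw [look_step]; rfl
  have s2 : look (vtR.step false) (1 :: 0 :: rest) = look vtR (2 :: 1 :: 0 :: rest) := by
    rw [look_step]; rfl
  rw [s1, s2] at h
  have e' : (1 :: 0 :: rest : W) = u ++ t := by simpa using e
  unfold leafOk at h
  simp only [band_true, force_eq, bor_true, Nat.ble_eq] at h
  obtain ⟨h24, h1, h2, h3⟩ := h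
  have hu : 24 ≤ u.length := by
    have : (4 : ℕ) ^ 24 ≤ 4 ^ u.length := by norm_num; exact h24
    exact (Nat.pow_le_pow_iff_right (by norm_num)).1 this
  have p1 : Nat.add 1 (Nat.mul 4 (pack u)) = pack (0 :: u) := rfl
  have p2 : Nat.add 3 (Nat.mul 4 (pack u)) = pack (2 :: u) := rfl
  have p3 : ∀ c : Fin 3, Nat.mul 4 (4 ^ u.length) = 4 ^ (c :: u).length := by
    intro c; rw [List.length_cons, pow_succ, mul_comm]; rfl
  rw [e'] at h1 h2 h3 ⊢
  have l1 := low_le (c := 0) (t := t) hu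
  have l2 := low_le (c := 2) (t := t) hu
  rw [← p3 0] at l1
  rw [← p3 2] at l2
  rw [p1, p2] at h1 h2 h3
  have v0 : vv (u ++ t) ≤ (look vtR (u ++ t)).1 := by unfold vv; split <;> omega
  simp only [Nat.add_eq, Nat.mul_eq] at h1 h2 h3 l1 l2
  refine ⟨by omega, fun hs => ?_, fun hs => ?_⟩
  · rcases h2 with h2 | h2
    · unfold ph; omega
    · exact absurd hs (anyS_not_sf h2)
  · rcases h3 with h3 | h3
    · unfold ph; omega
    · exact absurd hs (anyS_not_sf h3)

theorem upw_eq {c : Fin 3} {u t : W} {v : ℕ} (hs : SquareFree (c :: (u ++ t))) :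
    upw (pack (c :: u)) v = v := by
  unfold upw
  by_cases h0 : v = 0
  · simp [h0]
  · have : Nat.beq v 0 = false := by
      rw [← Bool.not_eq_true, Nat.beq_eq]; exact h0
    rw [this]
    have h2 : anyS (pack (c :: u)) mods = false := by
      rw [← Bool.not_eq_true]; exact fun h => anyS_not_sf h hs
    rw [h2]

theorem hub_root {rest : W} (hs : SquareFree (1 :: 0 :: rest : W)) (hl : 48 ≤ rest.length)
    (hH : ¬ headH (1 :: 0 :: rest)) :
    10000 * ((if SquareFree (0 :: 1 :: 0 :: rest : W) then hw (0 :: 1 :: 0 :: rest) else 0) +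
      (if SquareFree (2 :: 1 :: 0 :: rest : W) then hw (2 :: 1 :: 0 :: rest) else 0))
      ≤ 12088 * hw (1 :: 0 :: rest) := by
  obtain ⟨u, t, e, _, h⟩ := dfs_sound hubOk 48 1 0 [] rest _ _ _ hub_ok hs hl
  have s1 : look (htR.step true) (1 :: 0 :: rest) = look htR (0 :: 1 :: 0 :: rest) := by
    rw [look_step]; rfl
  have s2 : look (htR.step false) (1 :: 0 :: rest) = look htR (2 :: 1 :: 0 :: rest) := by
    rw [look_step]; rfl
  rw [s1, s2] at h
  have e' : (1 :: 0 :: rest : W) = u ++ t := by simpa using e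
  unfold hubOk at h
  simp only [bor_true, Nat.ble_eq, Nat.beq_eq] at h
  have h0 := hw_pos hH (by simp; omega)
  have p1 : Nat.add 1 (Nat.mul 4 (pack u)) = pack (0 :: u) := rfl
  have p2 : Nat.add 3 (Nat.mul 4 (pack u)) = pack (2 :: u) := rfl
  rw [p1, p2] at h
  simp only [Nat.add_eq, Nat.mul_eq] at h
  rw [e'] at h h0 ⊢
  rcases h with h | h
  · unfold hw at h0; omega
  · have g1 : (if SquareFree (0 :: (u ++ t)) then hw (0 :: (u ++ t)) else 0) ≤
        upw (pack (0 :: u)) (look htR (0 :: (u ++ t))).1 := by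
      split
      · rename_i hh; rw [upw_eq hh]; rfl
      · exact Nat.zero_le _
    have g2 : (if SquareFree (2 :: (u ++ t)) then hw (2 :: (u ++ t)) else 0) ≤
        upw (pack (2 :: u)) (look htR (2 :: (u ++ t))).1 := by
      split
      · rename_i hh; rw [upw_eq hh]; rfl
      · exact Nat.zero_le _
    change _ ≤ 12088 * (look htR (u ++ t)).1
    omega

theorem sf_map_iff {l : W} (g : Equiv.Perm (Fin 3)) : SquareFree (l.map g) ↔ SquareFree l := by
  constructor
  · intro h
    have := sf_map g.symm.injective h
    simpa using this
  · exact sf_map g.injective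

theorem sf_ne {x y : Fin 3} {l : W} (h : SquareFree (x :: y :: l)) : x ≠ y := by
  rintro rfl
  have := h [] [x] l (by simp)
  simp at this

theorem exists_perm {x y c b : Fin 3} (h : x ≠ y) (hc : c ≠ x) (hb : b ≠ x) (hcb : c ≠ b) :
    ∃ g : Equiv.Perm (Fin 3), g x = 1 ∧ g y = 0 ∧ ((g c = 0 ∧ g b = 2) ∨ (g c = 2 ∧ g b = 0)) := by
  revert x y c b; decide

theorem cert {x c b : Fin 3} {l : W} (hs : SquareFree (x :: l)) (hl : 49 ≤ l.length)
    (hc : c ≠ x) (hb : b ≠ x) (hcb : c ≠ b) :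
    12565 * vv (x :: l) ≤ 10000 * (vv (c :: x :: l) + vv (b :: x :: l)) ∧
    (SquareFree (c :: x :: l) →
      10 * (11 + ph (x :: l)) ≤ vv (b :: x :: l) + 10 * ph (c :: x :: l) ∧
      11 + ph (x :: l) ≤ 50 + ph (c :: x :: l)) := by
  match l, hl with
  | y :: l, hl =>
  obtain ⟨g, gx, gy, gcb⟩ := exists_perm (sf_ne hs) hc hb hcb
  have hr := cert_root (rest := l.map g) (by
    have := (sf_map_iff g).2 hs
    simpa [gx, gy] using this) (by simpa using hl)
  rw [← vv_map (l := x :: y :: l) g, ← vv_map (l := c :: x :: y :: l) g,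
    ← vv_map (l := b :: x :: y :: l) g, ← ph_map (l := x :: y :: l) g,
    ← ph_map (l := c :: x :: y :: l) g, ← sf_map_iff (l := c :: x :: y :: l) g]
  simp only [List.map_cons, gx, gy]
  rcases gcb with ⟨h1, h2⟩ | ⟨h1, h2⟩
  · rw [h1, h2]; exact ⟨hr.1, hr.2.1⟩
  · rw [h1, h2]; exact ⟨by rw [add_comm]; exact hr.1, hr.2.2⟩

theorem hub {x : Fin 3} {l : W} (hs : SquareFree (x :: l)) (hl : 49 ≤ l.length)
    (hH : ¬ headH (x :: l)) :
    10000 * (∑ c : Fin 3, if SquareFree (c :: x :: l) then hw (c :: x :: l) else 0)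
      ≤ 12088 * hw (x :: l) := by
  obtain ⟨c, b, hc, hb, hcb⟩ : ∃ c b : Fin 3, c ≠ x ∧ b ≠ x ∧ c ≠ b := by
    clear * -; revert x; decide
  have hsum : ∀ q : Fin 3 → ℕ, ∑ i, q i = q x + q c + q b := by
    intro q
    have : (Finset.univ : Finset (Fin 3)) = {x, c, b} := by
      clear * - hc hb hcb; revert x c b; decide
    rw [this, Finset.sum_insert (by simp [hc.symm, hb.symm]), Finset.sum_insert (by simp [hcb]),
      Finset.sum_singleton]; ring
  rw [hsum, if_neg (fun h => sf_ne h rfl), zero_add]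
  match l, hl with
  | y :: l, hl =>
  obtain ⟨g, gx, gy, gcb⟩ := exists_perm (sf_ne hs) hc hb hcb
  have hr := hub_root (rest := l.map g) (by
    have := (sf_map_iff g).2 hs
    simpa [gx, gy] using this) (by simpa using hl) (by
    have := mt (codeB_map g).1 hH
    unfold headH
    simpa [gx, gy] using this)
  rw [← hw_map (l := x :: y :: l) g, ← hw_map (l := c :: x :: y :: l) g,
    ← hw_map (l := b :: x :: y :: l) g]
  simp only [← sf_map_iff (l := c :: x :: y :: l) g,  ← sf_map_iff (l := b :: x :: y :: l) g]
  simp only [List.map_cons, gx, gy]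
  rcases gcb with ⟨h1, h2⟩ | ⟨h1, h2⟩
  · rw [h1, h2]; exact hr
  · rw [h1, h2, add_comm]; exact hr

end TSF

namespace TSF
open Classical

/-! ### Period classes -/

def xk (k : ℕ) : ℕ := 2 ^ (k + 1) + 4 * k + 23

theorem xk_succ (k : ℕ) : xk (k + 1) + 4 * k + 19 = 2 * xk k := by
  unfold xk; rw [pow_succ]; ring

theorem xk_mono : StrictMono xk := by
  apply strictMono_nat_of_lt_succ
  intro k
  unfold xk
  have : 2 ^ (k + 1) ≤ 2 ^ (k + 1 + 1) := Nat.pow_le_pow_right (by norm_num) (by omega)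
  omega

noncomputable def cl (P : ℕ) : ℕ := Nat.findGreatest (fun k => xk k ≤ P) P

theorem xk_cl {P : ℕ} (h : 25 ≤ P) : xk (cl P) ≤ P :=
  Nat.findGreatest_spec (P := fun k => xk k ≤ P) (Nat.zero_le P) (by simpa [xk] using h)

theorem lt_xk_cl (P : ℕ) : P < xk (cl P + 1) := by
  by_contra h
  push Not at h
  have h1 : cl P + 1 ≤ P := le_trans (xk_mono.le_apply) h
  have := Nat.le_findGreatest (P := fun k => xk k ≤ P) h1 h
  change cl P + 1 ≤ cl P at this
  omega

theorem cl_inj_aux {l : W} (hs : SquareFree l) {P Q k : ℕ} (hP : 25 ≤ P) (hPQ : P < Q)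
    (kP : cl P = k) (kQ : cl Q = k) (hd : P ≤ mu P l + (20 + 4 * k)) :
    mu Q l + (20 + 4 * k) < Q := by
  have h1 := mu_min hs hPQ
  have h2 := xk_cl hP
  have h4 := lt_xk_cl Q
  rw [kQ] at h4
  rw [kP] at h2
  have h3 := xk_succ k
  rcases min_lt_iff.1 h1 with h | h <;> omega

/-! ### The potential -/

noncomputable def sg (k : ℕ) : ℝ := 0.0227 / 2 ^ k

theorem sg_pos (k : ℕ) : 0 < sg k := by unfold sg; positivity

noncomputable def tau (P d : ℕ) : ℝ := max 0 ((1 + sg (cl P)) * (1 / 1.21) ^ d - sg (cl P))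

theorem tau_nonneg (P d : ℕ) : 0 ≤ tau P d := le_max_left _ _

theorem tau_zero (P : ℕ) : tau P 0 = 1 := by simp [tau]

theorem tau_le (P d : ℕ) : tau P d ≤ (1 / 1.21) ^ d := by
  unfold tau
  have h1 : ((1 : ℝ) / 1.21) ^ d ≤ 1 := pow_le_one₀ (by norm_num) (by norm_num)
  have := sg_pos (cl P)
  apply max_le (by positivity)
  nlinarith

theorem gpow_ge (k : ℕ) : (45.2 : ℝ) * 2 ^ k ≤ 1.21 ^ (20 + 4 * k) := by
  rw [pow_add, pow_mul]
  have h1 : (45.2 : ℝ) ≤ 1.21 ^ 20 := by norm_num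
  have h2 : (2 : ℝ) ^ k ≤ (1.21 ^ 4) ^ k := pow_le_pow_left₀ (by norm_num) (by norm_num) k
  exact mul_le_mul h1 h2 (by positivity) (by positivity)

theorem tau_far {P d : ℕ} (h : 20 + 4 * cl P ≤ d) : tau P d = 0 := by
  unfold tau
  apply max_eq_left
  set k := cl P
  have h1 := gpow_ge k
  have h2 : (1.21 : ℝ) ^ (20 + 4 * k) ≤ 1.21 ^ d := pow_le_pow_right₀ (by norm_num) h
  have h3 : ((1 : ℝ) / 1.21) ^ d = 1 / 1.21 ^ d := by rw [div_pow, one_pow]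
  rw [h3, mul_one_div, sub_nonpos, div_le_iff₀ (by positivity)]
  have h4 : (1 : ℝ) ≤ 2 ^ k := one_le_pow₀ (by norm_num)
  have h5 : sg k * 2 ^ k = 0.0227 := by unfold sg; field_simp
  have h6 := sg_pos k
  have h7 : sg k * (45.2 * 2 ^ k) ≤ sg k * 1.21 ^ d := by gcongr; linarith
  have h8 : sg k ≤ 0.0227 := by nlinarith
  nlinarith

theorem tau_step (P d : ℕ) : tau P d ≤ 1.21 * tau P (d + 1) + sg (cl P) * 0.21 := by
  have h0 := tau_nonneg P (d + 1)
  have h1 := sg_pos (cl P)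
  conv_lhs => unfold tau
  apply max_le (by positivity)
  have h2 : (1 + sg (cl P)) * (1 / 1.21) ^ (d + 1) - sg (cl P) ≤ tau P (d + 1) := le_max_right _ _
  have h3 : ((1 : ℝ) / 1.21) ^ d = 1.21 * (1 / 1.21) ^ (d + 1) := by rw [pow_succ]; ring
  rw [h3]
  nlinarith

theorem tau_start {P : ℕ} (h : 25 ≤ P) : tau P P = 0 := by
  apply tau_far
  have := xk_cl h
  unfold xk at this
  have h2 : 0 < 2 ^ (cl P + 1) := by positivity
  omega

noncomputable def tsum' (l : W) : ℝ := ∑ P ∈ Finset.Icc 25 l.length, tau P (P - mu P l)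

noncomputable def VV (l : W) : ℝ := vv l / 1000 - tsum' l

theorem tsum'_nonneg (l : W) : 0 ≤ tsum' l := Finset.sum_nonneg fun _ _ => tau_nonneg _ _

theorem VV_le_one (l : W) : VV l ≤ 1 := by
  have h := tsum'_nonneg l
  have h2 : (vv l : ℝ) ≤ 1000 := by exact_mod_cast vv_le l
  unfold VV; linarith

theorem VV_pos {c : Fin 3} {l : W} (hs : SquareFree l) (h : 0 < VV (c :: l)) :
    SquareFree (c :: l) ∧ ¬ headF (c :: l) := by
  have h0 := tsum'_nonneg (c :: l)
  have h2 : (vv (c :: l) : ℝ) ≤ 1000 := by exact_mod_cast vv_le _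
  constructor
  · rw [sf_cons_iff]
    refine ⟨hs, fun P hP => ?_⟩
    by_cases hp : P ≤ 24
    · have : vv (c :: l) = 0 := vv_short ⟨P, hp, hP⟩
      unfold VV at h
      rw [this] at h
      norm_num at h
      linarith
    · have hmem : P ∈ Finset.Icc 25 (c :: l).length := by
        have := hP.2.1
        rw [Finset.mem_Icc]; omega
      have h3 : tau P (P - mu P (c :: l)) ≤ tsum' (c :: l) :=
        Finset.single_le_sum (f := fun P => tau P (P - mu P (c :: l)))
          (fun _ _ => tau_nonneg _ _) hmem
      have h4 : P - mu P (c :: l) = 0 := by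
        have := (headSq_iff.1 hP).2; omega
      rw [h4, tau_zero] at h3
      unfold VV at h
      linarith
  · intro hF
    have : vv (c :: l) = 0 := vv_headF hF
    unfold VV at h
    rw [this] at h
    norm_num at h
    linarith

theorem sum_sg {s : Finset ℕ} (hs : Set.InjOn cl s) : ∑ P ∈ s, sg (cl P) ≤ 0.0454 := by
  rw [← Finset.sum_image (f := sg) (g := cl) hs]
  have h1 : HasSum sg 0.0454 := by
    have := (hasSum_geometric_two).mul_left (0.0227 : ℝ)
    have e : sg = fun i : ℕ => (0.0227 : ℝ) * (1 / 2) ^ i := by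
      ext k; unfold sg; rw [div_pow, one_pow]; ring
    rw [e, show (0.0454 : ℝ) = 0.0227 * 2 by norm_num]
    exact this
  exact sum_le_hasSum _ (fun k _ => (sg_pos k).le) h1

theorem tsum'_step {l : W} (hs : SquareFree l) {c b : Fin 3} (hcb : c ≠ b) :
    tsum' (c :: l) + tsum' (b :: l) ≤ 1.21 * tsum' l + 0.21 * 0.0454 := by
  have ext : ∀ c : Fin 3, tsum' (c :: l) =
      ∑ P ∈ Finset.Icc 25 l.length, tau P (P - mu P (c :: l)) := by
    intro c
    unfold tsum'
    rw [List.length_cons]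
    symm
    apply Finset.sum_subset
    · apply Finset.Icc_subset_Icc_right; omega
    · intro P hP hP2
      rw [Finset.mem_Icc] at hP hP2
      have hPl : P = l.length + 1 := by omega
      rw [mu_cons (by omega), if_neg, Nat.sub_zero, tau_start hP.1]
      rw [List.getElem?_eq_none (by omega)]
      simp
  rw [ext, ext, ← Finset.sum_add_distrib]
  set S := (Finset.Icc 25 l.length).filter (fun P => P ≤ mu P l + (20 + 4 * cl P)) with hS
  have hinj : Set.InjOn cl S := by
    intro P hP Q hQ e
    simp only [hS, Finset.coe_filter, Finset.mem_Icc, Set.mem_ofPred_eq] at hP hQ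
    rcases lt_trichotomy P Q with h | h | h
    · have := cl_inj_aux hs hP.1.1 h rfl e.symm hP.2
      rw [← e] at hQ; omega
    · exact h
    · have := cl_inj_aux hs hQ.1.1 h rfl e hQ.2
      rw [e] at hP; omega
  have h1 := sum_sg hinj
  rw [hS, Finset.sum_filter] at h1
  have h2 : ∀ P ∈ Finset.Icc 25 l.length, tau P (P - mu P (c :: l)) + tau P (P - mu P (b :: l)) ≤
      1.21 * tau P (P - mu P l) + 0.21 * (if P ≤ mu P l + (20 + 4 * cl P) then sg (cl P) else 0) := by
    intro P hP
    rw [Finset.mem_Icc] at hP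
    have hm : mu P l < P := mu_lt hs (by omega)
    have key : ∀ c : Fin 3, l[P - 1]? = some c → tau P (P - mu P (c :: l)) ≤
        1.21 * tau P (P - mu P l) + 0.21 * (if P ≤ mu P l + (20 + 4 * cl P) then sg (cl P) else 0) := by
      intro c hc
      rw [mu_cons (by omega), if_pos hc]
      split
      · have := tau_step P (P - (mu P l + 1))
        rw [show P - (mu P l + 1) + 1 = P - mu P l by omega] at this
        linarith
      · rw [tau_far (by omega)]
        have := tau_nonneg P (P - mu P l)
        linarith
    have key2 : ∀ c : Fin 3, l[P - 1]? ≠ some c → tau P (P - mu P (c :: l)) = 0 := by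
      intro c hc
      rw [mu_cons (by omega), if_neg hc, Nat.sub_zero, tau_start hP.1]
    have pos : 0 ≤ 1.21 * tau P (P - mu P l) + 0.21 * (if P ≤ mu P l + (20 + 4 * cl P) then sg (cl P) else 0) := by
      have := tau_nonneg P (P - mu P l)
      have := sg_pos (cl P)
      split <;> linarith
    by_cases hc : l[P - 1]? = some c
    · rw [key2 b (by rw [hc]; simpa using hcb), add_zero]
      exact key c hc
    · rw [key2 c hc, zero_add]
      by_cases hb : l[P - 1]? = some b
      · exact key b hb
      · rw [key2 b hb]; exact pos
  refine le_trans (Finset.sum_le_sum h2) ?_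
  rw [Finset.sum_add_distrib, ← Finset.mul_sum, ← Finset.mul_sum]
  unfold tsum'
  linarith

theorem VV_step {x c b : Fin 3} {l : W} (hs : SquareFree (x :: l)) (hl : 49 ≤ l.length)
    (hc : c ≠ x) (hb : b ≠ x) (hcb : c ≠ b) :
    1.21 * max 0 (VV (x :: l)) ≤ max 0 (VV (c :: x :: l)) + max 0 (VV (b :: x :: l)) := by
  have h1 := (cert hs hl hc hb hcb).1
  have h2 := tsum'_step hs hcb
  rcases le_or_gt (VV (x :: l)) 0 with h | h
  · rw [max_eq_left h]
    have := le_max_left 0 (VV (c :: x :: l))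
    have := le_max_left 0 (VV (b :: x :: l))
    linarith
  · rw [max_eq_right h.le]
    have h3 : (12565 : ℝ) * vv (x :: l) ≤ 10000 * (vv (c :: x :: l) + vv (b :: x :: l)) := by
      exact_mod_cast h1
    have h4 : (207 : ℝ) ≤ vv (x :: l) := by
      rcases vv_ge (x :: l) with h0 | h0
      · unfold VV at h; rw [h0] at h
        have := tsum'_nonneg (x :: l)
        norm_num at h; linarith
      · exact_mod_cast h0
    have := le_max_right 0 (VV (c :: x :: l))
    have := le_max_right 0 (VV (b :: x :: l))
    unfold VV at *
    linarith

/-! ### Counting words -/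

noncomputable def wordsF : ℕ → Finset W
  | 0 => {[]}
  | n + 1 => ((Finset.univ : Finset (Fin 3)) ×ˢ wordsF n).image (fun p => p.1 :: p.2)

theorem mem_wordsF {n : ℕ} {x : W} : x ∈ wordsF n ↔ x.length = n := by
  induction n generalizing x with
  | zero => simp [wordsF]
  | succ n ih =>
    cases x with
    | nil => simp [wordsF]
    | cons c l => simp [wordsF, ih]

theorem sum_wordsF {β : Type*} [AddCommMonoid β] (n : ℕ) (g : W → β) :
    ∑ x ∈ wordsF (n + 1), g x = ∑ l ∈ wordsF n, ∑ c : Fin 3, g (c :: l) := by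
  rw [wordsF, Finset.sum_image, Finset.sum_product_right]
  intro p _ q _ h
  simp only [List.cons.injEq] at h
  exact Prod.ext h.1 h.2

theorem card_wordsF (n : ℕ) : (wordsF n).card = 3 ^ n := by
  induction n with
  | zero => simp [wordsF]
  | succ n ih =>
    rw [Finset.card_eq_sum_ones, sum_wordsF]
    simp [ih, pow_succ]

/-- `x` extends `U` by `k` letters, square-freely and without new `f`-markers. -/
def Ex (U : W) (k : ℕ) (x : W) : Prop :=
  x.drop k = U ∧ SquareFree x ∧ ∀ j < k, ¬ headF (x.drop j)

noncomputable def EE (U : W) (k : ℕ) : Finset W := (wordsF (k + U.length)).filter (Ex U k)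

theorem Ex_cons {U : W} {k : ℕ} {c : Fin 3} {l : W} : Ex U (k + 1) (c :: l) ↔
    Ex U k l ∧ SquareFree (c :: l) ∧ ¬ headF (c :: l) := by
  unfold Ex
  constructor
  · rintro ⟨h1, h2, h3⟩
    exact ⟨⟨h1, sf_tail h2, fun j hj => h3 (j + 1) (by omega)⟩, h2, h3 0 (by omega)⟩
  · rintro ⟨⟨h1, h2, h3⟩, h4, h5⟩
    refine ⟨h1, h4, fun j hj => ?_⟩
    cases j with
    | zero => exact h5
    | succ j => exact h3 j (by omega)

theorem growth_sum {U : W} (hl : 50 ≤ U.length) (hU : SquareFree U) (k : ℕ) :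
    1.21 ^ k * max 0 (VV U) ≤ ∑ x ∈ wordsF (k + U.length), if Ex U k x then max 0 (VV x) else 0 := by
  induction k with
  | zero =>
    simp only [pow_zero, one_mul, zero_add]
    have : (if Ex U 0 U then max 0 (VV U) else 0) ≤
        ∑ x ∈ wordsF U.length, if Ex U 0 x then max 0 (VV x) else 0 := by
      apply Finset.single_le_sum (f := fun x => if Ex U 0 x then max 0 (VV x) else 0)
      · intro x _; split
        · exact le_max_left _ _
        · exact le_rfl
      · exact mem_wordsF.2 rfl
    rwa [if_pos ⟨rfl, hU, by simp⟩] at this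
  | succ k ih =>
    rw [show k + 1 + U.length = (k + U.length) + 1 by omega, sum_wordsF]
    rw [pow_succ, mul_comm (1.21 ^ k), mul_assoc]
    refine le_trans (mul_le_mul_of_nonneg_left ih (by norm_num)) ?_
    rw [Finset.mul_sum]
    apply Finset.sum_le_sum
    intro l hlm
    rw [mem_wordsF] at hlm
    by_cases h : Ex U k l
    · rw [if_pos h]
      match l, hlm with
      | [], hlm => simp at hlm; omega
      | x :: l, hlm =>
      simp only [List.length_cons] at hlm
      obtain ⟨c, b, hc, hb, hcb⟩ : ∃ c b : Fin 3, c ≠ x ∧ b ≠ x ∧ c ≠ b := by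
        clear * -; revert x; decide
      refine le_trans (VV_step h.2.1 (by omega) hc hb hcb) ?_
      have key : ∀ c : Fin 3, max 0 (VV (c :: x :: l)) =
          if Ex U (k + 1) (c :: x :: l) then max 0 (VV (c :: x :: l)) else 0 := by
        intro c
        split
        · rfl
        · rename_i hn
          rw [Ex_cons] at hn
          apply max_eq_left
          by_contra hh
          push Not at hh
          exact hn ⟨h, VV_pos h.2.1 hh⟩
      rw [key c, key b, ← Finset.sum_pair (f := fun c => if Ex U (k + 1) (c :: x :: l) then max 0 (VV (c :: x :: l)) else 0) hcb]
      apply Finset.sum_le_sum_of_subset_of_nonneg (Finset.subset_univ _)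
      intro i _ _
      split
      · exact le_max_left _ _
      · exact le_rfl
    · rw [if_neg h, mul_zero]
      apply Finset.sum_nonneg
      intro i _
      split
      · exact le_max_left _ _
      · exact le_rfl

theorem growth {U : W} (hl : 50 ≤ U.length) (hU : SquareFree U) (k : ℕ) :
    1.21 ^ k * VV U ≤ (EE U k).card := by
  have h1 : (1.21 : ℝ) ^ k * VV U ≤ 1.21 ^ k * max 0 (VV U) := by
    gcongr; exact le_max_right _ _
  refine le_trans (le_trans h1 (growth_sum hl hU k)) ?_
  rw [← Finset.sum_filter, Finset.card_eq_sum_ones]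
  push_cast
  apply Finset.sum_le_sum
  intro x _
  exact max_le zero_le_one (VV_le_one x)

end TSF

namespace TSF
open Classical

/-! ### Exits from the tree of a long square-free word -/

structure Run (n : ℕ) (ls : ℕ → W) (cs bs : ℕ → Fin 3) : Prop where
  sf : ∀ t ≤ n, SquareFree (ls t)
  len : ∀ t ≤ n, (ls t).length = t
  succ : ∀ t < n, ls (t + 1) = cs t :: ls t
  ne : ∀ t < n, bs t ≠ cs t

variable {n : ℕ} {ls : ℕ → W} {cs bs : ℕ → Fin 3}

theorem Run.drop (R : Run n ls cs bs) {t g : ℕ} (h : t + g ≤ n) : (ls (t + g)).drop g = ls t := by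
  induction g with
  | zero => simp
  | succ g ih =>
    rw [← add_assoc, R.succ (t + g) (by omega), List.drop_succ_cons]
    exact ih (by omega)

def Ev (ls : ℕ → W) (bs : ℕ → Fin 3) (k t P : ℕ) : Prop :=
  25 ≤ P ∧ cl P = k ∧ P ≤ mu P (bs t :: ls t) + (19 + 4 * k)

theorem Ev.lt {k t P : ℕ} (h : Ev ls bs k t P) : xk k ≤ P ∧ P < xk (k + 1) := by
  obtain ⟨h1, h2, _⟩ := h
  have := xk_cl h1
  have := lt_xk_cl P
  rw [h2] at *
  omega

theorem xk_ge (k : ℕ) : 24 + 4 * k < xk k := by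
  unfold xk
  have : 0 < 2 ^ k := by positivity
  rw [pow_succ]
  omega

theorem Ev.match {k t P : ℕ} (h : Ev ls bs k t P) :
    (ls t)[P - 1]? = some (bs t) ∧ mu P (bs t :: ls t) = mu P (ls t) + 1 := by
  have h2 := h.lt
  obtain ⟨h1, -, h3⟩ := h
  have := xk_ge k
  rw [mu_cons (by omega)] at h3 ⊢
  split at h3
  · rename_i hh; rw [if_pos hh]; exact ⟨hh, rfl⟩
  · omega

theorem Ev.gap {k t g P Q : ℕ} (R : Run n ls cs bs) (hn : t + g ≤ n) (hg : 1 ≤ g)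
    (hP : Ev ls bs k t P) (hQ : Ev ls bs k (t + g) Q) :
    3 * xk k + 1 + Q ≤ xk (k + 1) + 2 * (Q - mu Q (bs (t + g) :: ls (t + g))) + 2 * g + P := by
  obtain ⟨mP, mP'⟩ := hP.match
  obtain ⟨mQ, mQ'⟩ := hQ.match
  have lP := hP.lt
  have lQ := hQ.lt
  have h2 := xk_succ k
  have h3 := xk_ge k
  obtain ⟨p1, p2, p3⟩ := hP
  obtain ⟨q1, q2, q3⟩ := hQ
  have hd := mu_drop Q g (ls (t + g))
  rw [R.drop hn] at hd
  have hs : SquareFree (ls t) := R.sf t (by omega)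
  have hlt : mu Q (ls (t + g)) < Q := mu_lt (R.sf _ hn) (by omega)
  rcases lt_trichotomy P Q with h | h | h
  · have := mu_min hs h
    rcases min_lt_iff.1 this with h' | h' <;> omega
  · subst h
    have hd2 := mu_drop P (g - 1) (ls (t + g))
    have : (ls (t + g)).drop (g - 1) = cs t :: ls t := by
      have := R.drop (t := t + 1) (g := g - 1) (by omega)
      rw [show t + 1 + (g - 1) = t + g by omega] at this
      rw [this, R.succ t (by omega)]
    rw [this, mu_cons (by omega), if_neg] at hd2
    · omega
    · rw [mP]
      intro e
      exact R.ne t (by omega) (Option.some.inj e)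
  · have := mu_min hs h
    rcases min_lt_iff.1 this with h' | h' <;> omega

noncomputable def kap (k : ℕ) : ℝ := 0.5 / (2 ^ (k + 1) + 8 * k + 37)

theorem kap_pos (k : ℕ) : 0 < kap k := by unfold kap; positivity

theorem two_pow_ge (k : ℕ) : (k : ℝ) + 1 ≤ 2 ^ k := by
  have : k < 2 ^ k := Nat.lt_two_pow_self
  exact_mod_cast this

theorem kap_bound {k d : ℕ} (h : d ≤ 19 + 4 * k) :
    min ((1 / 1.21 : ℝ) ^ d) 0.5 ≤ kap k * (2 ^ (k + 1) + 8 * k + 43 - 2 * d) := by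
  have h2 := two_pow_ge k
  have hk : (0 : ℝ) ≤ k := by positivity
  set E : ℝ := 2 ^ (k + 1) + 8 * k + 37 with hE
  have hE1 : 10 * (k : ℝ) + 39 ≤ E := by rw [hE, pow_succ]; linarith
  have e : kap k * (2 ^ (k + 1) + 8 * k + 43 - 2 * d) = 0.5 * (E + 6 - 2 * d) / E := by
    unfold kap; rw [← hE]; rw [show (2 : ℝ) ^ (k + 1) + 8 * k + 43 = E + 6 by rw [hE]; ring]; ring
  rw [e, le_div_iff₀ (by linarith)]
  by_cases h3 : d ≤ 3
  · have hd : (d : ℝ) ≤ 3 := by exact_mod_cast h3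
    have : min ((1 / 1.21 : ℝ) ^ d) 0.5 ≤ 0.5 := min_le_right _ _
    nlinarith
  · have hm : min ((1 / 1.21 : ℝ) ^ d) 0.5 * E ≤ (1 / 1.21 : ℝ) ^ d * E :=
      mul_le_mul_of_nonneg_right (min_le_left _ _) (by linarith)
    refine le_trans hm ?_
    by_cases h4 : d ≤ 19
    · have hE39 : 39 ≤ E := by linarith
      clear_value E
      clear * - h3 h4 hE39
      interval_cases d <;> norm_num <;> linarith
    · have h5 : ((1 : ℝ) / 1.21) ^ d ≤ (1 / 1.21) ^ 20 :=
        pow_le_pow_of_le_one (by norm_num) (by norm_num) (by omega)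
      have h6 : ((1 : ℝ) / 1.21) ^ 20 ≤ 0.0222 := by norm_num
      have hd : (d : ℝ) ≤ 19 + 4 * k := by exact_mod_cast h
      have h7 : ((1 : ℝ) / 1.21) ^ d * E ≤ 0.0222 * E :=
        mul_le_mul_of_nonneg_right (le_trans h5 h6) (by linarith)
      linarith

noncomputable def ck (ls : ℕ → W) (bs : ℕ → Fin 3) (k t : ℕ) : ℝ :=
  ∑ P ∈ (Finset.Icc 25 (t + 1)).filter (fun P => cl P = k),
    min (tau P (P - mu P (bs t :: ls t))) 0.5

theorem ck_cases (R : Run n ls cs bs) {k t : ℕ} (ht : t ≤ n) :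
    ck ls bs k t = 0 ∨ ∃ P, Ev ls bs k t P ∧
      ck ls bs k t ≤ min ((1 / 1.21 : ℝ) ^ (P - mu P (bs t :: ls t))) 0.5 := by
  by_cases h : ∃ P ∈ (Finset.Icc 25 (t + 1)).filter (fun P => cl P = k), Ev ls bs k t P
  · right
    obtain ⟨P, hP, hE⟩ := h
    refine ⟨P, hE, ?_⟩
    unfold ck
    rw [Finset.sum_eq_single_of_mem P hP]
    · exact min_le_min_right _ (tau_le _ _)
    · intro Q hQ hQP
      simp only [Finset.mem_filter, Finset.mem_Icc] at hQ
      have hn : ¬ Ev ls bs k t Q := by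
        intro hE2
        have a1 := hE.match.2
        have a2 := hE2.match.2
        obtain ⟨e1, e2, e3⟩ := hE
        obtain ⟨f1, f2, f3⟩ := hE2
        rcases lt_or_gt_of_ne hQP with h | h
        · have := cl_inj_aux (R.sf t ht) f1 h f2 e2 (by omega)
          omega
        · have := cl_inj_aux (R.sf t ht) e1 h e2 f2 (by omega)
          omega
      rw [tau_far, min_eq_left (by norm_num)]
      rw [hQ.2]
      by_contra hh
      exact hn ⟨hQ.1.1, hQ.2, by omega⟩
  · left
    push Not at h
    unfold ck
    apply Finset.sum_eq_zero
    intro P hP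
    have := h P hP
    simp only [Finset.mem_filter, Finset.mem_Icc] at hP
    rw [tau_far, min_eq_left (by norm_num)]
    rw [hP.2]
    by_contra hh
    exact this ⟨hP.1.1, hP.2, by omega⟩

theorem class_cost (R : Run n ls cs bs) (k s0 m : ℕ) (hm : s0 + m ≤ n) :
    ∑ j ∈ Finset.range m, ck ls bs k (s0 + j) = 0 ∨
    ∃ t P, s0 ≤ t ∧ t < s0 + m ∧ Ev ls bs k t P ∧
      ∑ j ∈ Finset.range m, ck ls bs k (s0 + j) ≤
        0.5 + kap k * (2 * ((t : ℝ) - s0) + (xk (k + 1) - P)) := by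
  induction m with
  | zero => left; simp
  | succ m ih =>
    rw [Finset.sum_range_succ]
    rcases ck_cases R (k := k) (t := s0 + m) (by omega) with h | ⟨Q, hQ, hc⟩
    · rw [h, add_zero]
      rcases ih (by omega) with h | ⟨t, P, h1, h2, h3, h4⟩
      · left; exact h
      · right; exact ⟨t, P, h1, by omega, h3, h4⟩
    · right
      refine ⟨s0 + m, Q, by omega, by omega, hQ, ?_⟩
      have lQ := hQ.lt
      have kp := kap_pos k
      rcases ih (by omega) with h | ⟨t, P, h1, h2, h3, h4⟩
      · rw [h, zero_add]
        refine le_trans (le_trans hc (min_le_right _ _)) ?_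
        have : (Q : ℝ) ≤ xk (k + 1) := by exact_mod_cast lQ.2.le
        push_cast
        have : 0 ≤ kap k * (2 * ((s0 : ℝ) + m - s0) + (xk (k + 1) - Q)) := by
          apply mul_nonneg kp.le
          have : (0 : ℝ) ≤ m := by positivity
          linarith
        linarith
      · obtain ⟨g, rfl⟩ : ∃ g, m = t - s0 + g := ⟨m - (t - s0), by omega⟩
        have e : s0 + (t - s0 + g) = t + g := by omega
        rw [e] at hQ hc ⊢
        have hgap := Ev.gap R (by omega) (by omega) h3 hQ
        have hb := kap_bound (k := k) (d := Q - mu Q (bs (t + g) :: ls (t + g))) (by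
          have := hQ.2.2; omega)
        have hx := xk_succ k
        have hx2 : xk k = 2 ^ (k + 1) + 4 * k + 23 := rfl
        set d := Q - mu Q (bs (t + g) :: ls (t + g))
        have hge : (2 : ℝ) ^ (k + 1) + 8 * k + 43 - 2 * d ≤ 2 * g + P - Q := by
          have : 2 ^ (k + 1) + 8 * k + 43 + Q ≤ 2 * d + 2 * g + P := by omega
          have : (2 : ℝ) ^ (k + 1) + 8 * k + 43 + Q ≤ 2 * d + 2 * g + P := by exact_mod_cast this
          linarith
        have h6 := mul_le_mul_of_nonneg_left hge kp.le
        push_cast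
        nlinarith

theorem class_cost' (R : Run n ls cs bs) (k s0 m : ℕ) (hm : s0 + m ≤ n) :
    ∑ j ∈ Finset.range m, ck ls bs k (s0 + j) ≤ 1 + 2 * kap k * m := by
  have kp := kap_pos k
  rcases class_cost R k s0 m hm with h | ⟨t, P, h1, h2, h3, h4⟩
  · rw [h]; positivity
  · refine le_trans h4 ?_
    have lP := h3.lt
    have h5 : (t : ℝ) - s0 ≤ m := by
      have : (t : ℝ) ≤ s0 + m := by exact_mod_cast h2.le
      linarith
    have h6 : (xk (k + 1) : ℝ) - P ≤ 2 ^ (k + 1) + 4 := by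
      have : xk (k + 1) ≤ P + 2 ^ (k + 1) + 4 := by
        have : xk (k + 1) = 2 ^ (k + 1 + 1) + 4 * (k + 1) + 23 := rfl
        have : xk k = 2 ^ (k + 1) + 4 * k + 23 := rfl
        have : 2 ^ (k + 1 + 1) = 2 * 2 ^ (k + 1) := by ring
        omega
      have : (xk (k + 1) : ℝ) ≤ P + 2 ^ (k + 1) + 4 := by exact_mod_cast this
      linarith
    have h7 : kap k * (2 ^ (k + 1) + 4) ≤ 0.5 := by
      unfold kap
      rw [div_mul_eq_mul_div, div_le_iff₀ (by positivity)]
      have : (0 : ℝ) ≤ k := by positivity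
      linarith
    nlinarith

theorem kap_sum (K : ℕ) : ∑ k ∈ Finset.range K, 2 * kap k ≤ 0.104 := by
  have h1 : ∀ j : ℕ, ∑ k ∈ Finset.range (11 + j), 2 * kap k ≤
      ∑ k ∈ Finset.range 11, 2 * kap k + 1 / 2 ^ 11 * (1 - 1 / 2 ^ j) := by
    intro j
    induction j with
    | zero => simp
    | succ j ih =>
      rw [← add_assoc, Finset.sum_range_succ]
      have : 2 * kap (11 + j) ≤ 1 / 2 ^ 11 * (1 / 2 ^ (j + 1)) := by
        unfold kap
        rw [← mul_div_assoc, one_div_mul_one_div, div_le_div_iff₀ (by positivity) (by positivity)]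
        rw [show 11 + j + 1 = 11 + (j + 1) by ring, pow_add 2 11 (j + 1)]
        push_cast
        have : (0 : ℝ) ≤ j := by positivity
        linarith
      have e : (1 : ℝ) / 2 ^ j = 2 * (1 / 2 ^ (j + 1)) := by rw [pow_succ]; field_simp
      rw [e] at ih
      linarith
  have h2 : ∑ k ∈ Finset.range K, 2 * kap k ≤ ∑ k ∈ Finset.range (11 + K), 2 * kap k := by
    apply Finset.sum_le_sum_of_subset_of_nonneg
    · intro i; simp; omega
    · intro i _ _; have := kap_pos i; linarith
  refine le_trans h2 (le_trans (h1 K) ?_)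
  have h3 : (1 : ℝ) / 2 ^ 11 * (1 - 1 / 2 ^ K) ≤ 1 / 2 ^ 11 := by
    have : (0 : ℝ) ≤ 1 / 2 ^ K := by positivity
    nlinarith
  have h4 : ∑ k ∈ Finset.range 11, 2 * kap k ≤ 0.1034 := by
    simp only [Finset.sum_range_succ, Finset.sum_range_zero, kap]
    norm_num
  have h5 : (1 : ℝ) / 2 ^ 11 ≤ 0.0005 := by norm_num
  linarith

theorem cl_lt {P n : ℕ} (h : 25 ≤ P) (hP : P ≤ n) : cl P < Nat.log 2 n := by
  have h1 := xk_cl h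
  have h2 : 2 ^ (cl P + 1) ≤ n := by unfold xk at h1; omega
  exact Nat.le_log_of_pow_le (by norm_num) h2

theorem min_add_le' (a b t : ℝ) (ha : 0 ≤ a) (hb : 0 ≤ b) (ht : 0 ≤ t) : min (a + b) t ≤ min a t + min b t := by
  rcases le_total a t with h1 | h1 <;> rcases le_total b t with h2 | h2 <;>
    simp only [min_eq_left, min_eq_right, h1, h2]
  · exact min_le_left _ _
  · exact le_trans (min_le_right _ _) (by linarith)
  · exact le_trans (min_le_right _ _) (by linarith)
  · exact le_trans (min_le_right _ _) (by linarith)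

theorem min_sum_le {ι : Type*} (s : Finset ι) (f : ι → ℝ) (t : ℝ) (ht : 0 ≤ t)
    (hf : ∀ i ∈ s, 0 ≤ f i) : min (∑ i ∈ s, f i) t ≤ ∑ i ∈ s, min (f i) t := by
  induction s using Finset.induction_on with
  | empty => simp [ht]
  | insert a s ha ih =>
    rw [Finset.sum_insert ha, Finset.sum_insert ha]
    have h1 := hf a (Finset.mem_insert_self _ _)
    have h2 := ih (fun i hi => hf i (Finset.mem_insert_of_mem hi))
    have h3 : 0 ≤ ∑ i ∈ s, f i := Finset.sum_nonneg fun i hi => hf i (Finset.mem_insert_of_mem hi)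
    have := min_add_le' _ _ t h1 h3 ht
    linarith

theorem exit_run (R : Run n ls cs bs) (hb : ∀ t < n, ∀ x ∈ (ls t).head?, bs t ≠ x)
    {s0 m : ℕ} (h50 : 50 ≤ s0) (hn : s0 + m = n)
    (hbig : 1.04 + Nat.log 2 n < 0.001 * (m : ℝ)) :
    ∃ t, s0 ≤ t ∧ t < n ∧ 0.005 ≤ VV (bs t :: ls t) := by
  by_contra hcon
  push Not at hcon
  -- profit
  have profit : ∀ j ≤ m, 0.11 * (j : ℝ) ≤
      ∑ i ∈ Finset.range j, min ((vv (bs (s0 + i) :: ls (s0 + i)) : ℝ) / 1000) 0.5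
        + (ph (ls (s0 + j)) : ℝ) / 100 := by
    intro j hj
    induction j with
    | zero => simp; positivity
    | succ j ih =>
      rw [Finset.sum_range_succ]
      have h := ih (by omega)
      have hlt : s0 + j < n := by omega
      have hlen := R.len (s0 + j) hlt.le
      have hsf := R.sf (s0 + j) hlt.le
      have hsf2 := R.sf (s0 + j + 1) hlt
      rw [R.succ _ hlt] at hsf2
      have hb' := hb _ hlt
      rw [← add_assoc, R.succ _ hlt]
      have hne := R.ne _ hlt
      generalize ls (s0 + j) = l at *
      match l, hlen with
      | [], hlen => simp at hlen; omega
      | x :: l, hlen =>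
      have hc : cs (s0 + j) ≠ x := sf_ne hsf2
      have hb2 : bs (s0 + j) ≠ x := hb' x (by simp)
      obtain ⟨c1, c2⟩ := (cert hsf (by simp at hlen; omega) hc hb2 hne.symm).2 hsf2
      have c1' : (10 : ℝ) * (11 + ph (x :: l)) ≤ vv (bs (s0 + j) :: x :: l) +
        10 * ph (cs (s0 + j) :: x :: l) := by exact_mod_cast c1
      have c2' : (11 : ℝ) + ph (x :: l) ≤ 50 + ph (cs (s0 + j) :: x :: l) := by exact_mod_cast c2
      have : (0.11 : ℝ) + ph (x :: l) / 100 - ph (cs (s0 + j) :: x :: l) / 100 ≤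
          min ((vv (bs (s0 + j) :: x :: l) : ℝ) / 1000) 0.5 := by
        apply le_min <;> linarith
      push_cast
      linarith
  have h1 := profit m le_rfl
  have h2 : (ph (ls (s0 + m)) : ℝ) ≤ 104 := by exact_mod_cast ph_le _
  -- cost
  have cost : ∀ i ∈ Finset.range m, min ((vv (bs (s0 + i) :: ls (s0 + i)) : ℝ) / 1000) 0.5 ≤
      0.005 + ∑ k ∈ Finset.range (Nat.log 2 n), ck ls bs k (s0 + i) := by
    intro i hi
    rw [Finset.mem_range] at hi
    have h := hcon (s0 + i) (by omega) (by omega)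
    set y := bs (s0 + i) :: ls (s0 + i) with hy
    have hylen : y.length = s0 + i + 1 := by rw [hy, List.length_cons, R.len _ (by omega)]
    have ht := tsum'_nonneg y
    have e1 : min ((vv y : ℝ) / 1000) 0.5 ≤ 0.005 + min (tsum' y) 0.5 := by
      have : (vv y : ℝ) / 1000 ≤ 0.005 + tsum' y := by unfold VV at h; linarith
      refine le_trans (min_le_min_right _ this) (le_trans (min_add_le' _ _ _ (by norm_num) ht (by norm_num)) ?_)
      have := min_le_left (0.005 : ℝ) 0.5
      linarith
    refine le_trans e1 ?_
    gcongr
    unfold tsum'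
    refine le_trans (min_sum_le _ _ _ (by norm_num) (fun P _ => tau_nonneg _ _)) ?_
    rw [hylen]
    unfold ck
    rw [Finset.sum_fiberwise_of_maps_to]
    intro P hP
    rw [Finset.mem_Icc] at hP
    rw [Finset.mem_range]
    exact cl_lt hP.1 (by omega)
  have h3 := Finset.sum_le_sum cost
  rw [Finset.sum_add_distrib, Finset.sum_comm] at h3
  have h4 : ∑ k ∈ Finset.range (Nat.log 2 n), ∑ i ∈ Finset.range m, ck ls bs k (s0 + i) ≤
      ∑ k ∈ Finset.range (Nat.log 2 n), (1 + 2 * kap k * m) :=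
    Finset.sum_le_sum fun k _ => class_cost' R k s0 m hn.le
  rw [Finset.sum_add_distrib, ← Finset.sum_mul] at h4
  have h5 := kap_sum (Nat.log 2 n)
  simp only [Finset.sum_const, Finset.card_range, nsmul_eq_mul, mul_one] at h3 h4
  have h6 : (∑ k ∈ Finset.range (Nat.log 2 n), 2 * kap k) * m ≤ 0.104 * m := by gcongr
  linarith

/-- Exit lemma: a long square-free word has a long beginning (here: suffix of the reversed word)
from which the potential is bounded below. -/
theorem exit_lemma {L : W} (hL : SquareFree L) {s0 m : ℕ} (h50 : 50 ≤ s0) (hn : s0 + m = L.length)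
    (hbig : 1.04 + Nat.log 2 L.length < 0.001 * (m : ℝ)) :
    ∃ g b, 1 ≤ g ∧ g ≤ m ∧ SquareFree (b :: L.drop g) ∧ 0.005 ≤ VV (b :: L.drop g) := by
  set n := L.length with hnn
  let ls : ℕ → W := fun t => L.drop (n - t)
  let cs : ℕ → Fin 3 := fun t => (L[n - t - 1]?).getD 0
  have hex : ∀ t, ∃ b : Fin 3, b ≠ cs t ∧ b ≠ ((ls t).head?).getD 0 := by
    intro t
    generalize cs t = a
    generalize ((ls t).head?).getD 0 = c
    revert a c; decide
  choose bs hbs1 hbs2 using hex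
  have R : Run n ls cs bs := by
    refine ⟨fun t _ => sf_drop hL _, fun t ht => ?_, fun t ht => ?_, fun t _ => hbs1 t⟩
    · simp only [ls, List.length_drop]; omega
    · simp only [ls, cs]
      rw [show n - (t + 1) = n - t - 1 by omega, List.drop_eq_getElem_cons (by omega),
        show n - t - 1 + 1 = n - t by omega, List.getElem?_eq_getElem (by omega)]
      rfl
  obtain ⟨t, h1, h2, h3⟩ := exit_run R (fun t _ x hx => by
    have := hbs2 t
    rw [Option.mem_def] at hx
    rw [hx] at this
    simpa using this) h50 hn hbig
  refine ⟨n - t, bs t, by omega, by omega, ?_, h3⟩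
  exact (VV_pos (sf_drop hL _) (lt_of_lt_of_le (by norm_num) h3)).1

end TSF

namespace TSF
open Classical

/-! ### Hub counting -/

noncomputable def HE (U : W) (k : ℕ) : Finset W := (EE U k).filter headH

theorem sum_EE {β : Type*} [AddCommMonoid β] (U : W) (k : ℕ) (g : W → β) :
    ∑ x ∈ EE U (k + 1), g x = ∑ l ∈ EE U k, ∑ c : Fin 3,
      if SquareFree (c :: l) ∧ ¬ headF (c :: l) then g (c :: l) else 0 := by
  unfold EE
  rw [Finset.sum_filter, Finset.sum_filter, show k + 1 + U.length = (k + U.length) + 1 by omega,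
    sum_wordsF]
  apply Finset.sum_congr rfl
  intro l _
  by_cases h : Ex U k l
  · rw [if_pos h]
    apply Finset.sum_congr rfl
    intro c _
    simp only [Ex_cons, h, true_and]
  · rw [if_neg h]
    apply Finset.sum_eq_zero
    intro c _
    rw [if_neg]
    rw [Ex_cons]; tauto

theorem mem_EE {U : W} {k : ℕ} {x : W} : x ∈ EE U k ↔ x.length = k + U.length ∧ Ex U k x := by
  unfold EE; rw [Finset.mem_filter, mem_wordsF]

theorem EE_zero {U : W} : (EE U 0).card ≤ 1 := by
  apply Finset.card_le_one.2
  intro a ha b hb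
  have h1 := (mem_EE.1 ha).2.1
  have h2 := (mem_EE.1 hb).2.1
  simp at h1 h2
  rw [h1, h2]

theorem EE_card_le (U : W) (k : ℕ) : (EE U k).card ≤ 3 ^ k := by
  induction k with
  | zero => simpa using EE_zero
  | succ k ih =>
    rw [Finset.card_eq_sum_ones, sum_EE]
    calc _ ≤ ∑ l ∈ EE U k, 3 := by
          apply Finset.sum_le_sum
          intro l _
          calc _ ≤ ∑ c : Fin 3, 1 := Finset.sum_le_sum (fun c _ => by split <;> omega)
            _ = 3 := by simp
      _ ≤ _ := by rw [Finset.sum_const, smul_eq_mul, pow_succ]; gcongr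

noncomputable def Phi (U : W) (k : ℕ) : ℕ := ∑ x ∈ EE U k, hw x

theorem Phi_step {U : W} (hU : 50 ≤ U.length) (k : ℕ) :
    10000 * Phi U (k + 1) ≤ 12088 * Phi U k + 60000000 * (HE U k).card := by
  unfold Phi HE
  rw [sum_EE, Finset.card_filter, Finset.mul_sum, Finset.mul_sum, Finset.mul_sum,
    ← Finset.sum_add_distrib]
  apply Finset.sum_le_sum
  intro l hl
  rw [mem_EE] at hl
  have h1 : (∑ c : Fin 3, if SquareFree (c :: l) ∧ ¬ headF (c :: l) then hw (c :: l) else 0) ≤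
      ∑ c : Fin 3, if SquareFree (c :: l) then hw (c :: l) else 0 := by
    apply Finset.sum_le_sum
    intro c _
    by_cases h1 : SquareFree (c :: l) <;> by_cases h2 : headF (c :: l) <;> simp [h1, h2]
  by_cases hH : headH l
  · rw [if_pos hH]
    have h2 : (∑ c : Fin 3, if SquareFree (c :: l) then hw (c :: l) else 0) ≤ ∑ c : Fin 3, 2000 := by
      apply Finset.sum_le_sum
      intro c _
      have := hw_le (c :: l)
      split <;> omega
    simp only [Finset.sum_const, Finset.card_univ, Fintype.card_fin, smul_eq_mul] at h2
    omega
  · rw [if_neg hH]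
    match l, hl with
    | [], hl => simp at hl; omega
    | x :: l, hl =>
    have := hub hl.2.2.1 (by have := hl.1; simp at this; omega) hH
    omega

theorem EE_le_Phi {U : W} (hU : 50 ≤ U.length) (k : ℕ) :
    50 * (EE U k).card ≤ 50 * (HE U k).card + Phi U k := by
  unfold Phi HE
  rw [Finset.card_filter, Finset.card_eq_sum_ones, Finset.mul_sum, Finset.mul_sum,
    ← Finset.sum_add_distrib]
  apply Finset.sum_le_sum
  intro l hl
  rw [mem_EE] at hl
  by_cases hH : headH l
  · simp [hH]
  · have := hw_pos hH (by omega)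
    simp [hH]; omega

theorem hub_lemma {U : W} (hU : 50 ≤ U.length) (hs : SquareFree U) (hV : 0.005 ≤ VV U)
    {m : ℕ} {R : ℝ} (hR : 1 ≤ R) (hm : 200041 * 1.2094 ^ m * R ≤ 0.005 * 1.21 ^ m) :
    ∃ k0 ≤ m, R ≤ 3 ^ k0 ∧ 1 ≤ (HE U k0).card ∧
      ∀ k ≤ k0, ((EE U k).card : ℝ) * 1.2094 ^ (k0 - k) ≤ 200041 * (HE U k0).card := by
  obtain ⟨k0, hk0, hmax⟩ := Finset.exists_max_image (Finset.range (m + 1))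
    (fun k => ((HE U k).card : ℝ) / 1.2094 ^ k) ⟨0, by simp⟩
  rw [Finset.mem_range] at hk0
  set B : ℝ := ((HE U k0).card : ℝ) / 1.2094 ^ k0 with hB
  have hB0 : 0 ≤ B := by positivity
  have he : ∀ k ≤ m, ((HE U k).card : ℝ) ≤ B * 1.2094 ^ k := by
    intro k hk
    have := hmax k (Finset.mem_range.2 (by omega))
    rwa [div_le_iff₀ (by positivity)] at this
  have hPhi : ∀ k ≤ m, (Phi U k : ℝ) ≤ (2000 + 10000000 * B) * 1.2094 ^ k := by
    intro k hk
    induction k with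
    | zero =>
      have : Phi U 0 ≤ 2000 := by
        unfold Phi
        calc _ ≤ ∑ x ∈ EE U 0, 2000 := Finset.sum_le_sum fun x _ => hw_le x
          _ ≤ _ := by
            rw [Finset.sum_const, smul_eq_mul]
            have := EE_zero (U := U)
            omega
      have : (Phi U 0 : ℝ) ≤ 2000 := by exact_mod_cast this
      simp; linarith
    | succ k ih =>
      have h1 := ih (by omega)
      have h2 := he k (by omega)
      have h3 : (10000 : ℝ) * Phi U (k + 1) ≤ 12088 * Phi U k + 60000000 * (HE U k).card := by
        exact_mod_cast Phi_step hU k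
      rw [pow_succ]
      have h4 : (0 : ℝ) < 1.2094 ^ k := by positivity
      nlinarith
  have ha : ∀ k ≤ m, ((EE U k).card : ℝ) ≤ (40 + 200001 * B) * 1.2094 ^ k := by
    intro k hk
    have h1 : (50 : ℝ) * (EE U k).card ≤ 50 * (HE U k).card + Phi U k := by
      exact_mod_cast EE_le_Phi hU k
    have h2 := he k hk
    have h3 := hPhi k hk
    nlinarith
  have hBR : R ≤ B := by
    have h1 := growth hU hs m
    have h2 := ha m le_rfl
    have h3 : (0.005 : ℝ) * 1.21 ^ m ≤ 1.21 ^ m * VV U := by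
      rw [mul_comm]; gcongr
    have h4 : 200041 * R * (1.2094 : ℝ) ^ m ≤ (40 + 200001 * B) * 1.2094 ^ m := by linarith
    have h5 := le_of_mul_le_mul_right h4 (by positivity)
    linarith
  have hk3 : B ≤ (HE U k0).card := by
    rw [hB]
    apply div_le_self (by positivity)
    exact one_le_pow₀ (by norm_num)
  refine ⟨k0, by omega, ?_, ?_, ?_⟩
  · have h1 : ((HE U k0).card : ℝ) ≤ 3 ^ k0 := by
      have : (HE U k0).card ≤ 3 ^ k0 := le_trans (Finset.card_filter_le _ _) (EE_card_le U k0)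
      exact_mod_cast this
    linarith
  · have : (1 : ℝ) ≤ (HE U k0).card := by linarith
    exact_mod_cast this
  · intro k hk
    have h1 := ha k (by omega)
    have h2 : (40 + 200001 * B) ≤ 200041 * B := by linarith
    calc ((EE U k).card : ℝ) * 1.2094 ^ (k0 - k)
        ≤ (200041 * B * 1.2094 ^ k) * 1.2094 ^ (k0 - k) := by
          gcongr
          refine le_trans h1 ?_
          gcongr
      _ = 200041 * (B * 1.2094 ^ k0) := by
          rw [mul_assoc, ← pow_add, show k + (k0 - k) = k0 by omega]; ring
      _ = _ := by rw [hB]; field_simp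

end TSF

namespace TSF

/-! ### Junction words: finite checks -/

def hr : W := [1, 2, 0, 1, 0, 2, 1, 0]

def aTab (g : Fin 3 → Fin 3) : W :=
  if g 0 = 2 ∧ g 1 = 1 then [0, 1, 2, 0, 2, 1, 0, 2, 0, 1, 2, 0] else [0, 1, 2, 1, 0, 2, 1, 2, 0, 1, 2]

def bTab (g : Fin 3 → Fin 3) : W :=
  if g 0 = 0 then (if g 1 = 1 then [1, 0, 1, 2, 0, 2, 1, 0, 2, 0, 1] else [1, 0, 1, 2, 0, 2])
  else if g 0 = 1 then (if g 1 = 0 then [1, 0] else [1, 0, 1, 2])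
  else (if g 1 = 0 then [1, 0, 2, 0] else [2, 1, 2, 0, 1, 0])

def mTab (g : Fin 3 → Fin 3) : W := aTab g ++ bTab g ++ ((aTab g).map g).reverse

def perms6 : List (Fin 3 → Fin 3) :=
  [![0, 1, 2], ![0, 2, 1], ![1, 0, 2], ![1, 2, 0], ![2, 0, 1], ![2, 1, 0]]

theorem perm_mem : ∀ g : Equiv.Perm (Fin 3), ⇑g ∈ perms6 := by decide

/-- boolean square-freeness test through packed heads -/
noncomputable def sfB : W → Bool
  | [] => true
  | x :: l => band (! anyS (pack (x :: l)) mods) (sfB l)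

/-- the packed `f`-markers -/
noncomputable def isF (w : ℕ) : Bool :=
  List.rec (motive := fun _ => Bool) false
    (fun m _ ih => bor (Nat.beq (Nat.mod w 262144) m) ih)
    (perms6.map fun g => pack ([0, 1, 2, 0, 1, 0, 2, 1, 0].map g))

/-- depth first search over the left contexts of a junction -/
noncomputable def jd (n : ℕ) : ℕ → ℕ → Bool → Bool :=
  Nat.rec (motive := fun _ => ℕ → ℕ → Bool → Bool) (fun _ _ bad => Bool.rec true false bad)
    (fun n ih w wm bad =>
      let ext (d : ℕ) : Bool :=
        force (Nat.add d (Nat.mul 4 w)) fun w' =>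
          bor (anyS w' mods) (bor (isF w')
            (force (Nat.add d (Nat.mul 4 wm)) fun wm' =>
              Bool.rec (ih w' wm' false) (ih w' wm' true)
                (bor bad (band (anyS wm' mods) (Nat.ble 7 n)))))
      band (ext 1) (band (ext 2) (ext 3))) n

structure Good (hX M hZ : W) : Prop where
  sf : SquareFree (hX.reverse ++ M ++ hZ)
  marks : ∃ p2 p3 p4, 9 ≤ p2 ∧ p2 ≤ 11 ∧ p2 + 9 ≤ p3 ∧ p3 + 9 ≤ p4 ∧ p2 + 8 ≤ M.length ∧
    (∀ i, codeB fCode ((hX.reverse ++ M ++ hZ).drop i) → i = 0 ∨ i = p2 ∨ i = p3 ∨ i = p4) ∧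
    codeB fCode ((hX.reverse ++ M ++ hZ).drop 0) ∧
    codeB fCode ((hX.reverse ++ M ++ hZ).drop p2) ∧
    codeB fCode ((hX.reverse ++ M ++ hZ).drop p3) ∧
    codeB fCode ((hX.reverse ++ M ++ hZ).drop p4) ∧
    ((hX.reverse ++ M ++ hZ).drop 0).take 9 ≠ ((hX.reverse ++ M ++ hZ).drop p2).take 9 ∧
    ((hX.reverse ++ M ++ hZ).drop 0).take 9 ≠ ((hX.reverse ++ M ++ hZ).drop p3).take 9 ∧
    jd 24 (pack hX.reverse) (pack (hX.reverse ++ M.take p2)) false = true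

/-- decidable form of the marker conditions -/
def marksB (hX M hZ : W) (p2 p3 p4 : ℕ) : Prop :=
  9 ≤ p2 ∧ p2 ≤ 11 ∧ p2 + 9 ≤ p3 ∧ p3 + 9 ≤ p4 ∧ p2 + 8 ≤ M.length ∧
    (∀ i < 50, codeB fCode ((hX.reverse ++ M ++ hZ).drop i) → i = 0 ∨ i = p2 ∨ i = p3 ∨ i = p4) ∧
    (hX.reverse ++ M ++ hZ).length ≤ 50 ∧
    codeB fCode ((hX.reverse ++ M ++ hZ).drop 0) ∧
    codeB fCode ((hX.reverse ++ M ++ hZ).drop p2) ∧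
    codeB fCode ((hX.reverse ++ M ++ hZ).drop p3) ∧
    codeB fCode ((hX.reverse ++ M ++ hZ).drop p4) ∧
    ((hX.reverse ++ M ++ hZ).drop 0).take 9 ≠ ((hX.reverse ++ M ++ hZ).drop p2).take 9 ∧
    ((hX.reverse ++ M ++ hZ).drop 0).take 9 ≠ ((hX.reverse ++ M ++ hZ).drop p3).take 9

instance (hX M hZ : W) (p2 p3 p4 : ℕ) : Decidable (marksB hX M hZ p2 p3 p4) := by
  unfold marksB; infer_instance

def pp2 (g : Fin 3 → Fin 3) : ℕ := (aTab g).length - 1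
def pp4 (g : Fin 3 → Fin 3) : ℕ := (mTab g).length + 7

theorem marks_ok : ∀ g ∈ perms6,
    marksB hr (mTab g) (hr.map g) (pp2 g) (pp4 g - pp2 g) (pp4 g) ∧
    marksB (hr.map g) (mTab g).reverse hr (pp2 g) (pp4 g - pp2 g) (pp4 g) := by
  decide +kernel

theorem sfB_ok : ∀ g ∈ perms6, sfB (hr.reverse ++ mTab g ++ hr.map g) = true := by
  decide +kernel

theorem jd_ok : ∀ g ∈ perms6,
    jd 24 (pack hr.reverse) (pack (hr.reverse ++ (mTab g).take (pp2 g))) false = true ∧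
    jd 24 (pack (hr.map g).reverse)
      (pack ((hr.map g).reverse ++ (mTab g).reverse.take (pp2 g))) false = true := by
  decide +kernel

theorem sfB_sf {l : W} (hl : l.length ≤ 49) (h : sfB l = true) : SquareFree l := by
  induction l with
  | nil => exact sf_nil
  | cons x l ih =>
    have h' : band (! anyS (pack (x :: l)) mods) (sfB l) = true := h
    rw [band_true] at h'
    simp only [List.length_cons] at hl
    rw [sf_cons_iff]
    refine ⟨ih (by omega) h'.2, fun P hP => ?_⟩
    have h2 := h'.1
    rw [Bool.not_eq_true', ← Bool.not_eq_true, anyS_pack (by simp)] at h2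
    apply h2
    refine ⟨P, ?_, hP⟩
    have := hP.2.1
    simp only [List.length_cons] at this
    omega

theorem marks_conv {hX M hZ : W} {p2 p3 p4 : ℕ} (h : marksB hX M hZ p2 p3 p4)
    (hs : SquareFree (hX.reverse ++ M ++ hZ))
    (hj : jd 24 (pack hX.reverse) (pack (hX.reverse ++ M.take p2)) false = true) : Good hX M hZ := by
  obtain ⟨h1, h2, h3, h4, h5, h6, h7, h8, h9, h10, h11, h12, h13⟩ := h
  refine ⟨hs, p2, p3, p4, h1, h2, h3, h4, h5, ?_, h8, h9, h10, h11, h12, h13, hj⟩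
  intro i hi
  by_cases hi2 : i < 50
  · exact h6 i hi2 hi
  · rw [List.drop_eq_nil_of_le (by omega)] at hi
    simp [codeB, fCode] at hi

theorem mTab_len : ∀ g ∈ perms6, (mTab g).length ≤ 33 ∧ 10 ≤ (mTab g).length := by decide +kernel

theorem good_mTab (g : Equiv.Perm (Fin 3)) :
    Good hr (mTab g) (hr.map g) ∧ Good (hr.map g) (mTab g).reverse hr := by
  have hg := perm_mem g
  obtain ⟨h1, h2⟩ := marks_ok _ hg
  obtain ⟨j1, j2⟩ := jd_ok _ hg
  have hl := (mTab_len _ hg).1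
  have hs : SquareFree (hr.reverse ++ mTab g ++ hr.map g) :=
    sfB_sf (by simp [hr]; omega) (sfB_ok _ hg)
  refine ⟨marks_conv h1 hs j1, marks_conv h2 ?_ j2⟩
  have := sf_reverse hs
  simpa using this

end TSF

namespace TSF

theorem codeB_take {bs : List Bool} : ∀ {l : W}, codeB bs l ↔ codeB bs (l.take (bs.length + 2)) := by
  induction bs with
  | nil => intro l; simp [codeB]
  | cons b bs ih =>
    intro l
    match l with
    | [] => simp
    | [_] => simp [codeB]
    | [_, _] => simp [codeB]
    | x :: y :: z :: t =>
      have := ih (l := y :: z :: t)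
      simp only [List.length_cons, List.take_succ_cons] at this ⊢
      simp only [codeB]
      rw [this]

theorem codeB_len {l : W} (h : codeB fCode l) : 9 ≤ l.length := by
  match l, h with
  | [], h => simp [codeB, fCode] at h
  | [_], h => simp [codeB, fCode] at h
  | [_, _], h => simp [codeB, fCode] at h
  | [_, _, _], h => simp [codeB, fCode] at h
  | [_, _, _, _], h => simp [codeB, fCode] at h
  | [_, _, _, _, _], h => simp [codeB, fCode] at h
  | [_, _, _, _, _, _], h => simp [codeB, fCode] at h
  | [_, _, _, _, _, _, _], h => simp [codeB, fCode] at h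
  | [_, _, _, _, _, _, _, _], h => simp [codeB, fCode] at h
  | _ :: _ :: _ :: _ :: _ :: _ :: _ :: _ :: _ :: _, _ => simp

theorem codeB_rev {l : W} (hl : l.length = 9) : codeB fCode l.reverse → codeB fCode l := by
  match l, hl with
  | [a, b, c, d, e, f, g, h, i], _ =>
    simp only [List.reverse_cons, List.reverse_nil, List.nil_append, List.cons_append, codeB, fCode,
      decide_eq_false_iff_not, decide_eq_true_eq, and_true]
    rintro ⟨h1, h2, h3, h4, h5, h6, h7⟩
    exact ⟨Ne.symm h7, Ne.symm h6, Ne.symm h5, h4.symm, Ne.symm h3, Ne.symm h2, Ne.symm h1⟩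

theorem codeB_congr {l m : W} (h : l.take 9 = m.take 9) (hl : codeB fCode l) : codeB fCode m := by
  rw [codeB_take] at hl ⊢
  have : fCode.length + 2 = 9 := rfl
  rw [this] at hl ⊢
  rwa [← h]

theorem headH_eq : ∀ a b c d e f g h : Fin 3, a ≠ b → b ≠ c → c ≠ d → d ≠ e → e ≠ f → f ≠ g → g ≠ h →
    codeB hCode [a, b, c, d, e, f, g, h] →
    ∃ σ : Equiv.Perm (Fin 3), [a, b, c, d, e, f, g, h] = hr.map σ := by
  intro a b c d e f g h h1 h2 h3 h4 h5 h6 h7 hc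
  simp only [codeB, hCode, decide_eq_false_iff_not, decide_eq_true_eq, and_true] at hc
  obtain ⟨c1, c2, c3, c4, c5, c6⟩ := hc
  obtain ⟨σ, hσ⟩ : ∃ σ : Equiv.Perm (Fin 3), σ 1 = a ∧ σ 2 = b ∧ σ 0 = c := by
    have : ∀ a b c : Fin 3, a ≠ b → b ≠ c → a ≠ c →
      ∃ σ : Equiv.Perm (Fin 3), σ 1 = a ∧ σ 2 = b ∧ σ 0 = c := by decide
    exact this a b c h1 h2 c1
  refine ⟨σ, ?_⟩
  obtain ⟨rfl, rfl, rfl⟩ := hσ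
  have third : ∀ x y z w : Fin 3, x ≠ y → y ≠ z → x ≠ z → w ≠ y → w ≠ z → w = x := by
    have : ∀ x y z w : Fin 3, x ≠ y ∧ y ≠ z ∧ x ≠ z ∧ w ≠ y ∧ w ≠ z → w = x := by decide
    intro x y z w h1 h2 h3 h4 h5
    exact this x y z w ⟨h1, h2, h3, h4, h5⟩
  have e1 : d = σ 1 := third _ _ _ _ h1 h2 c1 (Ne.symm c2) (Ne.symm h3)
  subst e1
  subst c3
  have e2 : f = σ 2 := third _ _ _ _ h2 (Ne.symm c1) (Ne.symm h1) (Ne.symm h5) (Ne.symm c4)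
  subst e2
  have e3 : g = σ 1 := third _ _ _ _ h1 h2 c1 (Ne.symm h6) (Ne.symm c5)
  subst e3
  have e4 : h = σ 0 := third _ _ _ _ (Ne.symm c1) h1 (Ne.symm h2) (Ne.symm h7) (Ne.symm c6)
  subst e4
  simp [hr]

theorem headH_perm {l : W} (hs : SquareFree l) (hh : headH l) :
    ∃ (σ : Equiv.Perm (Fin 3)) (t : W), l = hr.map σ ++ t := by
  unfold headH at hh
  match l, hh with
  | [], hh => simp [codeB, hCode] at hh
  | [_], hh => simp [codeB, hCode] at hh
  | [_, _], hh => simp [codeB, hCode] at hh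
  | [_, _, _], hh => simp [codeB, hCode] at hh
  | [_, _, _, _], hh => simp [codeB, hCode] at hh
  | [_, _, _, _, _], hh => simp [codeB, hCode] at hh
  | [_, _, _, _, _, _], hh => simp [codeB, hCode] at hh
  | [_, _, _, _, _, _, _], hh => simp [codeB, hCode] at hh
  | a :: b :: c :: d :: e :: f :: g :: h :: t, hh =>
    have s1 := sf_tail hs
    have s2 := sf_tail s1
    have s3 := sf_tail s2
    have s4 := sf_tail s3
    have s5 := sf_tail s4
    have s6 := sf_tail s5
    obtain ⟨σ, hσ⟩ := headH_eq a b c d e f g h (sf_ne hs) (sf_ne s1) (sf_ne s2) (sf_ne s3) (sf_ne s4)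
      (sf_ne s5) (sf_ne s6) (by
        rw [codeB_take] at hh
        exact hh)
    refine ⟨σ, t, ?_⟩
    rw [← hσ]
    simp

/-! ### Squares at positions -/

/-- a square of period `P` at position `s` -/
def sqAt (T : W) (s P : ℕ) : Prop :=
  1 ≤ P ∧ s + 2 * P ≤ T.length ∧ ∀ i, s ≤ i → i < s + P → T[i]? = T[i + P]?

theorem exists_sqAt {T : W} (h : ¬ SquareFree T) : ∃ s P, sqAt T s P := by
  unfold SquareFree at h
  push Not at h
  obtain ⟨x, y, z, rfl, hy⟩ := h
  refine ⟨x.length, y.length, List.length_pos_of_ne_nil hy, by simp; omega, ?_⟩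
  intro i h1 h2
  simp only [List.append_assoc]
  have e1 : (x ++ (y ++ (y ++ z)))[i]? = y[i - x.length]? := by
    rw [List.getElem?_append_right h1, List.getElem?_append_left (by omega)]
  have e2 : (x ++ (y ++ (y ++ z)))[i + y.length]? = y[i - x.length]? := by
    rw [List.getElem?_append_right (by omega), List.getElem?_append_right (by omega),
      List.getElem?_append_left (by omega)]
    congr 1
    omega
  rw [e1, e2]

theorem sqAt.headSq {T : W} {s P : ℕ} (h : sqAt T s P) : headSq P (T.drop s) := by
  obtain ⟨h1, h2, h3⟩ := h
  refine ⟨h1, by rw [List.length_drop]; omega, ?_⟩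
  apply List.ext_getElem?
  intro i
  rw [List.drop_drop]
  by_cases hi : i < P
  · rw [List.getElem?_take_of_lt hi, List.getElem?_take_of_lt hi, List.getElem?_drop,
      List.getElem?_drop, h3 _ (by omega) (by omega)]
    congr 1; omega
  · rw [List.getElem?_eq_none (by simp; omega), List.getElem?_eq_none (by simp; omega)]

theorem sqAt.window {T : W} {s P : ℕ} (h : sqAt T s P) {i k : ℕ} (h1 : s ≤ i) (h2 : i + k ≤ s + P) :
    (T.drop i).take k = (T.drop (i + P)).take k := by
  obtain ⟨_, h4, h3⟩ := h
  apply List.ext_getElem?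
  intro j
  by_cases hj : j < k
  · rw [List.getElem?_take_of_lt hj, List.getElem?_take_of_lt hj, List.getElem?_drop,
      List.getElem?_drop, h3 _ (by omega) (by omega)]
    congr 1; omega
  · rw [List.getElem?_eq_none (by simp; omega), List.getElem?_eq_none (by simp; omega)]

theorem sqAt.reverse {T : W} {s P : ℕ} (h : sqAt T s P) :
    sqAt T.reverse (T.length - s - 2 * P) P := by
  obtain ⟨h1, h2, h3⟩ := h
  refine ⟨h1, by rw [List.length_reverse]; omega, ?_⟩
  intro i hi hi2
  rw [List.getElem?_reverse (by omega), List.getElem?_reverse (by omega),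
    h3 (T.length - 1 - (i + P)) (by omega) (by omega)]
  congr 1; omega

/-- squares inside a square-free factor -/
theorem sqAt.not_inside {p q r : W} {s P : ℕ} (h : sqAt (p ++ q ++ r) s P) (hq : SquareFree q)
    (h1 : p.length ≤ s) (h2 : s + 2 * P ≤ p.length + q.length) : False := by
  have hh : sqAt q (s - p.length) P := by
    obtain ⟨a, b, c⟩ := h
    refine ⟨a, by omega, ?_⟩
    intro i hi hi2
    have := c (i + p.length) (by omega) (by omega)
    have e : ∀ j, j < q.length → (p ++ q ++ r)[j + p.length]? = q[j]? := by
      intro j hj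
      rw [List.append_assoc, List.getElem?_append_right (by omega),
        List.getElem?_append_left (by omega)]
      congr 1
      omega
    have e3 : i + p.length + P = (i + P) + p.length := by ring
    rwa [e3, e _ (by omega), e _ (by omega)] at this
  exact not_headSq (sf_drop hq _) P hh.headSq

end TSF

namespace TSF

theorem perm_of_mem6 : ∀ g ∈ perms6, codeB fCode (([0, 1, 2, 0, 1, 0, 2, 1, 0] : W).map g) := by
  decide

theorem isF_codeB {w : W} (h : isF (pack w) = true) : codeB fCode w := by
  have gen : ∀ ms : List ℕ, List.rec (motive := fun _ => Bool) false
    (fun m _ ih => bor (Nat.beq (Nat.mod (pack w) 262144) m) ih) ms = true →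
      ∃ m ∈ ms, pack w % 262144 = m := by
    intro ms
    induction ms with
    | nil => intro h; simp at h
    | cons m ms ih =>
      intro h
      have h' : bor (Nat.beq (Nat.mod (pack w) 262144) m) (List.rec (motive := fun _ => Bool) false
        (fun m _ ih => bor (Nat.beq (Nat.mod (pack w) 262144) m) ih) ms) = true := h
      rw [bor_true] at h'
      rcases h' with h' | h'
      · exact ⟨m, by simp, Nat.eq_of_beq_eq_true h'⟩
      · obtain ⟨m', a, b⟩ := ih h'
        exact ⟨m', by simp [a], b⟩
  obtain ⟨m, hm, e⟩ := gen (perms6.map fun g => pack ([0, 1, 2, 0, 1, 0, 2, 1, 0].map g)) h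
  rw [List.mem_map] at hm
  obtain ⟨g, hg, rfl⟩ := hm
  have : (262144 : ℕ) = 4 ^ 9 := by norm_num
  rw [this, pack_mod] at e
  have := pack_inj e
  rw [codeB_take]
  change codeB fCode (w.take 9)
  rw [this]
  exact perm_of_mem6 g hg

/-- one extension step -/
noncomputable def jdExt (n w wm : ℕ) (bad : Bool) (d : ℕ) : Bool :=
  force (Nat.add d (Nat.mul 4 w)) fun w' =>
    bor (anyS w' mods) (bor (isF w')
      (force (Nat.add d (Nat.mul 4 wm)) fun wm' =>
        Bool.rec (jd n w' wm' false) (jd n w' wm' true)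
          (bor bad (band (anyS wm' mods) (Nat.ble 7 n)))))

theorem jd_succ (n w wm : ℕ) (bad : Bool) : jd (n + 1) w wm bad =
    band (jdExt n w wm bad 1) (band (jdExt n w wm bad 2) (jdExt n w wm bad 3)) := rfl

theorem jd_sound (n : ℕ) : ∀ (w m rest : W) (bad : Bool),
    jd n (pack w) (pack (w ++ m)) bad = true → SquareFree (rest.reverse ++ w) → n ≤ rest.length →
    (∀ j, j < n → ¬ codeB fCode ((rest.take (j + 1)).reverse ++ w)) →
    bad = false ∧ ∀ j, j + 7 < n → ¬ short ((rest.take (j + 1)).reverse ++ w ++ m) := by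
  induction n with
  | zero =>
    intro w m rest bad h _ _ _
    cases bad
    · simp
    · simp [jd] at h
  | succ n ih =>
    intro w m rest bad h hs hl hF
    match rest, hl with
    | z :: rest, hl =>
    have key : jdExt n (pack w) (pack (w ++ m)) bad (z.1 + 1) = true := by
      rw [jd_succ] at h
      simp only [band_true] at h
      obtain ⟨h1, h2, h3⟩ := h
      fin_cases z
      · exact h1
      · exact h2
      · exact h3
    simp only [jdExt, force_eq] at key
    have e1 : Nat.add (z.1 + 1) (Nat.mul 4 (pack w)) = pack (z :: w) := rfl
    have e2 : Nat.add (z.1 + 1) (Nat.mul 4 (pack (w ++ m))) = pack (z :: w ++ m) := rfl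
    rw [e1, e2, bor_true, bor_true] at key
    have hs' : SquareFree (rest.reverse ++ (z :: w)) := by simpa using hs
    have k2 : jd n (pack (z :: w)) (pack (z :: w ++ m))
        (bor bad (band (anyS (pack (z :: w ++ m)) mods) (Nat.ble 7 n))) = true := by
      rcases key with h1 | h1 | h1
      · exfalso
        rw [anyS_pack (by simp)] at h1
        obtain ⟨P, _, hP⟩ := h1
        exact not_headSq (sf_suffix hs') P hP
      · exfalso
        have := hF 0 (by omega)
        simp only [zero_add, List.take_succ_cons, List.take_zero, List.reverse_cons, List.reverse_nil,
          List.nil_append, List.cons_append] at this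
        exact this (isF_codeB h1)
      · generalize bor bad (band (anyS (pack (z :: w ++ m)) mods) (Nat.ble 7 n)) = b at h1 ⊢
        cases b <;> exact h1
    have := ih (z :: w) m rest _ k2 hs' (by simpa using hl) (by
      intro j hj
      have := hF (j + 1) (by omega)
      simpa using this)
    obtain ⟨b1, b2⟩ := this
    have b3 : ¬ (bad = true ∨ (short (z :: w ++ m) ∧ 7 ≤ n)) := by
      intro hb
      have : bor bad (band (anyS (pack (z :: w ++ m)) mods) (Nat.ble 7 n)) = true := by
        rw [bor_true, band_true, anyS_pack (by simp)]
        rcases hb with hb | hb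
        · exact Or.inl hb
        · exact Or.inr ⟨hb.1, by simpa using hb.2⟩
      rw [b1] at this
      simp at this
    refine ⟨by
      cases bad
      · rfl
      · simp at b3, ?_⟩
    intro j hj
    cases j with
    | zero =>
      intro hsh
      apply b3
      right
      exact ⟨by simpa using hsh, by omega⟩
    | succ j =>
      have := b2 j (by omega)
      simpa using this

/-- markers to the left of the junction -/
theorem left_marker {w R : W} {K i : ℕ} (hF : ∀ j < K, ¬ headF (w.drop j)) (hi : i + 9 ≤ w.length)
    (h : codeB fCode ((w.reverse ++ R).drop i)) : i + 9 + K ≤ w.length := by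
  by_contra hc
  apply hF (w.length - 9 - i) (by omega)
  unfold headF
  have e : ((w.reverse ++ R).drop i).take 9 = ((w.drop (w.length - 9 - i)).take 9).reverse := by
    rw [List.drop_append_of_le_length (by simp; omega), List.take_append_of_le_length (by simp; omega),
      List.drop_reverse, List.take_reverse]
    congr 1
    rw [List.drop_take, List.length_take]
    congr 1
    · omega
    · congr 1; omega
  rw [codeB_take] at h ⊢
  change codeB fCode (List.take 9 _) at h
  change codeB fCode (List.take 9 _)
  rw [e] at h
  exact codeB_rev (by simp; omega) h

theorem nearL {hX M hZ X Z : W} (hg : Good hX M hZ) (lX : hX.length = 8) (lZ : hZ.length = 8)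
    (lM : M.length ≤ 33)
    (sX : SquareFree (hX ++ X)) {K : ℕ} (hK : 50 ≤ K) (hKX : K ≤ (hX ++ X).length)
    (fX : ∀ j < K, ¬ headF ((hX ++ X).drop j)) (fZ : ∀ j < K, ¬ headF ((hZ ++ Z).drop j))
    {s P : ℕ} (h : sqAt ((hX ++ X).reverse ++ (M ++ (hZ ++ Z))) s P)
    (h1 : s + 8 < (hX ++ X).length) (h2 : (hX ++ X).length < s + 2 * P) (hP : P + 50 ≤ K) : False := by
  obtain ⟨p2, p3, p4, c1, c2, c3, c4, c5, hm, m1, m2, m3, m4, n2, n3, hj⟩ := hg.marks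
  set J := hX.reverse ++ M ++ hZ with hJ
  set a := (hX ++ X).length with ha
  set T := (hX ++ X).reverse ++ (M ++ (hZ ++ Z)) with hT
  have lJ : J.length = M.length + 16 := by rw [hJ]; simp; omega
  have aX : a = 8 + X.length := by rw [ha]; simp [lX]
  have TJ : T = X.reverse ++ (J ++ Z) := by rw [hT, hJ]; simp
  have dropJ : ∀ i, i ≤ J.length → T.drop (a - 8 + i) = J.drop i ++ Z := by
    intro i hi
    rw [TJ, List.drop_append, List.drop_append, List.drop_eq_nil_of_le (by simp; omega)]
    have e1 : a - 8 + i - X.reverse.length = i := by simp; omega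
    rw [e1]
    have e2 : i - J.length = 0 := by omega
    rw [e2]
    simp
  have wJ : ∀ i, i + 9 ≤ J.length → (T.drop (a - 8 + i)).take 9 = (J.drop i).take 9 := by
    intro i hi
    rw [dropJ i (by omega), List.take_append_of_le_length (by simp; omega)]
  have bJ : ∀ p, codeB fCode (J.drop p) → p + 9 ≤ J.length := by
    intro p hp
    have := codeB_len hp
    rw [List.length_drop] at this
    omega
  have b4 := bJ _ m4
  -- positions of markers
  have loc : ∀ i, codeB fCode (T.drop i) → i + 9 + K ≤ a ∨ i = a - 8 ∨ i = a - 8 + p2 ∨ i = a - 8 + p3 ∨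
      i = a - 8 + p4 ∨ a + M.length + K ≤ i := by
    intro i hi
    by_cases q1 : i + 9 ≤ a
    · left
      exact left_marker fX q1 hi
    by_cases q2 : i < a + M.length
    · have e : i = a - 8 + (i - (a - 8)) := by omega
      rw [e] at hi
      have := hm (i - (a - 8)) (codeB_congr (wJ _ (by omega)) hi)
      omega
    · right; right; right; right; right
      by_contra hc
      apply fZ (i - (a + M.length)) (by omega)
      have : T.drop i = (hZ ++ Z).drop (i - (a + M.length)) := by
        rw [hT, List.drop_append, List.drop_append, List.drop_eq_nil_of_le (by rw [List.length_reverse]; omega),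
          List.drop_eq_nil_of_le (by rw [List.length_reverse]; omega)]
        simp only [List.nil_append, List.length_reverse]
        congr 1
        omega
      rw [this] at hi
      exact hi
  have mk : ∀ p, codeB fCode (J.drop p) → codeB fCode (T.drop (a - 8 + p)) :=
    fun p hp => codeB_congr (wJ p (bJ p hp)).symm hp
  have fwd : ∀ i, s ≤ i → i + 9 ≤ s + P → codeB fCode (T.drop i) → codeB fCode (T.drop (i + P)) :=
    fun i q1 q2 q3 => codeB_congr (h.window q1 q2) q3
  have bwd : ∀ i, s + P ≤ i → i + 9 ≤ s + 2 * P → codeB fCode (T.drop i) → codeB fCode (T.drop (i - P)) := by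
    intro i q1 q2 q3
    refine codeB_congr ?_ q3
    have := h.window (i := i - P) (k := 9) (by omega) (by omega)
    rw [this]
    congr 2
    omega
  have hP1 := h.1
  have k1 := mk 0 m1
  have k2 := mk p2 m2
  have k3 := mk p3 m3
  rw [add_zero] at k1
  by_cases case1 : a + 1 ≤ s + P
  · -- the first marker lies in the first half
    have q := loc _ (fwd _ (by omega) (by omega) k1)
    have w := h.window (i := a - 8) (k := 9) (by omega) (by omega)
    have w0 := wJ 0 (by omega)
    rw [add_zero] at w0
    rw [w0] at w
    have P4 : P = p4 := by
      rcases q with q | q | q | q | q | q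
      · omega
      · omega
      · exfalso
        apply n2
        rw [w, q, wJ _ (by omega)]
      · exfalso
        apply n3
        rw [w, q, wJ _ (by omega)]
      · omega
      · omega
    have strad : ∀ p, 9 ≤ p → p + 9 ≤ p4 → codeB fCode (T.drop (a - 8 + p)) →
        a - 8 + p < s + P ∧ s + P < a - 8 + p + 9 := by
      intro p r1 r2 r3
      constructor
      · by_contra hc
        have := loc _ (bwd _ (by omega) (by omega) r3)
        omega
      · by_contra hc
        have := loc _ (fwd _ (by omega) (by omega) r3)
        omega
    have := strad p2 (by omega) (by omega) k2
    have := strad p3 (by omega) (by omega) k3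
    omega
  by_cases case2 : s + P ≤ a - 8
  · have := loc _ (bwd _ case2 (by omega) k1)
    omega
  -- straddling
  by_cases case3 : a - 8 + p2 + 9 ≤ s + 2 * P
  · have q := loc _ (bwd _ (by omega) case3 k2)
    have w := h.window (i := a - 8 + p2 - P) (k := 9) (by omega) (by omega)
    have e : a - 8 + p2 - P + P = a - 8 + p2 := by omega
    rw [e, wJ _ (by omega)] at w
    have : a - 8 + p2 - P = a - 8 := by omega
    apply n2
    rw [← w, this]
    have w0 := wJ 0 (by omega)
    rw [add_zero] at w0
    rw [w0]
  · -- short square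
    have hs := jd_sound 24 hX.reverse (M.take p2) X false hj (by
        have := sf_reverse sX
        simpa using this) (by omega) (by
        intro j hj' hc
        have e : (X.take (j + 1)).reverse ++ hX.reverse = ((hX ++ X).take (j + 9)).reverse := by
          rw [← List.reverse_append]
          congr 1
          rw [List.take_append, lX, List.take_of_length_le (l := hX) (by omega)]
          congr 2
        have e2 : T.drop (a - (j + 9)) = ((hX ++ X).take (j + 9)).reverse ++ (M ++ (hZ ++ Z)) := by
          rw [hT, List.drop_append_of_le_length (by rw [List.length_reverse]; omega), List.drop_reverse]
          congr 3
          omega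
        have := loc (a - (j + 9)) (by
          refine codeB_congr ?_ hc
          rw [e2, e]
          have lt : ((hX ++ X).take (j + 9)).reverse.length = j + 9 := by
            rw [List.length_reverse, List.length_take]; omega
          generalize ((hX ++ X).take (j + 9)).reverse = V at lt
          rw [List.take_append_of_le_length (by omega)])
        omega)
    have ns := hs.2 (a - s - 9) (by omega)
    apply ns
    refine ⟨P, by omega, ?_⟩
    have e2 : T.drop s = ((X.take (a - s - 9 + 1)).reverse ++ hX.reverse ++ M.take p2) ++
        (M.drop p2 ++ (hZ ++ Z)) := by
      rw [hT, List.drop_append_of_le_length (by rw [List.length_reverse]; omega), List.drop_reverse,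
        List.take_append, List.take_of_length_le (by omega), List.reverse_append]
      have : a - s - 9 + 1 = a - s - hX.length := by omega
      rw [this, ← ha]
      simp only [List.append_assoc]
      rw [← List.append_assoc (M.take p2), List.take_append_drop]
    have hh := h.headSq
    rw [e2] at hh
    obtain ⟨g1, g2, g3⟩ := hh
    have L : ((X.take (a - s - 9 + 1)).reverse ++ hX.reverse ++ M.take p2).length = a - s + p2 := by
      simp only [List.length_append, List.length_reverse, List.length_take, lX]
      omega
    refine ⟨g1, by omega, ?_⟩
    generalize (X.take (a - s - 9 + 1)).reverse ++ hX.reverse ++ M.take p2 = V at L g3 ⊢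
    rw [List.take_append_of_le_length (by omega), List.drop_append_of_le_length (by omega),
      List.take_append_of_le_length (by rw [List.length_drop]; omega)] at g3
    exact g3

end TSF

namespace TSF

theorem rev_window {w R : W} {i k : ℕ} (h : i + k ≤ w.length) :
    ((w.reverse ++ R).drop i).take k = ((w.drop (w.length - i - k)).take k).reverse := by
  rw [List.drop_append_of_le_length (by simp; omega), List.take_append_of_le_length (by simp; omega),
    List.drop_reverse, List.take_reverse]
  congr 1
  rw [List.drop_take, List.length_take]
  congr 1
  · omega
  · congr 1; omega

theorem farX {w R : W} {s P l : ℕ} (h : sqAt (w.reverse ++ R) s P) (hl : l ≤ w.length)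
    (AX : ∀ j, 1 ≤ j → l + j ≤ w.length → w.take l ≠ (w.drop j).take l)
    (h1 : s + P + l ≤ w.length) (h2 : w.length < s + 2 * P) : False := by
  have hP := h.1
  have q := h.window (i := w.length - l - P) (k := l) (by omega) (by omega)
  have e : w.length - l - P + P = w.length - l := by omega
  rw [e, rev_window (by omega), rev_window (by omega)] at q
  have q2 := List.reverse_injective q
  have e1 : w.length - (w.length - l) - l = 0 := by omega
  have e2 : w.length - (w.length - l - P) - l = P := by omega
  rw [e1, e2, List.drop_zero] at q2
  exact AX P hP (by omega) q2.symm

theorem junction {hX M hZ X Z : W} (g1 : Good hX M hZ) (g2 : Good hZ M.reverse hX)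
    (lX : hX.length = 8) (lZ : hZ.length = 8) (lM : M.length ≤ 33)
    (sX : SquareFree (hX ++ X)) (sZ : SquareFree (hZ ++ Z)) {K l : ℕ} (hK : 13 * l + 100 ≤ K)
    (hKX : K ≤ (hX ++ X).length) (hKZ : K ≤ (hZ ++ Z).length)
    (fX : ∀ j < K, ¬ headF ((hX ++ X).drop j)) (fZ : ∀ j < K, ¬ headF ((hZ ++ Z).drop j))
    (AX : ∀ j, 1 ≤ j → l + j ≤ (hX ++ X).length → (hX ++ X).take l ≠ ((hX ++ X).drop j).take l)
    (AZ : ∀ j, 1 ≤ j → l + j ≤ (hZ ++ Z).length → (hZ ++ Z).take l ≠ ((hZ ++ Z).drop j).take l)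
    (C : ∀ i, i + 11 * l ≤ (hZ ++ Z).length →
      ((hZ ++ Z).drop i).take (11 * l) ≠ (((hX ++ X).drop l).take (11 * l)).reverse) :
    SquareFree ((hX ++ X).reverse ++ (M ++ (hZ ++ Z))) := by
  by_contra hsf
  obtain ⟨s, P, h⟩ := exists_sqAt hsf
  have hP1 := h.1
  have hr := h.reverse
  have er : ((hX ++ X).reverse ++ (M ++ (hZ ++ Z))).reverse =
      (hZ ++ Z).reverse ++ (M.reverse ++ (hX ++ X)) := by simp
  have lT : ((hX ++ X).reverse ++ (M ++ (hZ ++ Z))).length =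
      (hX ++ X).length + M.length + (hZ ++ Z).length := by simp; omega
  rw [er, lT] at hr
  have hle := h.2.1
  rw [lT] at hle
  have q8 : (hX ++ X).length = 8 + X.length := by simp [lX]
  have q9 : (hZ ++ Z).length = 8 + Z.length := by simp [lZ]
  have caseJ : ¬ ((hX ++ X).length ≤ s + 8 ∧ s + 2 * P ≤ (hX ++ X).length + M.length + 8) := by
    rintro ⟨h1, h2⟩
    have hh : sqAt (X.reverse ++ (hX.reverse ++ M ++ hZ) ++ Z) s P := by
      convert h using 1
      simp
    refine hh.not_inside g1.sf (by simp; omega) ?_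
    simp only [List.length_append, List.length_reverse]
    omega
  have caseX : (hX ++ X).length < s + 2 * P := by
    by_contra hc
    have hh : sqAt ([] ++ (hX ++ X).reverse ++ (M ++ (hZ ++ Z))) s P := by
      rw [List.nil_append]; exact h
    refine hh.not_inside (sf_reverse sX) (by simp) ?_
    rw [List.length_reverse, List.length_nil]
    omega
  have caseZ : s < (hX ++ X).length + M.length := by
    by_contra hc
    have hh : sqAt (((hX ++ X).reverse ++ M) ++ (hZ ++ Z) ++ []) s P := by
      convert h using 1
      simp
    refine hh.not_inside sZ (by rw [List.length_append, List.length_reverse]; omega) ?_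
    rw [List.length_append, List.length_reverse]
    omega
  by_cases hP : P + 50 ≤ K
  · by_cases c1 : s + 8 < (hX ++ X).length
    · exact nearL g1 lX lZ lM sX (by omega) hKX fX fZ h c1 caseX hP
    · refine nearL g2 lZ lX (by simpa using lM) sZ (by omega) hKZ fZ fX hr ?_ ?_ hP
      · omega
      · omega
  · by_cases c1 : s + P + l ≤ (hX ++ X).length
    · exact farX h (by omega) AX c1 caseX
    by_cases c2 : (hX ++ X).length + M.length + l ≤ s + P
    · exact farX hr (by omega) AZ (by omega) (by omega)
    · have q := h.window (i := (hX ++ X).length - 12 * l) (k := 11 * l) (by omega) (by omega)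
      rw [rev_window (by omega)] at q
      have e1 : (hX ++ X).length - ((hX ++ X).length - 12 * l) - 11 * l = l := by omega
      rw [e1] at q
      have e2 : ((hX ++ X).reverse ++ (M ++ (hZ ++ Z))).drop ((hX ++ X).length - 12 * l + P) =
          (hZ ++ Z).drop ((hX ++ X).length - 12 * l + P - ((hX ++ X).length + M.length)) := by
        rw [List.drop_append, List.drop_append,
          List.drop_eq_nil_of_le (by rw [List.length_reverse]; omega),
          List.drop_eq_nil_of_le (by rw [List.length_reverse]; omega)]
        simp only [List.nil_append, List.length_reverse]
        congr 1
        omega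
      rw [e2] at q
      refine C _ ?_ q.symm
      have := congrArg List.length q
      rw [List.length_reverse, List.length_take, List.length_take, List.length_drop,
        List.length_drop] at this
      omega

end TSF

namespace TSF
open Classical

theorem junction2 {x z : W} (sX : SquareFree x) (sZ : SquareFree z) (hX : headH x) (hZ : headH z)
    {K l : ℕ} (hK : 13 * l + 100 ≤ K)
    (hKX : K ≤ x.length) (hKZ : K ≤ z.length)
    (fX : ∀ j < K, ¬ headF (x.drop j)) (fZ : ∀ j < K, ¬ headF (z.drop j))
    (AX : ∀ j, 1 ≤ j → l + j ≤ x.length → x.take l ≠ (x.drop j).take l)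
    (AZ : ∀ j, 1 ≤ j → l + j ≤ z.length → z.take l ≠ (z.drop j).take l)
    (C : ∀ i, i + 11 * l ≤ z.length →
      (z.drop i).take (11 * l) ≠ ((x.drop l).take (11 * l)).reverse) :
    ∃ M : W, M.length ≤ 33 ∧ SquareFree (x.reverse ++ (M ++ z)) := by
  obtain ⟨σ, X, eX⟩ := headH_perm sX hX
  obtain ⟨τ, Z, eZ⟩ := headH_perm sZ hZ
  set g : Equiv.Perm (Fin 3) := τ.trans σ.symm with hg
  have eX' : x.map σ.symm = hr ++ X.map σ.symm := by
    rw [eX, List.map_append, List.map_map]; simp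
  have eZ' : z.map σ.symm = hr.map g ++ Z.map σ.symm := by
    rw [eZ, List.map_append, List.map_map]; rfl
  obtain ⟨g1, g2⟩ := good_mTab g
  have lM := (mTab_len _ (perm_mem g)).1
  have inj : Function.Injective (List.map σ.symm) := List.map_injective_iff.2 σ.symm.injective
  have J := junction (X := X.map σ.symm) (Z := Z.map σ.symm) g1 g2 rfl (by simp [hr]) lM
    (by rw [← eX']; exact (sf_map_iff _).2 sX) (by rw [← eZ']; exact (sf_map_iff _).2 sZ) hK
    (by rw [← eX']; simpa using hKX) (by rw [← eZ']; simpa using hKZ)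
    (by
      rw [← eX']; intro j hj
      rw [← List.map_drop]; unfold headF; rw [codeB_map]; exact fX j hj)
    (by
      rw [← eZ']; intro j hj
      rw [← List.map_drop]; unfold headF; rw [codeB_map]; exact fZ j hj)
    (by
      rw [← eX']; intro j hj h2 h3
      rw [← List.map_drop, ← List.map_take, ← List.map_take] at h3
      exact AX j hj (by simpa using h2) (inj h3))
    (by
      rw [← eZ']; intro j hj h2 h3
      rw [← List.map_drop, ← List.map_take, ← List.map_take] at h3
      exact AZ j hj (by simpa using h2) (inj h3))
    (by
      rw [← eX', ← eZ']; intro j hj h3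
      rw [← List.map_drop, ← List.map_take, ← List.map_drop, ← List.map_take, ← List.map_reverse] at h3
      exact C j (by simpa using hj) (inj h3))
  rw [← eX', ← eZ'] at J
  refine ⟨(mTab g).map σ, by simpa using lM, ?_⟩
  rw [← sf_map_iff σ.symm]
  convert J using 1
  simp [List.map_reverse]

theorem drop_EE {U : W} {k l : ℕ} {x : W} (h : x ∈ EE U k) (hl : l ≤ k) : x.drop l ∈ EE U (k - l) := by
  rw [mem_EE] at h ⊢
  obtain ⟨h1, h2, h3, h4⟩ := h
  refine ⟨by rw [List.length_drop]; omega, ?_, sf_drop h3 _, ?_⟩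
  · rw [List.drop_drop, ← h2]; congr 1; omega
  · intro j hj
    rw [List.drop_drop]
    exact h4 _ (by omega)

theorem period_inj {x y : W} {l j : ℕ} (hj : 1 ≤ j) (h : x.drop l = y.drop l)
    (hx : x.take l = (x.drop j).take l) (hy : y.take l = (y.drop j).take l) : x = y := by
  have key : ∀ (d i : ℕ), l ≤ i + d → x[i]? = y[i]? := by
    intro d
    induction d with
    | zero =>
      intro i hi
      have := congrArg (fun t => t[i - l]?) h
      simp only [List.getElem?_drop] at this
      have e : l + (i - l) = i := by omega
      rwa [e] at this
    | succ d ih =>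
      intro i hi
      by_cases hil : i < l
      · have e1 := congrArg (fun t => t[i]?) hx
        have e2 := congrArg (fun t => t[i]?) hy
        simp only [List.getElem?_take_of_lt hil, List.getElem?_drop] at e1 e2
        rw [e1, e2]
        exact ih _ (by omega)
      · exact ih _ (by omega)
  exact List.ext_getElem? fun i => key l i (by omega)

def badA (l : ℕ) (x : W) : Prop := ∃ j, 1 ≤ j ∧ l + j ≤ x.length ∧ x.take l = (x.drop j).take l

theorem badA_card {U : W} {k l : ℕ} (hl : l ≤ k) :
    ((HE U k).filter (badA l)).card ≤ (k + U.length) * (EE U (k - l)).card := by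
  have sub : (HE U k).filter (badA l) ⊆ (Finset.Icc 1 (k + U.length)).biUnion fun j =>
      (EE U k).filter fun x => x.take l = (x.drop j).take l := by
    intro x hx
    simp only [Finset.mem_filter, HE] at hx
    obtain ⟨⟨h1, _⟩, j, h2, h3, h4⟩ := hx
    rw [Finset.mem_biUnion]
    refine ⟨j, ?_, by simp [h1, h4]⟩
    have := (mem_EE.1 h1).1
    rw [Finset.mem_Icc]
    omega
  refine (Finset.card_le_card sub).trans (Finset.card_biUnion_le.trans ?_)
  refine (Finset.sum_le_card_nsmul _ _ (EE U (k - l)).card ?_).trans (by simp)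
  intro j hj
  rw [Finset.mem_Icc] at hj
  refine Finset.card_le_card_of_injOn (fun x => x.drop l) ?_ ?_
  · intro x hx
    have hx := Finset.mem_coe.1 hx
    rw [Finset.mem_filter] at hx
    exact Finset.mem_coe.2 (drop_EE hx.1 hl)
  · intro x hx y hy h
    have hx := Finset.mem_coe.1 hx
    have hy := Finset.mem_coe.1 hy
    rw [Finset.mem_filter] at hx hy
    exact period_inj hj.1 h hx.2 hy.2

def badC (l : ℕ) (z x : W) : Prop := ∃ i, i + 11 * l ≤ z.length ∧
  (z.drop i).take (11 * l) = ((x.drop l).take (11 * l)).reverse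

theorem badC_card {U z : W} {k l : ℕ} (hl : 12 * l ≤ k) :
    ((HE U k).filter (badC l z)).card ≤ (z.length + 1) * (3 ^ l * (EE U (k - 12 * l)).card) := by
  have sub : (HE U k).filter (badC l z) ⊆ (Finset.range (z.length + 1)).biUnion fun i =>
      (EE U k).filter fun x => (z.drop i).take (11 * l) = ((x.drop l).take (11 * l)).reverse := by
    intro x hx
    simp only [Finset.mem_filter, HE] at hx
    obtain ⟨⟨h1, _⟩, j, h2, h4⟩ := hx
    rw [Finset.mem_biUnion]
    refine ⟨j, by rw [Finset.mem_range]; omega, by simp [h1, h4]⟩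
  refine (Finset.card_le_card sub).trans (Finset.card_biUnion_le.trans ?_)
  refine (Finset.sum_le_card_nsmul _ _ (3 ^ l * (EE U (k - 12 * l)).card) ?_).trans (by simp)
  intro i hi
  rw [← card_wordsF l, ← Finset.card_product]
  refine Finset.card_le_card_of_injOn (fun x => (x.take l, x.drop (12 * l))) ?_ ?_
  · intro x hx
    have hx := Finset.mem_coe.1 hx
    rw [Finset.mem_filter] at hx
    rw [Finset.mem_coe, Finset.mem_product]
    have := (mem_EE.1 hx.1).1
    refine ⟨?_, drop_EE hx.1 hl⟩
    rw [mem_wordsF, List.length_take]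
    omega
  · intro x hx y hy h
    have hx := Finset.mem_coe.1 hx
    have hy := Finset.mem_coe.1 hy
    rw [Finset.mem_filter] at hx hy
    simp only [Prod.mk.injEq] at h
    have e : (x.drop l).take (11 * l) = (y.drop l).take (11 * l) :=
      List.reverse_injective (hx.2.symm.trans hy.2)
    have e2 : ∀ w : W, w = w.take l ++ ((w.drop l).take (11 * l) ++ w.drop (12 * l)) := by
      intro w
      have : w.drop (12 * l) = (w.drop l).drop (11 * l) := by rw [List.drop_drop]; congr 1; ring
      rw [this, List.take_append_drop, List.take_append_drop]
    rw [e2 x, e2 y, h.1, h.2, e]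

end TSF

namespace TSF
open Classical

theorem exists_hub {U : W} (hU : 50 ≤ U.length) (hs : SquareFree U) (hV : 0.005 ≤ VV U)
    {m l N : ℕ} (hm : 200041 * 1.2094 ^ m * (3 : ℝ) ^ (30 * l) ≤ 0.005 * 1.21 ^ m)
    (hN : m + U.length ≤ N) (hbig : (200041 : ℝ) * (2 * N + 2) < 1.2094 ^ l) (z : W) (hz : z.length ≤ N) :
    ∃ k x, 30 * l ≤ k ∧ k ≤ m ∧ x ∈ HE U k ∧ ¬ badA l x ∧ ¬ badC l z x := by
  obtain ⟨k, hk, hR, hH, hE⟩ := hub_lemma hU hs hV (m := m) (R := (3 : ℝ) ^ (30 * l))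
    (one_le_pow₀ (by norm_num)) hm
  have hkl : 30 * l ≤ k := by
    by_contra hc
    have : (3 : ℝ) ^ k < 3 ^ (30 * l) := pow_lt_pow_right₀ (by norm_num) (by omega)
    linarith
  by_contra hcon
  push Not at hcon
  have cov : HE U k ⊆ (HE U k).filter (badA l) ∪ (HE U k).filter (badC l z) := by
    intro x hx
    rw [Finset.mem_union, Finset.mem_filter, Finset.mem_filter]
    by_cases h : badA l x
    · exact Or.inl ⟨hx, h⟩
    · exact Or.inr ⟨hx, hcon k x hkl hk hx h⟩
  have c1 := (Finset.card_le_card cov).trans (Finset.card_union_le _ _)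
  have c2 := badA_card (U := U) (k := k) (l := l) (by omega)
  have c3 := badC_card (U := U) (z := z) (k := k) (l := l) (by omega)
  have e1 := hE (k - l) (by omega)
  have e2 := hE (k - 12 * l) (by omega)
  have f1 : k - (k - l) = l := by omega
  have f2 : k - (k - 12 * l) = 12 * l := by omega
  rw [f1] at e1
  rw [f2] at e2
  set H : ℝ := ((HE U k).card : ℝ) with hHdef
  set a1 : ℝ := ((EE U (k - l)).card : ℝ) with ha1
  set a2 : ℝ := ((EE U (k - 12 * l)).card : ℝ) with ha2
  have hH1 : (1 : ℝ) ≤ H := by rw [hHdef]; exact_mod_cast hH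
  have ha2n : 0 ≤ a2 := by rw [ha2]; positivity
  have ha1n : 0 ≤ a1 := by rw [ha1]; positivity
  have c4 : H ≤ N * a1 + (N + 1) * (3 ^ l * a2) := by
    have h1 : H ≤ ((k + U.length : ℕ) : ℝ) * a1 + ((z.length + 1 : ℕ) : ℝ) * (3 ^ l * a2) := by
      rw [hHdef, ha1, ha2]
      exact_mod_cast c1.trans (Nat.add_le_add c2 c3)
    have h2 : ((k + U.length : ℕ) : ℝ) ≤ N := by exact_mod_cast (by omega)
    have h3 : ((z.length + 1 : ℕ) : ℝ) ≤ N + 1 := by exact_mod_cast (by omega)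
    refine h1.trans (add_le_add (by gcongr) ?_)
    exact mul_le_mul_of_nonneg_right h3 (by positivity)
  set q : ℝ := 1.2094 ^ l with hq
  have hqp : 0 < q := by rw [hq]; positivity
  have e3 : 3 ^ l * a2 * q ≤ 200041 * H := by
    refine le_trans ?_ e2
    have : (3 : ℝ) ^ l * q ≤ 1.2094 ^ (12 * l) := by
      rw [hq, ← mul_pow, pow_mul]
      exact pow_le_pow_left₀ (by norm_num) (by norm_num) _
    calc 3 ^ l * a2 * q = a2 * (3 ^ l * q) := by ring
      _ ≤ _ := by gcongr
  have c5 : H * q ≤ 200041 * (2 * N + 2) * H := by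
    have hN0 : (0 : ℝ) ≤ N := by positivity
    have := mul_le_mul_of_nonneg_right c4 hqp.le
    have t1 : (N : ℝ) * (a1 * q) ≤ N * (200041 * H) := by gcongr
    have t2 : ((N : ℝ) + 1) * (3 ^ l * a2 * q) ≤ (N + 1) * (200041 * H) := by gcongr
    nlinarith
  have : q ≤ 200041 * (2 * N + 2) := by
    have := c5
    rw [mul_comm] at this
    exact le_of_mul_le_mul_right this (by linarith)
  linarith

theorem connect {U V : W} (hU : 50 ≤ U.length) (sU : SquareFree U) (vU : 0.005 ≤ VV U)
    (hV : 50 ≤ V.length) (sV : SquareFree V) (vV : 0.005 ≤ VV V)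
    {m l N : ℕ} (hm : 200041 * 1.2094 ^ m * (3 : ℝ) ^ (30 * l) ≤ 0.005 * 1.21 ^ m) (hl : 10 ≤ l)
    (hNU : m + U.length ≤ N) (hNV : m + V.length ≤ N)
    (hbig : (200041 : ℝ) * (2 * N + 2) < 1.2094 ^ l) :
    ∃ M : W, M.length ≤ 2 * m + 33 ∧ SquareFree (U.reverse ++ M ++ V) := by
  obtain ⟨k2, z, hk2, hk2m, hz, zA, _⟩ := exists_hub hV sV vV hm hNV hbig [] (by simp)
  have zE := Finset.mem_filter.1 hz
  obtain ⟨zl, zd, zs, zf⟩ := mem_EE.1 zE.1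
  obtain ⟨k1, x, hk1, hk1m, hx, xA, xC⟩ := exists_hub hU sU vU hm hNU hbig z (by omega)
  have xE := Finset.mem_filter.1 hx
  obtain ⟨xl, xd, xs, xf⟩ := mem_EE.1 xE.1
  obtain ⟨M, hM, hsf⟩ := junction2 (K := 30 * l) (l := l) xs zs xE.2 zE.2 (by omega) (by omega) (by omega)
    (fun j hj => xf j (by omega)) (fun j hj => zf j (by omega))
    (fun j h1 h2 h3 => xA ⟨j, h1, h2, h3⟩) (fun j h1 h2 h3 => zA ⟨j, h1, h2, h3⟩)
    (fun i h1 h2 => xC ⟨i, h1, h2⟩)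
  refine ⟨(x.take k1).reverse ++ M ++ z.take k2, by simp; omega, ?_⟩
  convert hsf using 1
  conv_rhs => rw [← List.take_append_drop k1 x, ← List.take_append_drop k2 z, xd, zd]
  simp

end TSF

namespace TSF

theorem ratio_pow : (2 : ℝ) * 3 ^ 30 * 1.2094 ^ 1000000 ≤ 1.21 ^ 1000000 := by
  have h1 : (2 : ℝ) ≤ (1.21 / 1.2094) ^ 2500 := by
    have := one_add_mul_le_pow (a := (0.000496 : ℝ)) (by norm_num) 2500
    refine le_trans ?_ (this.trans (pow_le_pow_left₀ (by norm_num) ?_ _))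
    · norm_num
    · norm_num
  have h2 : (2 : ℝ) * 3 ^ 30 ≤ (1.21 / 1.2094) ^ 1000000 := by
    calc (2 : ℝ) * 3 ^ 30 ≤ 2 ^ 60 := by norm_num
      _ ≤ 2 ^ 400 := pow_le_pow_right₀ (by norm_num) (by norm_num)
      _ ≤ ((1.21 / 1.2094) ^ 2500) ^ 400 := pow_le_pow_left₀ (by norm_num) h1 _
      _ = _ := by rw [← pow_mul]
  rw [div_pow, le_div_iff₀ (by positivity)] at h2
  exact h2

theorem ratio_pow2 {l : ℕ} (hl : 26 ≤ l) :
    200041 * 1.2094 ^ (1000000 * l) * (3 : ℝ) ^ (30 * l) ≤ 0.005 * 1.21 ^ (1000000 * l) := by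
  have h := pow_le_pow_left₀ (by positivity) ratio_pow l
  rw [mul_pow, mul_pow, ← pow_mul, ← pow_mul, ← pow_mul] at h
  have h2 : (40008200 : ℝ) ≤ 2 ^ l :=
    le_trans (by norm_num) (pow_le_pow_right₀ (by norm_num) hl)
  have h3 : (40008200 : ℝ) * (3 ^ (30 * l) * 1.2094 ^ (1000000 * l)) ≤
      2 ^ l * (3 ^ (30 * l) * 1.2094 ^ (1000000 * l)) :=
    mul_le_mul_of_nonneg_right h2 (by positivity)
  generalize (1.21 : ℝ) ^ (1000000 * l) = A at *
  generalize (1.2094 : ℝ) ^ (1000000 * l) = B at *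
  generalize (3 : ℝ) ^ (30 * l) = D at *
  linarith

theorem gluing {δ : ℝ} (h0 : 0 < δ) (h1 : δ ≤ 1) : ∃ n0 : ℕ, ∀ n ≥ n0, ∀ W1 W2 : W,
    W1.length = n → W2.length = n → SquareFree W1 → SquareFree W2 →
    ∃ (g1 g2 : ℕ) (M : W), (g1 : ℝ) ≤ δ * n ∧ (g2 : ℝ) ≤ δ * n ∧ (M.length : ℝ) ≤ δ * n ∧
      SquareFree (W1.take (n - g1) ++ M ++ W2.drop g2) := by
  set c : ℝ := δ / 8000000 with hc
  have c0 : 0 < c := by positivity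
  refine ⟨⌈10 ^ 9 / c ^ 2 + 27 / c + 100 / δ + 100⌉₊, ?_⟩
  intro n hn W1 W2 l1 l2 s1 s2
  have hn' : 10 ^ 9 / c ^ 2 + 27 / c + 100 / δ + 100 ≤ (n : ℝ) := (Nat.le_ceil _).trans (by exact_mod_cast hn)
  have b1 : 0 < 10 ^ 9 / c ^ 2 := by positivity
  have b2 : 0 < 27 / c := by positivity
  have b3 : 0 < 100 / δ := by positivity
  have n1 : (10 : ℝ) ^ 9 ≤ n * c ^ 2 := by
    have : 10 ^ 9 / c ^ 2 ≤ (n : ℝ) := by linarith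
    rwa [div_le_iff₀ (by positivity)] at this
  have n2 : (27 : ℝ) ≤ c * n := by
    have : 27 / c ≤ (n : ℝ) := by linarith
    rw [div_le_iff₀ (by positivity)] at this
    linarith
  have n3 : (100 : ℝ) ≤ δ * n := by
    have : 100 / δ ≤ (n : ℝ) := by linarith
    rw [div_le_iff₀ (by positivity)] at this
    linarith
  have n4 : (100 : ℝ) ≤ n := by linarith
  set l := ⌊c * n⌋₊ with hl
  have la : (l : ℝ) ≤ c * n := Nat.floor_le (by positivity)
  have lb : c * n < l + 1 := Nat.lt_floor_add_one _
  have l26 : 26 ≤ l := by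
    have : (26 : ℝ) < l + 1 := by linarith
    have : 26 < l + 1 := by exact_mod_cast this
    omega
  set m := 1000000 * l with hm
  have mle : (m : ℝ) ≤ δ * n / 8 := by
    rw [hm]; push_cast
    rw [hc] at la
    linarith
  have mn : 8 * m ≤ n := by
    have : (8 * m : ℝ) ≤ n := by nlinarith
    exact_mod_cast this
  have n100 : 100 ≤ n := by exact_mod_cast n4
  have big : (200041 : ℝ) * (2 * (2 * n : ℕ) + 2) < 1.2094 ^ l := by
    have t1 : (1 + (l : ℝ) * 0.09) ^ 2 ≤ 1.2094 ^ l := by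
      have := one_add_mul_le_pow (a := (0.09 : ℝ)) (by norm_num) l
      have t := pow_le_pow_left₀ (by positivity) this 2
      refine t.trans ?_
      rw [← pow_mul, mul_comm l 2, pow_mul]
      exact pow_le_pow_left₀ (by norm_num) (by norm_num) _
    refine lt_of_lt_of_le ?_ t1
    push_cast
    have t2 : c * n / 2 ≤ l := by linarith
    have t3 : (c * n / 2 * 0.09) ^ 2 ≤ (1 + (l : ℝ) * 0.09) ^ 2 :=
      pow_le_pow_left₀ (by positivity) (by nlinarith) 2
    refine lt_of_lt_of_le ?_ t3
    have t4 : (10 : ℝ) ^ 9 * n ≤ n * c ^ 2 * n := mul_le_mul_of_nonneg_right n1 (by linarith)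
    have t5 : (c * n / 2 * 0.09) ^ 2 = n * c ^ 2 * n * 0.002025 := by ring
    rw [t5]
    nlinarith
  have hlog : Nat.log 2 n < l := by
    apply Nat.log_lt_of_lt_pow (by omega)
    have : (n : ℝ) < 2 ^ l := by
      refine lt_of_lt_of_le ?_ (pow_le_pow_left₀ (by norm_num) (by norm_num : (1.2094 : ℝ) ≤ 2) l)
      push_cast at big
      nlinarith
    exact_mod_cast this
  have hexit : 1.04 + (Nat.log 2 n : ℝ) < 0.001 * (m : ℝ) := by
    have q1 : ((Nat.log 2 n : ℕ) : ℝ) < l := by exact_mod_cast hlog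
    have q2 : (26 : ℝ) ≤ l := by exact_mod_cast l26
    rw [hm]; push_cast
    linarith
  obtain ⟨g1, b1', g11, g1m, u1, v1⟩ := exit_lemma (L := W1.reverse) (sf_reverse s1) (s0 := n - m) (m := m)
    (by omega) (by rw [List.length_reverse]; omega) (by rw [List.length_reverse, l1]; exact hexit)
  obtain ⟨g2, b2', g21, g2m, u2, v2⟩ := exit_lemma (L := W2) s2 (s0 := n - m) (m := m)
    (by omega) (by omega) (by rw [l2]; exact hexit)
  have L1 : (b1' :: W1.reverse.drop g1).length = n - g1 + 1 := by
    rw [List.length_cons, List.length_drop, List.length_reverse, l1]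
  have L2 : (b2' :: W2.drop g2).length = n - g2 + 1 := by
    rw [List.length_cons, List.length_drop, l2]
  obtain ⟨M, hM, hs⟩ := connect (by omega) u1 v1 (by omega) u2 v2 (m := m) (l := l) (N := 2 * n)
    (ratio_pow2 l26) (by omega) (by omega) (by omega) big
  refine ⟨g1, g2, b1' :: M ++ [b2'], ?_, ?_, ?_, ?_⟩
  · have : (g1 : ℝ) ≤ m := by exact_mod_cast g1m
    linarith
  · have : (g2 : ℝ) ≤ m := by exact_mod_cast g2m
    linarith
  · have : (M.length : ℝ) ≤ 2 * m + 33 := by exact_mod_cast hM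
    simp only [List.length_append, List.length_cons, List.length_nil]
    push_cast
    linarith
  · convert hs using 1
    rw [List.reverse_cons, List.drop_reverse, List.reverse_reverse, l1]
    simp

end TSF

namespace TSF
open Classical

noncomputable def Sk (n k : ℕ) : Finset W := (wordsF n).filter fun w => SquareFree w ∧ w.count 0 = k

theorem mem_Sk {n k : ℕ} {w : W} : w ∈ Sk n k ↔ w.length = n ∧ SquareFree w ∧ w.count 0 = k := by
  rw [Sk, Finset.mem_filter, mem_wordsF]

theorem s2_eq (n k : ℕ) : s2 n k = (Sk n k).card := by
  unfold s2
  exact Nat.subtype_card _ fun x => mem_Sk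

theorem window_step (N : ℕ) (T : W) (j : ℕ) :
    ((T.drop (j + 1)).take N).count 0 ≤ ((T.drop j).take N).count 0 + 1 := by
  rcases h : T.drop j with _ | ⟨x, l⟩
  · rw [← List.drop_drop, h]; simp
  · rw [← List.drop_drop, h]
    cases N with
    | zero => simp
    | succ N =>
      rw [List.take_succ_cons, List.count_cons, List.drop_one, List.tail_cons, List.take_add_one,
        List.count_append]
      have : List.count 0 (l[N]?.toList) ≤ 1 := by
        refine List.count_le_length.trans ?_
        cases l[N]? <;> simp
      omega

theorem exists_window {N lo hi : ℕ} {T : W} (h : N ≤ T.length) (hlh : lo ≤ hi)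
    (h0 : (T.take N).count 0 ≤ hi) (h1 : lo ≤ ((T.drop (T.length - N)).take N).count 0) :
    ∃ j, j + N ≤ T.length ∧ lo ≤ ((T.drop j).take N).count 0 ∧ ((T.drop j).take N).count 0 ≤ hi := by
  have hex : ∃ j, lo ≤ ((T.drop j).take N).count 0 := ⟨_, h1⟩
  set j := Nat.find hex with hj
  have hs := Nat.find_spec hex
  have hle : j ≤ T.length - N := Nat.find_min' hex h1
  refine ⟨j, by omega, hs, ?_⟩
  rcases hj0 : j with _ | i
  · simpa using h0
  · have := Nat.find_min hex (m := i) (by omega)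
    have := window_step N T i
    omega

theorem comb {n N D k1 k2 lo hi : ℕ} (hN : N + D = n) (h1 : k1 ≤ hi) (h2 : lo + D ≤ k2) (hlh : lo ≤ hi)
    (glue : ∀ W1 W2 : W, W1.length = n → W2.length = n → SquareFree W1 → SquareFree W2 →
      ∃ (g1 g2 : ℕ) (M : W), g1 ≤ D ∧ g2 ≤ D ∧ M.length ≤ D ∧
        SquareFree (W1.take (n - g1) ++ M ++ W2.drop g2)) {B : ℝ} (hB0 : 0 ≤ B)
    (hB : ∀ j r c0 c c2, j + r ≤ n + 2 * D → n ≤ j + r + D → lo ≤ c → c ≤ hi →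
      k1 + k2 ≤ c0 + c + c2 + 3 * D → c0 + c + c2 ≤ k1 + k2 + 3 * D →
      (s2 j c0 : ℝ) * s2 N c * s2 r c2 ≤ B) :
    (s2 n k1 : ℝ) * s2 n k2 ≤ (4 * n + 1) ^ 8 * 9 ^ D * B := by
  let adm : (Fin 8 → ℕ) → Prop := fun d => d 0 + d 1 ≤ n + 2 * D ∧ n ≤ d 0 + d 1 + D ∧ lo ≤ d 3 ∧ d 3 ≤ hi ∧
    k1 + k2 ≤ d 2 + d 3 + d 4 + 3 * D ∧ d 2 + d 3 + d 4 ≤ k1 + k2 + 3 * D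
  let I : Finset ((Fin 8 → ℕ) × W × W) :=
    ((Fintype.piFinset fun _ => Finset.range (4 * n + 1)).filter adm) ×ˢ (wordsF D ×ˢ wordsF D)
  let t : Finset (Σ _ : (Fin 8 → ℕ) × W × W, W × W × W) :=
    I.sigma fun d => Sk (d.1 0) (d.1 2) ×ˢ (Sk N (d.1 3) ×ˢ Sk (d.1 1) (d.1 4))
  let R : W × W → (Σ _ : (Fin 8 → ℕ) × W × W, W × W × W) → Prop := fun p b =>
    b.1.1 5 ≤ D ∧ b.1.1 6 ≤ D ∧
    p.1.take (n - b.1.1 5) = (b.2.1 ++ (b.2.2.1 ++ b.2.2.2)).take (n - b.1.1 5) ∧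
    p.1.drop (n - D) = b.1.2.1 ∧
    p.2.drop (b.1.1 6) = (b.2.1 ++ (b.2.2.1 ++ b.2.2.2)).drop (n - b.1.1 5 + b.1.1 7) ∧
    p.2.take D = b.1.2.2
  have main : (Sk n k1 ×ˢ Sk n k2).card ≤ t.card := by
    apply Finset.card_le_card_of_forall_subsingleton R
    · rintro ⟨W1, W2⟩ hp
      rw [Finset.mem_product] at hp
      obtain ⟨l1, s1, e1⟩ := mem_Sk.1 hp.1
      obtain ⟨l2, s2, e2⟩ := mem_Sk.1 hp.2
      simp only at l1 l2 s1 s2 e1 e2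
      obtain ⟨g1, g2, M, hg1, hg2, hM, hs⟩ := glue W1 W2 l1 l2 s1 s2
      set T := W1.take (n - g1) ++ M ++ W2.drop g2 with hT
      have lT : T.length = n - g1 + M.length + (n - g2) := by
        rw [hT]; simp only [List.length_append, List.length_take, List.length_drop]; omega
      obtain ⟨j, hj, jlo, jhi⟩ := exists_window (N := N) (lo := lo) (hi := hi) (T := T) (by omega) hlh
        (by
          have : T.take N = W1.take N := by
            rw [hT, List.append_assoc, List.take_append_of_le_length (by rw [List.length_take]; omega),
              List.take_take]
            congr 1; omega
          rw [this]
          have := (List.take_sublist N W1).count_le 0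
          omega)
        (by
          have : T.drop (T.length - N) = W2.drop D := by
            rw [lT, hT, List.drop_append, List.drop_eq_nil_of_le (by
              simp only [List.length_append, List.length_take]; omega), List.nil_append, List.drop_drop]
            congr 1
            simp only [List.length_append, List.length_take]
            omega
          rw [this, List.take_of_length_le (by rw [List.length_drop]; omega)]
          have h3 := congrArg (List.count 0) (List.take_append_drop D W2)
          rw [List.count_append] at h3
          have : (W2.take D).count 0 ≤ D := List.count_le_length.trans (by rw [List.length_take]; omega)
          omega)
      have eT : T.take j ++ ((T.drop j).take N ++ T.drop (j + N)) = T := by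
        rw [← List.drop_drop, List.take_append_drop, List.take_append_drop]
      have cT : (T.take j).count 0 + ((T.drop j).take N).count 0 + (T.drop (j + N)).count 0 = T.count 0 := by
        conv_rhs => rw [← eT]
        rw [List.count_append, List.count_append]; ring
      have cW1 := congrArg (List.count 0) (List.take_append_drop (n - g1) W1)
      have cW2 := congrArg (List.count 0) (List.take_append_drop g2 W2)
      rw [List.count_append] at cW1 cW2
      have b1 : (W1.drop (n - g1)).count 0 ≤ D := List.count_le_length.trans (by rw [List.length_drop]; omega)
      have b2 : (W2.take g2).count 0 ≤ D := List.count_le_length.trans (by rw [List.length_take]; omega)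
      have b3 : M.count 0 ≤ D := List.count_le_length.trans hM
      have cT2 : T.count 0 = (W1.take (n - g1)).count 0 + M.count 0 + (W2.drop g2).count 0 := by
        rw [hT, List.count_append, List.count_append]
      have bT : T.count 0 ≤ T.length := List.count_le_length
      refine ⟨⟨(![j, T.length - j - N, (T.take j).count 0, ((T.drop j).take N).count 0,
        (T.drop (j + N)).count 0, g1, g2, M.length], W1.drop (n - D), W2.take D),
        (T.take j, (T.drop j).take N, T.drop (j + N))⟩, ?_, ?_⟩
      · rw [Finset.mem_sigma]
        constructor
        · rw [Finset.mem_product, Finset.mem_product, Finset.mem_filter]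
          refine ⟨⟨?_, ?_⟩, ?_, ?_⟩
          · rw [Fintype.mem_piFinset]
            intro i
            rw [Finset.mem_range]
            fin_cases i <;> simp <;> omega
          · simp only [adm]
            simp
            omega
          · rw [mem_wordsF, List.length_drop]; omega
          · rw [mem_wordsF, List.length_take]; omega
        · rw [Finset.mem_product, Finset.mem_product, mem_Sk, mem_Sk, mem_Sk]
          refine ⟨⟨?_, ?_, rfl⟩, ⟨?_, ?_, rfl⟩, ⟨?_, sf_drop hs _, rfl⟩⟩
          · simp; omega
          · exact sf_of_isInfix hs (List.take_prefix _ _).isInfix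
          · simp; omega
          · exact sf_of_isInfix (sf_drop hs j) (List.take_prefix _ _).isInfix
          · simp; omega
      · refine ⟨hg1, hg2, ?_, rfl, ?_, rfl⟩
        · simp only
          rw [eT]
          change W1.take (n - g1) = T.take (n - g1)
          rw [hT, List.append_assoc, List.take_append_of_le_length (by rw [List.length_take]; omega),
            List.take_take, min_self]
        · simp only
          rw [eT]
          change W2.drop g2 = T.drop (n - g1 + M.length)
          rw [hT, List.drop_left' (by simp only [List.length_append, List.length_take]; omega)]
    · rintro ⟨⟨d, R1, R2⟩, pre, win, post⟩ hb ⟨W1, W2⟩ ⟨hp, hR⟩ ⟨V1, V2⟩ ⟨hp', hR'⟩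
      obtain ⟨q1, q2, q3, q4, q5, q6⟩ := hR
      obtain ⟨_, _, r3, r4, r5, r6⟩ := hR'
      simp only at q1 q2 q3 q4 q5 q6 r3 r4 r5 r6
      have f1 : ∀ V : W, V = V.take (n - d 5) ++ (V.drop (n - D)).drop (D - d 5) := by
        intro V
        rw [List.drop_drop]
        have : n - D + (D - d 5) = n - d 5 := by omega
        rw [this, List.take_append_drop]
      have f2 : ∀ V : W, V = (V.take D).take (d 6) ++ V.drop (d 6) := by
        intro V
        rw [List.take_take, min_eq_left q2, List.take_append_drop]
      rw [Prod.mk.injEq]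
      constructor
      · rw [f1 W1, f1 V1, q3, q4, r3, r4]
      · rw [f2 W2, f2 V2, q5, q6, r5, r6]
  have tc : (t.card : ℝ) ≤ (4 * n + 1) ^ 8 * 9 ^ D * B := by
    rw [Finset.card_sigma]
    push_cast
    have : ∀ d ∈ I, ((Sk (d.1 0) (d.1 2) ×ˢ (Sk N (d.1 3) ×ˢ Sk (d.1 1) (d.1 4))).card : ℝ) ≤ B := by
      intro d hd
      rw [Finset.mem_product, Finset.mem_filter] at hd
      obtain ⟨a1, a2, a3, a4, a5, a6⟩ := hd.1.2
      have := hB _ _ _ _ _ a1 a2 a3 a4 a5 a6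
      rw [s2_eq, s2_eq, s2_eq] at this
      rw [Finset.card_product, Finset.card_product]
      push_cast
      rwa [← mul_assoc]
    refine (Finset.sum_le_card_nsmul _ _ B this).trans ?_
    rw [nsmul_eq_mul]
    refine mul_le_mul_of_nonneg_right ?_ hB0
    have : I.card ≤ (4 * n + 1) ^ 8 * 9 ^ D := by
      rw [Finset.card_product, Finset.card_product, card_wordsF, ← mul_pow]
      refine Nat.mul_le_mul ((Finset.card_filter_le _ _).trans ?_) le_rfl
      rw [Fintype.card_piFinset]
      simp
    exact_mod_cast this
  rw [Finset.card_product] at main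
  rw [s2_eq, s2_eq]
  refine le_trans ?_ tc
  exact_mod_cast main

end TSF

namespace TSF
open Filter Topology

theorem s2_zero_of_lt {n k : ℕ} (h : n < k) : s2 n k = 0 := by
  rw [s2_eq, Finset.card_eq_zero, Finset.eq_empty_iff_forall_notMem]
  intro w hw
  obtain ⟨h1, -, h3⟩ := mem_Sk.1 hw
  have := List.count_le_length (a := (0 : Fin 3)) (l := w)
  omega

theorem le_of_s2_pos {n k : ℕ} (h : 0 < s2 n k) : k ≤ n := by
  by_contra hc
  rw [s2_zero_of_lt (by omega)] at h
  omega

theorem s2_pos_anti {n m : ℕ} (h : m ≤ n) (hn : ∃ k, 0 < s2 n k) : ∃ k, 0 < s2 m k := by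
  obtain ⟨k, hk⟩ := hn
  rw [s2_eq, Finset.card_pos] at hk
  obtain ⟨w, hw⟩ := hk
  obtain ⟨h1, h2, -⟩ := mem_Sk.1 hw
  refine ⟨(w.take m).count 0, ?_⟩
  rw [s2_eq, Finset.card_pos]
  refine ⟨w.take m, mem_Sk.2 ⟨by simp [h1, h], ?_, rfl⟩⟩
  exact sf_of_isInfix h2 (List.take_prefix m w).isInfix

theorem sPoly_exp (n : ℕ) (t : ℝ) :
    sPoly n (Real.exp t) = ∑ k ∈ Finset.range (n + 1), (s2 n k : ℝ) * Real.exp (k * t) := by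
  unfold sPoly
  refine Finset.sum_congr rfl fun k _ => ?_
  rw [Real.exp_nat_mul]

theorem term_le (n k : ℕ) (t : ℝ) : (s2 n k : ℝ) * Real.exp (k * t) ≤ sPoly n (Real.exp t) := by
  rw [sPoly_exp]
  by_cases hk : k ≤ n
  · exact Finset.single_le_sum (f := fun k : ℕ => (s2 n k : ℝ) * Real.exp (k * t))
      (fun i _ => by positivity) (Finset.mem_range.2 (by omega))
  · rw [s2_zero_of_lt (by omega)]
    simp only [Nat.cast_zero, zero_mul]
    exact Finset.sum_nonneg fun i _ => by positivity

theorem sPoly_pos {n : ℕ} (h : ∃ k, 0 < s2 n k) (t : ℝ) : 0 < sPoly n (Real.exp t) := by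
  obtain ⟨k, hk⟩ := h
  have hk' : (0 : ℝ) < s2 n k := by exact_mod_cast hk
  exact lt_of_lt_of_le (by positivity) (term_le n k t)

theorem log_term_le {n k : ℕ} (h : 0 < s2 n k) (t : ℝ) :
    Real.log (s2 n k) + k * t ≤ Real.log (sPoly n (Real.exp t)) := by
  have hk' : (0 : ℝ) < s2 n k := by exact_mod_cast h
  have := Real.log_le_log (by positivity) (term_le n k t)
  rwa [Real.log_mul hk'.ne' (Real.exp_pos _).ne', Real.log_exp] at this

theorem exists_max {n : ℕ} (h : ∃ k, 0 < s2 n k) (t : ℝ) : ∃ k, 0 < s2 n k ∧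
    Real.log (sPoly n (Real.exp t)) ≤ Real.log (n + 1) + (Real.log (s2 n k) + k * t) := by
  have hS := sPoly_pos h t
  obtain ⟨k, hk, hmax⟩ := Finset.exists_max_image (Finset.range (n + 1))
    (fun k : ℕ => (s2 n k : ℝ) * Real.exp (k * t)) ⟨0, by simp⟩
  have hle : sPoly n (Real.exp t) ≤ (n + 1) * ((s2 n k : ℝ) * Real.exp (k * t)) := by
    rw [sPoly_exp]
    refine (Finset.sum_le_card_nsmul _ _ _ hmax).trans ?_
    simp
  have hp : 0 < s2 n k := by
    rcases Nat.eq_zero_or_pos (s2 n k) with h0 | h0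
    · rw [h0] at hle; simp at hle; linarith
    · exact h0
  have hp' : (0 : ℝ) < s2 n k := by exact_mod_cast hp
  refine ⟨k, hp, ?_⟩
  have := Real.log_le_log hS hle
  rwa [Real.log_mul (by positivity) (by positivity), Real.log_mul hp'.ne' (Real.exp_pos _).ne', Real.log_exp] at this

theorem ev_log (κ : ℝ) (hκ : 0 < κ) (a b : ℝ) (ha : 0 < a) (hb : 0 ≤ b) (K : ℝ) :
    ∀ᶠ n : ℕ in atTop, 8 * Real.log (a * n + b) + K ≤ κ * n := by
  have h1 : Tendsto (fun x : ℝ => a * x + b) atTop atTop :=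
    tendsto_atTop_add_const_right _ _ (tendsto_id.const_mul_atTop ha)
  have h2 := (Real.isLittleO_log_id_atTop.comp_tendsto h1).bound (c := κ / (32 * a)) (by positivity)
  have h3 := h2.natCast_atTop
  have h4 : Tendsto (fun n : ℕ => (n : ℝ)) atTop atTop := tendsto_natCast_atTop_atTop
  filter_upwards [h3, h4.eventually_ge_atTop (b / a), h4.eventually_ge_atTop (2 * |K| / κ), h4.eventually_ge_atTop 0] with n h5 h6 h7 h8
  simp only [Function.comp, id, Real.norm_eq_abs] at h5
  have h9 : |a * (n : ℝ) + b| = a * n + b := abs_of_nonneg (by positivity)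
  rw [h9] at h5
  have h10 := (le_abs_self _).trans h5
  rw [div_le_iff₀ ha] at h6
  rw [div_le_iff₀ hκ] at h7
  have h11 : κ / (32 * a) * (a * n + b) ≤ κ / (32 * a) * (2 * (a * n)) := by
    apply mul_le_mul_of_nonneg_left _ (by positivity); linarith
  have h12 : κ / (32 * a) * (2 * (a * n)) = κ * n / 16 := by field_simp; ring
  have := le_abs_self K
  linarith

theorem ev_lim {u : ℕ → ℝ} {g : ℝ} (h : Tendsto (fun n : ℕ => u n / n) atTop (𝓝 g)) {κ : ℝ} (hκ : 0 < κ) :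
    ∀ᶠ n : ℕ in atTop, n * (g - κ) ≤ u n ∧ u n ≤ n * (g + κ) := by
  filter_upwards [h.eventually_const_le (show g - κ < g by linarith),
    h.eventually_le_const (show g < g + κ by linarith), eventually_gt_atTop 0] with n h1 h2 h3
  have h3' : (0 : ℝ) < n := by exact_mod_cast h3
  rw [le_div_iff₀ h3'] at h1
  rw [div_le_iff₀ h3'] at h2
  constructor <;> linarith

theorem tilt_lo {G : ℝ → ℝ}
  (hG : ∀ t, Tendsto (fun n : ℕ => Real.log (sPoly n (Real.exp t)) / n) atTop (𝓝 (G t)))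
  (hne : ∀ n, ∃ k, 0 < s2 n k) {ε s : ℝ} (hmin : ∀ t, G s - ε * s ≤ G t - ε * t)
    {η : ℝ} (h0 : 0 < η) (h1 : η ≤ 1) : ∀ᶠ n : ℕ in atTop, ∃ k, 0 < s2 n k ∧
    (k : ℝ) ≤ (ε + η) * n ∧ n * (G s - η) ≤ Real.log (s2 n k) + k * s := by
  obtain ⟨θ, hθ⟩ : ∃ θ, θ = η / (2 * (1 + |ε|)) := ⟨_, rfl⟩
  have hε := abs_nonneg ε
  have hε' := le_abs_self ε
  have hθ0 : 0 < θ := by rw [hθ]; positivity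
  have hθ2 : θ * (1 + |ε|) = η / 2 := by rw [hθ]; field_simp
  have hθ1 : θ ≤ 1 / 2 := by nlinarith
  have hκ : 0 < η * θ / 3 := by positivity
  filter_upwards [ev_lim (hG (s - θ)) hκ, ev_lim (hG s) hκ, ev_log _ hκ 1 1 one_pos zero_le_one 0] with n e1 e2 e3
  obtain ⟨k, hk, hk2⟩ := exists_max (hne n) (s - θ)
  have hk3 := log_term_le hk s
  have hm := hmin (s - θ)
  have hn : (0 : ℝ) ≤ n := Nat.cast_nonneg n
  have hk0 : (0 : ℝ) ≤ k := Nat.cast_nonneg k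
  have hl : 0 ≤ Real.log (1 * (n : ℝ) + 1) := Real.log_nonneg (by linarith)
  rw [one_mul] at hl e3
  have hm' : n * (G s - G (s - θ)) ≤ n * (ε * θ) := mul_le_mul_of_nonneg_left (by linarith) hn
  refine ⟨k, hk, ?_, ?_⟩
  · have : θ * (k : ℝ) ≤ θ * ((ε + η) * n) := by nlinarith
    exact le_of_mul_le_mul_left this hθ0
  · have a1 : ε * θ ≤ η / 2 := by nlinarith
    have a2 : n * (ε * θ) ≤ n * (η / 2) := mul_le_mul_of_nonneg_left a1 hn
    have a3 : η * θ ≤ η * (1 / 2) := mul_le_mul_of_nonneg_left hθ1 h0.le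
    have a4 : n * (η * θ) ≤ n * (η * (1 / 2)) := mul_le_mul_of_nonneg_left a3 hn
    have a5 : 0 ≤ k * θ := by positivity
    have a6 : 0 ≤ n * η := by positivity
    linarith [e1.1]

theorem tilt_hi {G : ℝ → ℝ}
  (hG : ∀ t, Tendsto (fun n : ℕ => Real.log (sPoly n (Real.exp t)) / n) atTop (𝓝 (G t)))
  (hne : ∀ n, ∃ k, 0 < s2 n k) {ε s : ℝ} (hmin : ∀ t, G s - ε * s ≤ G t - ε * t)
    {η : ℝ} (h0 : 0 < η) (h1 : η ≤ 1) : ∀ᶠ n : ℕ in atTop, ∃ k, 0 < s2 n k ∧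
    (ε - η) * n ≤ (k : ℝ) ∧ n * (G s - η) ≤ Real.log (s2 n k) + k * s := by
  obtain ⟨θ, hθ⟩ : ∃ θ, θ = η / (2 * (1 + |ε|)) := ⟨_, rfl⟩
  have hε := abs_nonneg ε
  have hε' := neg_abs_le ε
  have hθ0 : 0 < θ := by rw [hθ]; positivity
  have hθ2 : θ * (1 + |ε|) = η / 2 := by rw [hθ]; field_simp
  have hθ1 : θ ≤ 1 / 2 := by nlinarith
  have hκ : 0 < η * θ / 3 := by positivity
  filter_upwards [ev_lim (hG (s + θ)) hκ, ev_lim (hG s) hκ, ev_log _ hκ 1 1 one_pos zero_le_one 0] with n e1 e2 e3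
  obtain ⟨k, hk, hk2⟩ := exists_max (hne n) (s + θ)
  have hk3 := log_term_le hk s
  have hm := hmin (s + θ)
  have hn : (0 : ℝ) ≤ n := Nat.cast_nonneg n
  have hk0 : (0 : ℝ) ≤ k := Nat.cast_nonneg k
  have hl : 0 ≤ Real.log (1 * (n : ℝ) + 1) := Real.log_nonneg (by linarith)
  have hkn : (k : ℝ) ≤ n := by exact_mod_cast le_of_s2_pos hk
  rw [one_mul] at hl e3
  have hm' : n * (ε * θ) ≤ n * (G (s + θ) - G s) := mul_le_mul_of_nonneg_left (by linarith) hn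
  refine ⟨k, hk, ?_, ?_⟩
  · have : θ * ((ε - η) * n) ≤ θ * (k : ℝ) := by nlinarith
    exact le_of_mul_le_mul_left this hθ0
  · have a1 : θ - ε * θ ≤ η / 2 := by nlinarith
    have a2 : n * (θ - ε * θ) ≤ n * (η / 2) := mul_le_mul_of_nonneg_left a1 hn
    have a3 : η * θ ≤ η * (1 / 2) := mul_le_mul_of_nonneg_left hθ1 h0.le
    have a4 : n * (η * θ) ≤ n * (η * (1 / 2)) := mul_le_mul_of_nonneg_left a3 hn
    have a5 : k * θ ≤ n * θ := mul_le_mul_of_nonneg_right hkn hθ0.le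
    have a6 : 0 ≤ n * η := by positivity
    linarith [e1.1]

theorem unif_upper {G : ℝ → ℝ} {s : ℝ}
    (hG : Tendsto (fun n : ℕ => Real.log (sPoly n (Real.exp s)) / n) atTop (𝓝 (G s)))
    {η : ℝ} (h0 : 0 < η) : ∃ K : ℝ, ∀ l : ℕ, Real.log (sPoly l (Real.exp s)) ≤ K + l * (G s + η) := by
  obtain ⟨n0, hn0⟩ := eventually_atTop.1 (ev_lim hG h0)
  refine ⟨∑ l ∈ Finset.range n0, |Real.log (sPoly l (Real.exp s)) - l * (G s + η)|, fun l => ?_⟩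
  by_cases hl : n0 ≤ l
  · have := (hn0 l hl).2
    have : 0 ≤ ∑ l ∈ Finset.range n0, |Real.log (sPoly l (Real.exp s)) - l * (G s + η)| :=
      Finset.sum_nonneg fun _ _ => abs_nonneg _
    linarith
  · have := Finset.single_le_sum (f := fun l : ℕ => |Real.log (sPoly l (Real.exp s)) - l * (G s + η)|)
      (fun _ _ => abs_nonneg _) (Finset.mem_range.2 (not_le.1 hl))
    have h2 := le_abs_self (Real.log (sPoly l (Real.exp s)) - l * (G s + η))
    linarith

end TSF

namespace TSF
open Filter Topology

theorem s2_le_exp {n k : ℕ} {b : ℝ} (h : 0 < s2 n k → Real.log (s2 n k) ≤ b) : (s2 n k : ℝ) ≤ Real.exp b := by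
  rcases Nat.eq_zero_or_pos (s2 n k) with h0 | h0
  · rw [h0]; simpa using (Real.exp_pos b).le
  · have h1 : (0 : ℝ) < s2 n k := by exact_mod_cast h0
    exact (Real.log_le_iff_le_exp h1).1 (h h0)

set_option maxHeartbeats 2000000 in
theorem core_aux {G : ℝ → ℝ}
    (hG : ∀ t, Tendsto (fun n : ℕ => Real.log (sPoly n (Real.exp t)) / n) atTop (𝓝 (G t)))
    (hne : ∀ n, ∃ k, 0 < s2 n k) {ε s : ℝ} (hmin : ∀ t, G s - ε * s ≤ G t - ε * t)
    (hε1 : ε ≤ 1) {η : ℝ} (h0 : 0 < η) (h1 : η ≤ 1) (h2 : 4 * η ≤ ε) :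
    ∀ᶠ N : ℕ in atTop, ∃ c, 0 < s2 N c ∧ |(c : ℝ) - ε * N| ≤ 3 * η * N ∧
      N * (G s - ε * s - (15 + 6 * |s| + 3 * |G s|) * η) ≤ Real.log (s2 N c) := by
  obtain ⟨n1, hn1⟩ := eventually_atTop.1 (tilt_lo hG hne hmin h0 h1)
  obtain ⟨n2, hn2⟩ := eventually_atTop.1 (tilt_hi hG hne hmin h0 h1)
  obtain ⟨n3, hn3⟩ := gluing (δ := η / 4) (by positivity) (by linarith)
  obtain ⟨K, hK⟩ := unif_upper (hG s) h0
  have hcast : Tendsto (fun n : ℕ => (n : ℝ)) atTop atTop := tendsto_natCast_atTop_atTop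
  filter_upwards [eventually_ge_atTop n1, eventually_ge_atTop n2, eventually_ge_atTop n3,
    ev_log η h0 8 1 (by norm_num) zero_le_one (2 * K), hcast.eventually_ge_atTop (2 / η)] with N e1 e2 e3 e4 e5
  rw [div_le_iff₀ h0] at e5
  have hN0 : (0 : ℝ) < N := by
    by_contra hc
    have : (N : ℝ) = 0 := le_antisymm (not_lt.1 hc) (Nat.cast_nonneg N)
    rw [this] at e5; linarith
  obtain ⟨D, hD⟩ : ∃ D, D = ⌊η * (N : ℝ)⌋₊ := ⟨_, rfl⟩
  have hDle : (D : ℝ) ≤ η * N := by rw [hD]; exact Nat.floor_le (by positivity)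
  have hDge : η * N - 1 ≤ D := by
    have := Nat.lt_floor_add_one (η * (N : ℝ)); rw [hD]; linarith
  have hD0 : (0 : ℝ) ≤ D := Nat.cast_nonneg D
  obtain ⟨n, hn⟩ : ∃ n, n = N + D := ⟨_, rfl⟩
  have hnr : (n : ℝ) = N + D := by rw [hn]; push_cast; ring
  have hηN : η * N ≤ N := by nlinarith
  obtain ⟨k1, hk1, hk1a, hk1b⟩ := hn1 n (by omega)
  obtain ⟨k2, hk2, hk2a, hk2b⟩ := hn2 n (by omega)
  have glue := hn3 n (by omega)
  have hηη : η * η ≤ η := by nlinarith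
  have hDk2 : D ≤ k2 := by
    have : (D : ℝ) ≤ k2 := by
      refine hDle.trans (le_trans ?_ hk2a)
      rw [hnr]; nlinarith
    exact_mod_cast this
  have hDk2r : ((k2 - D : ℕ) : ℝ) = k2 - D := Nat.cast_sub hDk2
  obtain ⟨hi, hhi⟩ : ∃ hi, hi = max k1 ⌊ε * (N : ℝ)⌋₊ := ⟨_, rfl⟩
  obtain ⟨lo, hlo⟩ : ∃ lo, lo = min (k2 - D) hi := ⟨_, rfl⟩
  have hεN : 0 ≤ ε * N := by nlinarith
  have hhir : (hi : ℝ) ≤ ε * N + 3 * η * N := by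
    have a1 : (⌊ε * (N : ℝ)⌋₊ : ℝ) ≤ ε * N := Nat.floor_le hεN
    have a2 : (k1 : ℝ) ≤ ε * N + 3 * η * N := by
      refine hk1a.trans ?_
      rw [hnr]
      have b1 : (ε + η) * D ≤ (ε + η) * (η * N) := mul_le_mul_of_nonneg_left hDle (by linarith)
      have b2 : (ε + η) * (η * N) ≤ 2 * (η * N) := mul_le_mul_of_nonneg_right (by linarith) (by positivity)
      linarith
    rw [hhi, Nat.cast_max]
    refine max_le a2 (a1.trans ?_)
    have : 0 ≤ η * N := by positivity
    linarith
  have hlor : ε * N - 3 * η * N ≤ lo := by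
    have a1 : ε * N - 1 ≤ (⌊ε * (N : ℝ)⌋₊ : ℝ) := by
      have := Nat.lt_floor_add_one (ε * (N : ℝ)); linarith
    have a2 : ε * N - 3 * η * N ≤ ((k2 - D : ℕ) : ℝ) := by
      rw [hDk2r]
      rw [hnr] at hk2a
      have : 0 ≤ (ε - η) * D := mul_nonneg (by linarith) hD0
      nlinarith
    rw [hlo, Nat.cast_min]
    refine le_min a2 ?_
    rw [hhi, Nat.cast_max]
    refine le_trans ?_ (le_max_right _ _)
    linarith
  by_contra hcon
  push Not at hcon
  obtain ⟨g, hg⟩ : ∃ g, g = G s := ⟨_, rfl⟩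
  rw [← hg] at hK hk1b hk2b hcon
  obtain ⟨M, hM⟩ : ∃ M, M = 15 + 6 * |s| + 3 * |g| := ⟨_, rfl⟩
  rw [← hM] at hcon
  have hcomb := comb (n := n) (N := N) (D := D) (k1 := k1) (k2 := k2) (lo := lo) (hi := hi) hn.symm
    (by omega) (by omega) (by omega)
    (by
      intro W1 W2 l1 l2 s1 s2
      obtain ⟨g1, g2, V, c1, c2, c3, c4⟩ := glue W1 W2 l1 l2 s1 s2
      have hb : η / 4 * n ≤ D := by rw [hnr]; nlinarith
      exact ⟨g1, g2, V, by exact_mod_cast c1.trans hb, by exact_mod_cast c2.trans hb,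
        by exact_mod_cast c3.trans hb, c4⟩)
    (B := Real.exp (2 * K + (n * (g + η) + 2 * D * |g + η|) + (3 * D * |s| - (k1 + k2) * s) +
      N * (g - M * η + 3 * η * |s|))) (Real.exp_pos _).le
    (by
      intro j r c0 c c2 i1 i2 i3 i4 i5 i6
      have q1 : (s2 j c0 : ℝ) ≤ Real.exp (K + j * (g + η) - c0 * s) := s2_le_exp fun hp => by
        have := log_term_le hp s
        have := hK j
        linarith
      have q2 : (s2 r c2 : ℝ) ≤ Real.exp (K + r * (g + η) - c2 * s) := s2_le_exp fun hp => by
        have := log_term_le hp s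
        have := hK r
        linarith
      have i3' : (lo : ℝ) ≤ c := by exact_mod_cast i3
      have i4' : (c : ℝ) ≤ hi := by exact_mod_cast i4
      have hc : |(c : ℝ) - ε * N| ≤ 3 * η * N := by rw [abs_le]; constructor <;> linarith
      have q3 : (s2 N c : ℝ) ≤ Real.exp (N * (g - ε * s - M * η)) := s2_le_exp fun hp => (hcon c hp hc).le
      have q4 : (s2 j c0 : ℝ) * s2 N c * s2 r c2 ≤ Real.exp (K + j * (g + η) - c0 * s) *
          Real.exp (N * (g - ε * s - M * η)) * Real.exp (K + r * (g + η) - c2 * s) := by gcongr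
      refine q4.trans ?_
      rw [← Real.exp_add, ← Real.exp_add, Real.exp_le_exp]
      have i1' : (j : ℝ) + r ≤ n + 2 * D := by exact_mod_cast i1
      have i2' : (n : ℝ) ≤ j + r + D := by exact_mod_cast i2
      have i5' : (k1 : ℝ) + k2 ≤ c0 + c + c2 + 3 * D := by exact_mod_cast i5
      have i6' : (c0 : ℝ) + c + c2 ≤ k1 + k2 + 3 * D := by exact_mod_cast i6
      have z1 : ((j : ℝ) + r - n) * (g + η) ≤ 2 * D * |g + η| := by
        refine (le_abs_self _).trans ?_
        rw [abs_mul]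
        refine mul_le_mul_of_nonneg_right ?_ (abs_nonneg _)
        rw [abs_le]; constructor <;> linarith
      have z2 : ((k1 : ℝ) + k2 - (c0 + c + c2)) * s ≤ 3 * D * |s| := by
        refine (le_abs_self _).trans ?_
        rw [abs_mul]
        refine mul_le_mul_of_nonneg_right ?_ (abs_nonneg _)
        rw [abs_le]; constructor <;> linarith
      have z3 : ((c : ℝ) - ε * N) * s ≤ 3 * η * N * |s| := by
        refine (le_abs_self _).trans ?_
        rw [abs_mul]
        exact mul_le_mul_of_nonneg_right hc (abs_nonneg _)
      linarith)
  have p1 : (0 : ℝ) < s2 n k1 := by exact_mod_cast hk1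
  have p2 : (0 : ℝ) < s2 n k2 := by exact_mod_cast hk2
  have hl := Real.log_le_log (mul_pos p1 p2) hcomb
  have hn0 : (0 : ℝ) ≤ n := Nat.cast_nonneg n
  rw [Real.log_mul p1.ne' p2.ne', Real.log_mul (by positivity) (by positivity),
    Real.log_mul (by positivity) (by positivity), Real.log_pow, Real.log_pow, Real.log_exp] at hl
  have l9 : Real.log 9 ≤ 4 := by
    have : (9 : ℝ) = 3 ^ 2 := by norm_num
    rw [this, Real.log_pow]
    have := Real.log_le_sub_one_of_pos (show (0 : ℝ) < 3 by norm_num)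
    push_cast; linarith
  have l9' : (D : ℝ) * Real.log 9 ≤ D * 4 := mul_le_mul_of_nonneg_left l9 hD0
  have hlog : Real.log (4 * (n : ℝ) + 1) ≤ Real.log (8 * N + 1) :=
    Real.log_le_log (by positivity) (by rw [hnr]; linarith)
  push_cast at hl
  have w1 : |g + η| ≤ |g| + 1 := (abs_add_le _ _).trans (by rw [abs_of_pos h0]; linarith)
  have w2 : (D : ℝ) * |g + η| ≤ D * (|g| + 1) := mul_le_mul_of_nonneg_left w1 hD0
  have w3 : -((D : ℝ) * |g|) ≤ D * g := by
    have := mul_le_mul_of_nonneg_left (neg_abs_le g) hD0; linarith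
  have w4 : (D : ℝ) * (6 + 3 * |g| + 3 * |s|) ≤ η * N * (6 + 3 * |g| + 3 * |s|) :=
    mul_le_mul_of_nonneg_right hDle (by positivity)
  have w5 : (n : ℝ) * η ≤ 2 * N * η := mul_le_mul_of_nonneg_right (by linarith) h0.le
  have w6 : 0 < η * N := by positivity
  have hMη : N * (M * η) = η * N * (15 + 6 * |s| + 3 * |g|) := by rw [hM]; ring
  have hng : (n : ℝ) * g = N * g + D * g := by rw [hnr]; ring
  linarith

theorem core {G : ℝ → ℝ}
    (hG : ∀ t, Tendsto (fun n : ℕ => Real.log (sPoly n (Real.exp t)) / n) atTop (𝓝 (G t)))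
    (hne : ∀ n, ∃ k, 0 < s2 n k) {ε s : ℝ} (hmin : ∀ t, G s - ε * s ≤ G t - ε * t)
    (hε0 : 0 < ε) (hε1 : ε ≤ 1) {η : ℝ} (h0 : 0 < η) :
    ∀ᶠ N : ℕ in atTop, ∃ c, 0 < s2 N c ∧ max (|(c : ℝ) / N - ε|) (G s - ε * s - Real.log (s2 N c) / N) ≤ η := by
  obtain ⟨M, hM⟩ : ∃ M, M = 15 + 6 * |s| + 3 * |G s| := ⟨_, rfl⟩
  have hM0 : 15 ≤ M := by rw [hM]; linarith [abs_nonneg s, abs_nonneg (G s)]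
  obtain ⟨κ, hκ⟩ : ∃ κ, κ = min (ε / 4) (η / M) := ⟨_, rfl⟩
  have hκ0 : 0 < κ := by rw [hκ]; exact lt_min (by positivity) (by positivity)
  have hκ1 : κ ≤ ε / 4 := hκ ▸ min_le_left _ _
  have hκ2 : κ ≤ η / M := hκ ▸ min_le_right _ _
  rw [le_div_iff₀ (by linarith)] at hκ2
  filter_upwards [core_aux hG hne hmin hε1 hκ0 (by linarith) (by linarith), eventually_gt_atTop 0] with N h1 h2
  obtain ⟨c, c1, c2, c3⟩ := h1
  rw [← hM] at c3
  have hN : (0 : ℝ) < N := by exact_mod_cast h2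
  refine ⟨c, c1, max_le ?_ ?_⟩
  · have : (c : ℝ) / N - ε = (c - ε * N) / N := by field_simp
    rw [this, abs_div, abs_of_pos hN, div_le_iff₀ hN]
    refine c2.trans (mul_le_mul_of_nonneg_right ?_ hN.le)
    nlinarith
  · have : G s - ε * s - M * κ ≤ Real.log (s2 N c) / N := by
      rw [le_div_iff₀ hN]; linarith
    linarith

theorem diag {G : ℝ → ℝ}
    (hG : ∀ t, Tendsto (fun n : ℕ => Real.log (sPoly n (Real.exp t)) / n) atTop (𝓝 (G t)))
    (hne : ∀ n, ∃ k, 0 < s2 n k) {ε s : ℝ} (hmin : ∀ t, G s - ε * s ≤ G t - ε * t)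
    (hε0 : 0 < ε) (hε1 : ε ≤ 1) : ∃ k : ℕ → ℕ, Tendsto (fun n : ℕ => (k n : ℝ) / n) atTop (𝓝 ε) ∧
      Tendsto (fun n : ℕ => Real.log (s2 n (k n)) / n) atTop (𝓝 (G s - ε * s)) := by
  let f : ℕ → ℕ → ℝ := fun N c => max (|(c : ℝ) / N - ε|) (G s - ε * s - Real.log (s2 N c) / N)
  have hex : ∀ N, ∃ k, 0 < s2 N k ∧ ∀ c, 0 < s2 N c → f N k ≤ f N c := by
    intro N
    obtain ⟨c0, hc0⟩ := hne N
    obtain ⟨k, hk, hm⟩ := Finset.exists_min_image ((Finset.range (N + 1)).filter fun c => 0 < s2 N c) (f N)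
      ⟨c0, by simp [hc0, Nat.lt_succ_of_le (le_of_s2_pos hc0)]⟩
    refine ⟨k, (Finset.mem_filter.1 hk).2, fun c hc => hm c ?_⟩
    simp [hc, Nat.lt_succ_of_le (le_of_s2_pos hc)]
  choose k hk hkm using hex
  have hle : ∀ η > 0, ∀ᶠ N : ℕ in atTop, f N (k N) ≤ η := by
    intro η hη
    filter_upwards [core hG hne hmin hε0 hε1 hη] with N h
    obtain ⟨c, c1, c2⟩ := h
    exact (hkm N c c1).trans c2
  have hk1 : Tendsto (fun n : ℕ => (k n : ℝ) / n) atTop (𝓝 ε) := by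
    rw [Metric.tendsto_nhds]
    intro η hη
    filter_upwards [hle (η / 2) (by positivity)] with N h
    rw [Real.dist_eq]
    have := (le_max_left _ _).trans h
    linarith
  refine ⟨k, hk1, ?_⟩
  have hup : Tendsto (fun n : ℕ => Real.log (sPoly n (Real.exp s)) / n - (k n : ℝ) / n * s) atTop
    (𝓝 (G s - ε * s)) := (hG s).sub (hk1.mul_const s)
  rw [tendsto_order]
  constructor
  · intro a ha
    filter_upwards [hle ((G s - ε * s - a) / 2) (by linarith)] with N h
    have := (le_max_right _ _).trans h
    linarith
  · intro a ha
    filter_upwards [hup.eventually_lt_const ha] with N h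
    refine lt_of_le_of_lt ?_ h
    rw [div_mul_eq_mul_div, ← sub_div]
    have := log_term_le (hk N) s
    gcongr
    linarith

end TSF

namespace TSF
open Filter Topology

theorem G_lip {G : ℝ → ℝ}
    (hG : ∀ t, Tendsto (fun n : ℕ => Real.log (sPoly n (Real.exp t)) / n) atTop (𝓝 (G t)))
    (hne : ∀ n, ∃ k, 0 < s2 n k) (t t' : ℝ) : G t ≤ G t' + dist t t' := by
  refine le_of_tendsto_of_tendsto (hG t) ((hG t').add_const (dist t t')) ?_
  filter_upwards [eventually_gt_atTop 0] with n hn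
  have hn' : (0 : ℝ) < n := by exact_mod_cast hn
  have h1 : sPoly n (Real.exp t) ≤ Real.exp (n * dist t t') * sPoly n (Real.exp t') := by
    rw [sPoly_exp, sPoly_exp, Finset.mul_sum]
    refine Finset.sum_le_sum fun k hk => ?_
    have hk' : (k : ℝ) ≤ n := by
      have := Finset.mem_range.1 hk
      exact_mod_cast Nat.lt_succ_iff.1 this
    have : Real.exp (k * t) ≤ Real.exp (n * dist t t') * Real.exp (k * t') := by
      rw [← Real.exp_add, Real.exp_le_exp, Real.dist_eq]
      have a1 : (k : ℝ) * (t - t') ≤ k * |t - t'| := mul_le_mul_of_nonneg_left (le_abs_self _) (Nat.cast_nonneg k)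
      have a2 : (k : ℝ) * |t - t'| ≤ n * |t - t'| := mul_le_mul_of_nonneg_right hk' (abs_nonneg _)
      linarith
    calc (s2 n k : ℝ) * Real.exp (k * t) ≤ s2 n k * (Real.exp (n * dist t t') * Real.exp (k * t')) := by gcongr
      _ = _ := by ring
  have h2 := Real.log_le_log (sPoly_pos (hne n) t) h1
  rw [Real.log_mul (Real.exp_pos _).ne' (sPoly_pos (hne n) t').ne', Real.log_exp] at h2
  rw [div_add' _ _ _ hn'.ne']
  gcongr
  linarith

theorem G_ge {G : ℝ → ℝ}
    (hG : ∀ t, Tendsto (fun n : ℕ => Real.log (sPoly n (Real.exp t)) / n) atTop (𝓝 (G t)))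
    {b : ℕ → ℕ} (hb : ∀ n, 0 < s2 n (b n)) {c t : ℝ} (h : ∃ᶠ n : ℕ in atTop, c * t ≤ (b n : ℝ) / n * t) :
    c * t ≤ G t := by
  refine ge_of_tendsto_of_frequently (hG t) (h.mono fun n hn => hn.trans ?_)
  rw [div_mul_eq_mul_div]
  have h1 := log_term_le (hb n) t
  have h2 : 0 ≤ Real.log (s2 n (b n)) := Real.log_natCast_nonneg _
  gcongr
  linarith

theorem main_ne (F : ℝ → ℝ)
    (hF : ∀ q : ℝ, 0 < q →
      Filter.Tendsto (fun n : ℕ => Real.log (sPoly n q) / n) Filter.atTop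
        (nhds (F q)))
    (A B : ℕ → ℕ)
    (hA : ∀ n, A n = sInf {k : ℕ | 0 < s2 n k})
    (hB : ∀ n, B n = sSup {k : ℕ | 0 < s2 n k})
    (εminus εplus : ℝ)
    (hεminus : εminus = Filter.liminf (fun n : ℕ => (A n : ℝ) / n) Filter.atTop)
    (hεplus : εplus = Filter.limsup (fun n : ℕ => (B n : ℝ) / n) Filter.atTop)
    (P : ℝ → ℝ)
    (hP : ∀ ε : ℝ, P ε = ⨅ q : {q : ℝ // 0 < q}, (F q.1 - ε * Real.log q.1))
    (hne : ∀ n, ∃ k, 0 < s2 n k) :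
    ConcaveOn ℝ (Set.Ioo εminus εplus) P ∧
    ∀ ε ∈ Set.Ioo εminus εplus,
      BddBelow (Set.range fun q : {q : ℝ // 0 < q} => F q.1 - ε * Real.log q.1) ∧
      ∃ σ : ℕ → ℤ,
        Filter.Tendsto (fun n : ℕ => (σ n : ℝ) / n) Filter.atTop (nhds 0) ∧
        Filter.Tendsto (fun n : ℕ =>
            Real.log (s2 n (⌊ε * n⌋ + σ n).toNat) / n) Filter.atTop
          (nhds (P ε)) := by
  have hAm : ∀ n, 0 < s2 n (A n) := fun n => by rw [hA]; exact Nat.sInf_mem (hne n)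
  have hBm : ∀ n, 0 < s2 n (B n) := fun n => by
    rw [hB]; exact Nat.sSup_mem (hne n) ⟨n, fun k hk => le_of_s2_pos hk⟩
  have le1 : ∀ (b : ℕ → ℕ), (∀ n, 0 < s2 n (b n)) → ∀ n : ℕ, (b n : ℝ) / n ≤ 1 := fun b hb n =>
    div_le_one_of_le₀ (by exact_mod_cast le_of_s2_pos (hb n)) (Nat.cast_nonneg n)
  have ge0 : ∀ (b : ℕ → ℕ) (n : ℕ), 0 ≤ (b n : ℝ) / n := fun b n => by positivity
  have hm0 : 0 ≤ εminus := by
    rw [hεminus]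
    exact le_liminf_of_le (isBoundedUnder_of ⟨1, fun n => le1 A hAm n⟩).isCoboundedUnder_ge (Eventually.of_forall (ge0 A))
  have hp1 : εplus ≤ 1 := by
    rw [hεplus]
    exact limsup_le_of_le (isBoundedUnder_of ⟨0, fun n => ge0 B n⟩).isCoboundedUnder_le (Eventually.of_forall (le1 B hBm))
  obtain ⟨G, hGdef⟩ : ∃ G : ℝ → ℝ, ∀ t, G t = F (Real.exp t) := ⟨_, fun _ => rfl⟩
  have hG : ∀ t, Tendsto (fun n : ℕ => Real.log (sPoly n (Real.exp t)) / n) atTop (𝓝 (G t)) := fun t => by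
    rw [hGdef]; exact hF _ (Real.exp_pos t)
  have hcont : Continuous G := (LipschitzWith.of_le_add (G_lip hG hne)).continuous
  have hq : ∀ (ε : ℝ) (q : {q : ℝ // 0 < q}), F q.1 - ε * Real.log q.1 = G (Real.log q.1) - ε * Real.log q.1 := by
    intro ε q
    rw [hGdef, Real.exp_log q.2]
  have hcoer : ∀ ε ∈ Set.Ioo εminus εplus, ∃ ρ > 0, ∀ t, ρ * |t| ≤ G t - ε * t := by
    intro ε hε
    obtain ⟨c1, hc1, hc1'⟩ := exists_between hε.2
    obtain ⟨c2, hc2, hc2'⟩ := exists_between hε.1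
    have f1 : ∃ᶠ n : ℕ in atTop, c1 < (B n : ℝ) / n :=
      frequently_lt_of_lt_limsup (isBoundedUnder_of ⟨0, fun n => ge0 B n⟩).isCoboundedUnder_le (by rw [← hεplus]; exact hc1')
    have f2 : ∃ᶠ n : ℕ in atTop, (A n : ℝ) / n < c2 :=
      frequently_lt_of_liminf_lt (isBoundedUnder_of ⟨1, fun n => le1 A hAm n⟩).isCoboundedUnder_ge (by rw [← hεminus]; exact hc2)
    refine ⟨min (c1 - ε) (ε - c2), lt_min (by linarith) (by linarith), fun t => ?_⟩
    rcases le_total 0 t with ht | ht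
    · have h1 := G_ge hG hBm (c := c1) (t := t) (f1.mono fun n hn => mul_le_mul_of_nonneg_right hn.le ht)
      rw [abs_of_nonneg ht]
      have := mul_le_mul_of_nonneg_right (min_le_left (c1 - ε) (ε - c2)) ht
      linarith
    · have h1 := G_ge hG hAm (c := c2) (t := t) (f2.mono fun n hn => mul_le_mul_of_nonpos_right hn.le ht)
      rw [abs_of_nonpos ht]
      have := mul_le_mul_of_nonneg_right (min_le_right (c1 - ε) (ε - c2)) (neg_nonneg.2 ht)
      linarith
  have hbdd : ∀ ε ∈ Set.Ioo εminus εplus,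
      BddBelow (Set.range fun q : {q : ℝ // 0 < q} => F q.1 - ε * Real.log q.1) := by
    intro ε hε
    obtain ⟨ρ, hρ, h⟩ := hcoer ε hε
    refine ⟨0, ?_⟩
    rintro _ ⟨q, rfl⟩
    simp only
    rw [hq]
    exact le_trans (by positivity) (h _)
  have : Nonempty {q : ℝ // 0 < q} := ⟨⟨1, one_pos⟩⟩
  refine ⟨⟨convex_Ioo _ _, ?_⟩, fun ε hε => ⟨hbdd ε hε, ?_⟩⟩
  · intro x hx y hy a b ha hb hab
    simp only [smul_eq_mul]
    rw [hP (a * x + b * y)]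
    refine le_ciInf fun q => ?_
    have h1 : P x ≤ F q.1 - x * Real.log q.1 := by rw [hP]; exact ciInf_le (hbdd x hx) q
    have h2 : P y ≤ F q.1 - y * Real.log q.1 := by rw [hP]; exact ciInf_le (hbdd y hy) q
    have h3 := mul_le_mul_of_nonneg_left h1 ha
    have h4 := mul_le_mul_of_nonneg_left h2 hb
    have h5 : F q.1 = a * F q.1 + b * F q.1 := by rw [← add_mul, hab, one_mul]
    linarith
  · obtain ⟨ρ, hρ, hco⟩ := hcoer ε hε
    have hφ : Continuous fun t => G t - ε * t := by fun_prop
    have htend : Tendsto (fun t => G t - ε * t) (cocompact ℝ) atTop := by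
      refine tendsto_atTop_mono hco ?_
      exact (tendsto_norm_cocompact_atTop (E := ℝ)).const_mul_atTop hρ
    obtain ⟨s, hs⟩ := hφ.exists_forall_le htend
    have hPs : P ε = G s - ε * s := by
      rw [hP]
      refine le_antisymm ?_ (le_ciInf fun q => ?_)
      · refine (ciInf_le (hbdd ε hε) ⟨Real.exp s, Real.exp_pos s⟩).trans ?_
        simp only [Real.log_exp, hGdef, le_refl]
      · rw [hq]; exact hs _
    obtain ⟨k, hk1, hk2⟩ := diag hG hne hs (lt_of_le_of_lt hm0 hε.1) (hε.2.le.trans hp1)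
    refine ⟨fun n => (k n : ℤ) - ⌊ε * n⌋, ?_, ?_⟩
    · have hfl : Tendsto (fun n : ℕ => ((⌊ε * n⌋ : ℤ) : ℝ) / n) atTop (𝓝 ε) := by
        have hε0 : 0 ≤ ε := hm0.trans hε.1.le
        refine ((tendsto_nat_floor_mul_div_atTop hε0).comp tendsto_natCast_atTop_atTop).congr fun n => ?_
        simp only [Function.comp]
        rw [natCast_floor_eq_intCast_floor (by positivity)]
      have := hk1.sub hfl
      rw [sub_self] at this
      refine this.congr fun n => ?_
      push_cast
      rw [sub_div]
    · rw [hPs]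
      refine hk2.congr fun n => ?_
      rw [add_sub_cancel, Int.toNat_natCast]

theorem main_empty (A B : ℕ → ℕ)
    (hA : ∀ n, A n = sInf {k : ℕ | 0 < s2 n k})
    (hB : ∀ n, B n = sSup {k : ℕ | 0 < s2 n k})
    (εminus εplus : ℝ)
    (hεminus : εminus = Filter.liminf (fun n : ℕ => (A n : ℝ) / n) Filter.atTop)
    (hεplus : εplus = Filter.limsup (fun n : ℕ => (B n : ℝ) / n) Filter.atTop)
    (hne : ¬ ∀ n, ∃ k, 0 < s2 n k) : Set.Ioo εminus εplus = ∅ := by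
  rw [not_forall] at hne
  obtain ⟨n0, hn0⟩ := hne
  have hset : ∀ n ≥ n0, {k : ℕ | 0 < s2 n k} = ∅ := by
    intro n hn
    rw [Set.eq_empty_iff_forall_notMem]
    intro k hk
    exact hn0 (s2_pos_anti hn ⟨k, hk⟩)
  have hA0 : Tendsto (fun n : ℕ => (A n : ℝ) / n) atTop (𝓝 0) := by
    refine tendsto_const_nhds.congr' ?_
    filter_upwards [eventually_ge_atTop n0] with n hn
    rw [hA, hset n hn]; simp
  have hB0 : Tendsto (fun n : ℕ => (B n : ℝ) / n) atTop (𝓝 0) := by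
    refine tendsto_const_nhds.congr' ?_
    filter_upwards [eventually_ge_atTop n0] with n hn
    rw [hB, hset n hn]; simp
  rw [hεminus, hεplus, hA0.liminf_eq, hB0.limsup_eq, Set.Ioo_self]

end TSF

theorem ternary_squareFree_entropy_function (F : ℝ → ℝ)
    (hF : ∀ q : ℝ, 0 < q →
      Filter.Tendsto (fun n : ℕ => Real.log (sPoly n q) / n) Filter.atTop
        (nhds (F q)))
    (A B : ℕ → ℕ)
    (hA : ∀ n, A n = sInf {k : ℕ | 0 < s2 n k})
    (hB : ∀ n, B n = sSup {k : ℕ | 0 < s2 n k})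
    (εminus εplus : ℝ)
    (hεminus : εminus = Filter.liminf (fun n : ℕ => (A n : ℝ) / n) Filter.atTop)
    (hεplus : εplus = Filter.limsup (fun n : ℕ => (B n : ℝ) / n) Filter.atTop)
    (P : ℝ → ℝ)
    (hP : ∀ ε : ℝ, P ε = ⨅ q : {q : ℝ // 0 < q}, (F q.1 - ε * Real.log q.1)) :
    ConcaveOn ℝ (Set.Ioo εminus εplus) P ∧
    ∀ ε ∈ Set.Ioo εminus εplus,
      BddBelow (Set.range fun q : {q : ℝ // 0 < q} => F q.1 - ε * Real.log q.1) ∧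
      ∃ σ : ℕ → ℤ,
        Filter.Tendsto (fun n : ℕ => (σ n : ℝ) / n) Filter.atTop (nhds 0) ∧
        Filter.Tendsto (fun n : ℕ =>
            Real.log (s2 n (⌊ε * n⌋ + σ n).toNat) / n) Filter.atTop
          (nhds (P ε)) := by
  by_cases hne : ∀ n, ∃ k, 0 < s2 n k
  · exact TSF.main_ne F hF A B hA hB εminus εplus hεminus hεplus P hP hne
  · rw [TSF.main_empty A B hA hB εminus εplus hεminus hεplus hne]
    refine ⟨⟨convex_empty, fun x hx => absurd hx (Set.notMem_empty x)⟩, fun ε hε => absurd hε (Set.notMem_empty ε)⟩
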